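/- (Theorem 5.1, multivariate q,t-Kostka numbers for hooks, in N variables.) Let λ^1,…,λ^r be partitions with n = |λ^{[r]}| ≥ 1 and let N ≥ n. Then there exists a unique family (K̃_μ)_{μ ⊢ n, ℓ(μ) ≤ N} of rational functions in q and t such that Σ_{π ∈ 𝒫([r])} (−1)^{#π−1}(#π−1)! Π_{B∈π} H̃_{λ^B}^{(N)} = (q−1)^{r−1} · Σ_{μ ⊢ n, ℓ(μ) ≤ N} K̃_μ · s_μ^{(N)}(x_1,…,x_N); moreover, for every hook partition μ = (n−s, 1^s) with 0 ≤ s ≤ n−1, K̃_μ is the polynomial with nonnegative integer coefficients K̃_{(n−s,1^s)} = Σ_{{□_1,…,□_s} ⊆ λ^{[r]} ∖ {(1,1)}} 𝓘_{G^{□_1,…,□_s}}(q) · t^{ℓ'(□_1)+⋯+ℓ'(□_s)}, the sum running over all s-element sets of boxes of λ^{[r]} avoiding the corner box (1,1), where ℓ'(i,j) = j−1 is the coleg of a box. -/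

import Mathlib

open Finset

open scoped Classical

noncomputable section

/-! ### Set partitions -/

/-- `π` is a set partition of the finite set `H`. -/
def IsSetPartition {α : Type*} (π : Finset (Finset α)) (H : Finset α) : Prop :=
  (∀ B ∈ π, B ⊆ H) ∧ (∀ B ∈ π, B.Nonempty) ∧
    (∀ B ∈ π, ∀ C ∈ π, B ≠ C → Disjoint B C) ∧ (∀ a ∈ H, ∃ B ∈ π, a ∈ B)

/-- The finite set of all set partitions of `H`. -/
def setPartitions {α : Type*} (H : Finset α) : Finset (Finset (Finset α)) :=
  H.powerset.powerset.filter (fun π => IsSetPartition π H)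

/-- The joint cumulant of the family `u` on the subset `H`. -/
def jointCumulant {A : Type*} [CommRing A] {ι : Type*} (u : Finset ι → A) (H : Finset ι) : A :=
  ∑ π ∈ setPartitions H,
    (-1 : A) ^ (π.card - 1) * ((π.card - 1).factorial : A) * ∏ B ∈ π, u B

/-! ### Multigraphs -/

/-- Number of edges of the multigraph with endpoint map `ends` whose endpoint set is `{i,j}`. -/
def eCnt {V E : Type*} [Fintype E] (ends : E → Sym2 V) (i j : V) : ℕ :=
  (univ.filter fun e => ends e = s(i, j)).card

/-- The spanning subgraph `(V, S)` is connected. -/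
def SConnected {V E : Type*} (ends : E → Sym2 V) (S : Finset E) : Prop :=
  ∀ v w : V, Relation.ReflTransGen (fun a b => ∃ e ∈ S, ends e = s(a, b)) v w

/-- The subgraph `(B, S)` is connected. -/
def SConnectedOn {V E : Type*} (ends : E → Sym2 V) (B : Finset V) (S : Finset E) : Prop :=
  ∀ v ∈ B, ∀ w ∈ B, Relation.ReflTransGen (fun a b => ∃ e ∈ S, ends e = s(a, b)) v w

/-- `E|_B`: the edges with both endpoints in `B`. -/
def edgesIn {V E : Type*} [Fintype E] (ends : E → Sym2 V) (B : Finset V) : Finset E :=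
  univ.filter fun e => ∀ v ∈ ends e, v ∈ B

/-- `c_{G|_B}(q) = Σ_{S ⊆ E|_B, (B,S) connected} q^{#S}` as a polynomial in `q`. -/
def connPoly {V E : Type*} [Fintype E] (ends : E → Sym2 V) (B : Finset V) : Polynomial ℤ :=
  ∑ S ∈ (edgesIn ends B).powerset.filter (fun S => SConnectedOn ends B S),
    Polynomial.X ^ S.card

/-- Number of edges joining `w` to some vertex of `B`. -/
def dCnt {V E : Type*} [Fintype E] (ends : E → Sym2 V) (B : Finset V) (w : V) : ℕ :=
  (univ.filter fun e => ∃ b ∈ B, ends e = s(w, b)).card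

/-! ### The `G`-inversion polynomial -/

/-- `[m]_q = 1 + q + ⋯ + q^{m-1}`. -/
def nq {R : Type*} [CommSemiring R] (q : R) (m : ℕ) : R := ∑ k ∈ Finset.range m, q ^ k

/-- Rooted spanning trees (encoded by parent maps, rooted at `0`) of the simple graph `G̃`
underlying the multigraph on `Fin (r+1)` with edge multiplicities `e`. -/
def parentMaps {r : ℕ} (e : Fin (r+1) → Fin (r+1) → ℕ) : Finset (Fin (r+1) → Fin (r+1)) :=
  univ.filter fun p => p 0 = 0 ∧ (∀ w, w ≠ 0 → p w ≠ w ∧ 0 < e w (p w)) ∧ ∀ w, ∃ k, p^[k] w = 0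

/-- `(i,j)` is a `κ`-inversion of the spanning tree encoded by `p`. -/
def isKappaInv {r : ℕ} (e : Fin (r+1) → Fin (r+1) → ℕ) (p : Fin (r+1) → Fin (r+1))
    (i j : Fin (r+1)) : Prop :=
  i ≠ 0 ∧ j ≠ 0 ∧ i ≠ j ∧ (∃ k, p^[k] j = i) ∧ j < i ∧ p i ≠ j ∧ 0 < e j (p i)

/-- `κ(T) = Σ_{(i,j) κ-inversion} e_{parent(i), j}`. -/
def kappaStat {r : ℕ} (e : Fin (r+1) → Fin (r+1) → ℕ) (p : Fin (r+1) → Fin (r+1)) : ℕ :=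
  ∑ pr ∈ (univ ×ˢ univ : Finset (Fin (r+1) × Fin (r+1))).filter
    (fun pr => isKappaInv e p pr.1 pr.2), e (p pr.1) pr.2

/-- `δ_T(w) = Σ_u e_{u, parent(w)}`, `u` ranging over descendants of `w` together with `w`. -/
def deltaStat {r : ℕ} (e : Fin (r+1) → Fin (r+1) → ℕ) (p : Fin (r+1) → Fin (r+1))
    (w : Fin (r+1)) : ℕ :=
  ∑ u ∈ univ.filter (fun u => ∃ k, p^[k] u = w), e u (p w)

/-- The `G`-inversion polynomial `𝓘_G(q)` of the multigraph on `Fin (r+1)` with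
edge multiplicities `e`, evaluated at an element `q` of a commutative (semi)ring. -/
def Iinv {r : ℕ} {R : Type*} [CommSemiring R] (e : Fin (r+1) → Fin (r+1) → ℕ) (q : R) : R :=
  q ^ (∑ i, e i i) *
    ∑ p ∈ parentMaps e, q ^ kappaStat e p * ∏ w ∈ univ.erase (0 : Fin (r+1)), nq q (e w (p w))

/-! ### Partitions, Young diagrams and fillings -/

/-- `f : ℕ → ℕ` encodes a partition: `f j` is the `j`-th part (for `j ≥ 1`). -/
def IsPartitionFun (f : ℕ → ℕ) : Prop := Antitone f ∧ ∃ N, f N = 0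

/-- The number of (nonempty) rows of the diagram of `f`. -/
def nRows (f : ℕ → ℕ) : ℕ := sSup {j | f j ≠ 0}

/-- `λ^t_i`: the length of the `i`-th column of the diagram of `f`. -/
def colLen (f : ℕ → ℕ) (i : ℕ) : ℕ :=
  ((Finset.Icc 1 (nRows f)).filter (fun j => i ≤ f j)).card

/-- The cells `(i,j)`, `1 ≤ i ≤ f j`, `j ≥ 1`, of the Young diagram of `f`
(French convention, `i` the column index and `j` the row index). -/
def cells (f : ℕ → ℕ) : Finset (ℕ × ℕ) :=
  (Finset.Icc 1 (f 1) ×ˢ Finset.Icc 1 (nRows f)).filter (fun c => c.1 ≤ f c.2)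

/-- Fillings of the diagram of `f` with entries in `{1, …, N}`, encoded as functions
`ℕ × ℕ → ℕ` vanishing outside the diagram. -/
def fillings (f : ℕ → ℕ) (N : ℕ) : Finset ((ℕ × ℕ) → ℕ) :=
  ((cells f).pi (fun _ => Finset.Icc 1 N)).image
    (fun g c => if h : c ∈ cells f then g c h else 0)

/-- The descent set of a filling. -/
def desSet (f : ℕ → ℕ) (σ : (ℕ × ℕ) → ℕ) : Finset (ℕ × ℕ) :=
  (cells f).filter (fun c => 2 ≤ c.2 ∧ σ (c.1, c.2 - 1) < σ c)

/-- `maj(σ) = Σ_{□ ∈ Des(σ)} (leg(□) + 1)`. -/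
def majStat (f : ℕ → ℕ) (σ : (ℕ × ℕ) → ℕ) : ℕ :=
  ∑ c ∈ desSet f σ, (colLen f c.1 - c.2 + 1)

/-- The counterclockwise-increasing condition defining inversion pairs; the box below `c1`
is read via `σ`, which vanishes off the diagram (giving the convention `σ(□_3) = 0`). -/
def invTriple (σ : (ℕ × ℕ) → ℕ) (c1 c2 : ℕ × ℕ) : Prop :=
  (σ c1 ≤ σ (c1.1, c1.2 - 1) ∧ σ (c1.1, c1.2 - 1) < σ c2) ∨
  (σ (c1.1, c1.2 - 1) < σ c2 ∧ σ c2 < σ c1) ∨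
  (σ c2 < σ c1 ∧ σ c1 ≤ σ (c1.1, c1.2 - 1))

/-- The set of inversion pairs of a filling. -/
def invPairs (f : ℕ → ℕ) (σ : (ℕ × ℕ) → ℕ) : Finset ((ℕ × ℕ) × (ℕ × ℕ)) :=
  ((cells f) ×ˢ (cells f)).filter
    (fun pr => pr.1.2 = pr.2.2 ∧ pr.1.1 < pr.2.1 ∧ invTriple σ pr.1 pr.2)

/-- `inv(σ)`: the number of inversion pairs. -/
def invStat (f : ℕ → ℕ) (σ : (ℕ × ℕ) → ℕ) : ℕ := (invPairs f σ).card

/-! ### The ring `ℤ[q, t, x₁, x₂, …]` and Macdonald polynomials -/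

/-- The polynomial ring `ℤ[q, t, x₀, x₁, x₂, …]`. -/
abbrev MR : Type := MvPolynomial (Fin 2 ⊕ ℕ) ℤ

/-- The variable `q`. -/
def qv : MR := MvPolynomial.X (Sum.inl 0)

/-- The variable `t`. -/
def tv : MR := MvPolynomial.X (Sum.inl 1)

/-- The variable `x_k`. -/
def xv (k : ℕ) : MR := MvPolynomial.X (Sum.inr k)

/-- Haglund's formula: the modified Macdonald polynomial in the variables `x_1, …, x_N`. -/
def macH (f : ℕ → ℕ) (N : ℕ) : MR :=
  ∑ σ ∈ fillings f N, qv ^ invStat f σ * tv ^ majStat f σ * ∏ c ∈ cells f, xv (σ c)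

/-- `λ^B = ⊕_{b ∈ B} λ^b`. -/
def lamB {r : ℕ} (lam : Fin (r+1) → ℕ → ℕ) (B : Finset (Fin (r+1))) : ℕ → ℕ :=
  fun j => ∑ b ∈ B, lam b j

/-- The (unnormalized) Macdonald cumulant
`Σ_{π ∈ 𝒫([r])} (-1)^{#π-1} (#π-1)! Π_{B ∈ π} H̃_{λ^B}`. -/
def macCumulant {r : ℕ} (lam : Fin (r+1) → ℕ → ℕ) (N : ℕ) : MR :=
  ∑ π ∈ setPartitions (univ : Finset (Fin (r+1))),
    (-1 : MR) ^ (π.card - 1) * ((π.card - 1).factorial : MR) * ∏ B ∈ π, macH (lamB lam B) N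

/-! ### Coloring of the diagram `λ^B` -/

/-- Labels `(b, i)`, `b ∈ B`, `1 ≤ i ≤ λ^b_1`, of the columns of the diagrams `λ^b`, `b ∈ B`. -/
def columnPairs {r : ℕ} (lam : Fin (r+1) → ℕ → ℕ) (B : Finset (Fin (r+1))) :
    Finset (Fin (r+1) × ℕ) :=
  (B ×ˢ Finset.Icc 1 (lamB lam B 1)).filter (fun p => p.2 ≤ lam p.1 1)

/-- The column `p'` comes weakly before the column `p` in the sorted order
(longer first; ties first by color, then by column index). -/
def colBefore {r : ℕ} (lam : Fin (r+1) → ℕ → ℕ) (p' p : Fin (r+1) × ℕ) : Prop :=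
  colLen (lam p.1) p.2 < colLen (lam p'.1) p'.2 ∨
    (colLen (lam p'.1) p'.2 = colLen (lam p.1) p.2 ∧
      (p'.1 < p.1 ∨ (p'.1 = p.1 ∧ p'.2 ≤ p.2)))

/-- The position in `λ^B` of the column `i` of `λ^b`. -/
def posIn {r : ℕ} (lam : Fin (r+1) → ℕ → ℕ) (B : Finset (Fin (r+1)))
    (b : Fin (r+1)) (i : ℕ) : ℕ :=
  ((columnPairs lam B).filter (fun p' => colBefore lam p' (b, i))).card

/-- The label `(b, i)` of the column of `λ^B` at position `c`. -/
def colAt {r : ℕ} (lam : Fin (r+1) → ℕ → ℕ) (B : Finset (Fin (r+1))) (c : ℕ) :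
    Fin (r+1) × ℕ :=
  if h : ∃ p ∈ columnPairs lam B, posIn lam B p.1 p.2 = c then h.choose else (0, 1)

/-- The filling `σ^B` of `λ^B` induced from a filling `σ` of `λ^{[r]}` via the
identification of boxes given by the coloring. -/
def inducedFilling {r : ℕ} (lam : Fin (r+1) → ℕ → ℕ) (B : Finset (Fin (r+1)))
    (σ : (ℕ × ℕ) → ℕ) : (ℕ × ℕ) → ℕ :=
  fun cj =>
    if ∃ p ∈ columnPairs lam B, posIn lam B p.1 p.2 = cj.1 then
      σ (posIn lam univ (colAt lam B cj.1).1 (colAt lam B cj.1).2, cj.2)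
    else 0

/-- The color of the column `x` of `λ^{[r]}`. -/
def colColor {r : ℕ} (lam : Fin (r+1) → ℕ → ℕ) (x : ℕ) : Fin (r+1) :=
  (colAt lam univ x).1

/-- Edge multiplicities of the multigraph `G^σ`: the number of inversion pairs of `σ`
colored by `{i, j}`. -/
def eG {r : ℕ} (lam : Fin (r+1) → ℕ → ℕ) (σ : (ℕ × ℕ) → ℕ) (i j : Fin (r+1)) : ℕ :=
  ((invPairs (lamB lam univ) σ).filter (fun pr =>
    (colColor lam pr.1.1 = i ∧ colColor lam pr.2.1 = j) ∨
    (colColor lam pr.1.1 = j ∧ colColor lam pr.2.1 = i))).card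

/-- Edge multiplicities of the multigraph `G^{□_1,…,□_s}` attached to a set `D` of boxes:
for each box of `D` and each box strictly to its left in the same row, one edge joining
the colors of the two columns. -/
def eBox {r : ℕ} (lam : Fin (r+1) → ℕ → ℕ) (D : Finset (ℕ × ℕ)) (i j : Fin (r+1)) : ℕ :=
  ((D ×ˢ cells (lamB lam univ)).filter (fun pr =>
    pr.2.2 = pr.1.2 ∧ pr.2.1 < pr.1.1 ∧
      ((colColor lam pr.2.1 = i ∧ colColor lam pr.1.1 = j) ∨
       (colColor lam pr.2.1 = j ∧ colColor lam pr.1.1 = i)))).card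


/-- The field `ℚ(q,t)` of rational functions in `q` and `t`. -/
abbrev KField : Type := FractionRing (MvPolynomial (Fin 2) ℤ)

/-- The inclusion `ℤ[q,t,x₀,x₁,…] → ℚ(q,t)[x₀,x₁,…]`. -/
def toK : MR →ₐ[ℤ] MvPolynomial ℕ KField :=
  MvPolynomial.aeval (Sum.elim
    (fun i : Fin 2 =>
      MvPolynomial.C (algebraMap (MvPolynomial (Fin 2) ℤ) KField (MvPolynomial.X i)))
    (fun k : ℕ => (MvPolynomial.X k : MvPolynomial ℕ KField)))

/-- The partitions of `n` with at most `N` parts, encoded as functions `ℕ → ℕ`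
(the `j`-th part for `j ≥ 1`, and `0` for `j = 0` or `j > N`). -/
def partFinset (n N : ℕ) : Finset (ℕ → ℕ) :=
  ((univ : Finset (Fin N → Fin (n+1))).filter fun m =>
      (∀ a b : Fin N, a ≤ b → (m b : ℕ) ≤ (m a : ℕ)) ∧ (∑ a, (m a : ℕ)) = n).image
    fun m j => if h : 1 ≤ j ∧ j ≤ N then (m ⟨j - 1, by omega⟩ : ℕ) else 0

/-- Semistandard Young tableaux of shape `f` with entries in `{1, …, N}`: entries weakly
increasing along rows and strictly increasing up columns. -/
def ssytFinset (f : ℕ → ℕ) (N : ℕ) : Finset ((ℕ × ℕ) → ℕ) :=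
  (fillings f N).filter (fun T =>
    (∀ c ∈ cells f, ∀ c' ∈ cells f, c.2 = c'.2 → c.1 ≤ c'.1 → T c ≤ T c') ∧
    (∀ c ∈ cells f, ∀ c' ∈ cells f, c.1 = c'.1 → c.2 < c'.2 → T c < T c'))

/-- The Schur polynomial `s_f(x_1, …, x_N)`, with coefficients in `ℚ(q,t)`. -/
def schurK (f : ℕ → ℕ) (N : ℕ) : MvPolynomial ℕ KField :=
  ∑ T ∈ ssytFinset f N, ∏ c ∈ cells f, MvPolynomial.X (T c)

/-- The hook partition `(n-s, 1^s)`, as a function `ℕ → ℕ`. -/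
def hookFun (n s : ℕ) : ℕ → ℕ :=
  fun j => if j = 1 then n - s else if 2 ≤ j ∧ j ≤ s + 1 then 1 else 0

/-- The hook coefficient
`Σ_{{□_1,…,□_s} ⊆ λ^{[r]}∖(1,1)} 𝓘_{G^{□_1,…,□_s}}(q) t^{ℓ'(□_1)+⋯+ℓ'(□_s)}` in `ℤ[q,t]`,
manifestly a polynomial with nonnegative integer coefficients. -/
def hookCoeff {r : ℕ} (lam : Fin (r+1) → ℕ → ℕ) (s : ℕ) : MvPolynomial (Fin 2) ℤ :=
  ∑ D ∈ ((cells (lamB lam univ)).erase (1, 1)).powersetCard s,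
    Iinv (eBox lam D) (MvPolynomial.X 0) * (MvPolynomial.X 1 : MvPolynomial (Fin 2) ℤ) ^
      (∑ c ∈ D, (c.2 - 1))

/-- `K` is a family of Schur-expansion coefficients (in `ℚ(q,t)`, supported on the
partitions of `n` with at most `N` parts) of the Macdonald cumulant of `lam`,
normalized by `(q-1)^{#[r]-1}`. -/
def SchurExpansion {r : ℕ} (lam : Fin (r+1) → ℕ → ℕ) (N n : ℕ)
    (K : (ℕ → ℕ) → KField) : Prop :=
  (∀ m, m ∉ partFinset n N → K m = 0) ∧
  toK (macCumulant lam N) =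
    MvPolynomial.C
        ((algebraMap (MvPolynomial (Fin 2) ℤ) KField) ((MvPolynomial.X 0 - 1) ^ r)) *
      ∑ m ∈ partFinset n N, MvPolynomial.C (K m) * schurK m N

/-! ### A symmetric two-letter sum -/

/-- The weight of the splitting `V = S ⊔ (V \ S)`. -/
def splitWt {α A : Type*} [DecidableEq α] [CommRing A] (g : α → α → A) (V S : Finset α) : A :=
  ∏ i ∈ S, ∏ j ∈ V \ S, g i j

/-- The generating polynomial of the two-letter words on `V`. -/
def pairSum {α A : Type*} [DecidableEq α] [CommRing A] (g : α → α → A) (V : Finset α)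
    (y z : A) : A :=
  ∑ S ∈ V.powerset, splitWt g V S * (y ^ S.card * z ^ (V \ S).card)

lemma splitWt_insert_left {α A : Type*} [DecidableEq α] [CommRing A] (g : α → α → A)
    {U T : Finset α} {a : α}
    (ha : a ∉ U) (hT : T ⊆ U) :
    splitWt g (insert a U) T = splitWt g U T * ∏ i ∈ T, g i a := by
  have haT : a ∉ T := fun h => ha (hT h)
  rw [splitWt, splitWt, ← Finset.prod_mul_distrib]
  refine Finset.prod_congr rfl fun i _ => ?_
  rw [insert_sdiff_of_notMem _ haT, prod_insert (by simp [ha]), mul_comm]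

lemma splitWt_insert_both {α A : Type*} [DecidableEq α] [CommRing A] (g : α → α → A)
    {U T : Finset α} {a : α}
    (ha : a ∉ U) (hT : T ⊆ U) :
    splitWt g (insert a U) (insert a T) = splitWt g U T * ∏ j ∈ U \ T, g a j := by
  have haT : a ∉ T := fun h => ha (hT h)
  have : insert a U \ insert a T = U \ T := by
    ext x; simp only [mem_sdiff, mem_insert]
    constructor
    · rintro ⟨h | h, h'⟩
      · exact absurd (Or.inl h) h'
      · exact ⟨h, fun h2 => h' (Or.inr h2)⟩
    · rintro ⟨h, h'⟩
      exact ⟨Or.inr h, fun h2 => h2.elim (fun h3 => ha (h3 ▸ h)) h'⟩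
  rw [splitWt, splitWt, this, prod_insert haT, mul_comm]

lemma card_insert_sdiff_left {α : Type*} [DecidableEq α] {U T : Finset α} {a : α} (ha : a ∉ U)
    (hT : T ⊆ U) :
    (insert a U \ T).card = (U \ T).card + 1 := by
  have haT : a ∉ T := fun h => ha (hT h)
  rw [insert_sdiff_of_notMem _ haT, card_insert_of_notMem (by simp [ha])]

lemma card_insert_sdiff_both {α : Type*} [DecidableEq α] {U T : Finset α} {a : α} (ha : a ∉ U) :
    (insert a U \ insert a T).card = (U \ T).card := by
  congr 1
  ext x; simp only [mem_sdiff, mem_insert]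
  constructor
  · rintro ⟨h | h, h'⟩
    · exact absurd (Or.inl h) h'
    · exact ⟨h, fun h2 => h' (Or.inr h2)⟩
  · rintro ⟨h, h'⟩
    exact ⟨Or.inr h, fun h2 => h2.elim (fun h3 => ha (h3 ▸ h)) h'⟩

lemma pairSum_insert {α A : Type*} [DecidableEq α] [CommRing A] (g : α → α → A) {U : Finset α}
    {a : α}
    (ha : a ∉ U) (y z : A) :
    pairSum g (insert a U) y z =
      ∑ T ∈ U.powerset, splitWt g U T * (∏ i ∈ T, g i a) * (y ^ T.card * z ^ (U \ T).card) * z +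
      ∑ T ∈ U.powerset,
        splitWt g U T * (∏ j ∈ U \ T, g a j) * (y ^ T.card * z ^ (U \ T).card) * y := by
  rw [pairSum, sum_powerset_insert ha]
  congr 1
  · refine sum_congr rfl fun T hT => ?_
    rw [mem_powerset] at hT
    rw [splitWt_insert_left g ha hT, card_insert_sdiff_left ha hT]; ring
  · refine sum_congr rfl fun T hT => ?_
    rw [mem_powerset] at hT
    rw [splitWt_insert_both g ha hT, card_insert_sdiff_both ha,
      card_insert_of_notMem (fun h => ha (hT h))]; ring

lemma pairSum_insert_isolated {α A : Type*} [DecidableEq α] [CommRing A] (g : α → α → A)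
    {U : Finset α} {a : α}
    (ha : a ∉ U) (h1 : ∀ i ∈ U, g i a = 1) (h2 : ∀ i ∈ U, g a i = 1) (y z : A) :
    pairSum g (insert a U) y z = pairSum g U y z * (y + z) := by
  rw [pairSum_insert g ha, mul_add, pairSum, sum_mul, sum_mul, add_comm]
  congr 1
  · refine sum_congr rfl fun T _ => ?_
    rw [prod_eq_one (fun i hi => h2 i (mem_sdiff.1 hi).1)]; ring
  · refine sum_congr rfl fun T hT => ?_
    rw [prod_eq_one (fun i hi => h1 i (mem_powerset.1 hT hi))]; ring

lemma splitWt_congr {α A : Type*} [DecidableEq α] [CommRing A] {g g' : α → α → A} {V S : Finset α}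
    (h : ∀ i ∈ S, ∀ j ∈ V \ S, g i j = g' i j) : splitWt g V S = splitWt g' V S :=
  prod_congr rfl fun i hi => prod_congr rfl fun j hj => h i hi j hj

/-- Replacing the weight of the outermost pair starting at the first vertex. -/
lemma pairSum_sub {α A : Type*} [DecidableEq α] [CommRing A] (q : A) (g g' : α → α → A)
    {U : Finset α} {a b : α}
    (hab : a ≠ b) (ha : a ∉ U) (hb : b ∉ U)
    (hgg : ∀ i j, ¬ (i = a ∧ j = b) → g i j = g' i j) (h1 : g' a b = 1)
    (M : Finset α) (hM : M ⊆ U)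
    (hMq : ∀ u ∈ M, g a u = q ∧ g u b = q) (hM1 : ∀ u ∈ U, u ∉ M → g a u = 1 ∧ g u b = 1)
    (y z : A) :
    pairSum g (insert a (insert b U)) y z - pairSum g' (insert a (insert b U)) y z =
      (g a b - 1) * q ^ M.card * (y * z) * pairSum g U y z := by
  have ha' : a ∉ insert b U := by simp [hab, ha]
  rw [pairSum_insert g ha', pairSum_insert g' ha']
  have e1 : ∀ T ∈ (insert b U).powerset, splitWt g (insert b U) T = splitWt g' (insert b U) T := by
    intro T hT
    refine splitWt_congr fun i hi j _ => hgg i j ?_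
    rintro ⟨rfl, -⟩
    exact ha' (mem_powerset.1 hT hi)
  have e2 : ∀ T, ∏ i ∈ T, g i a = ∏ i ∈ T, g' i a := fun T =>
    prod_congr rfl fun i _ => hgg i a (fun h => hab h.2)
  rw [sum_congr rfl fun T hT => by rw [e1 T hT, e2 T], add_sub_add_left_eq_sub, ← sum_sub_distrib,
    sum_powerset_insert hb]
  have e3 : ∀ T ∈ U.powerset, ∏ j ∈ insert b U \ insert b T, g a j =
      ∏ j ∈ insert b U \ insert b T, g' a j := fun T _ =>
    prod_congr rfl fun j hj => hgg a j (fun h => by simp [h.2] at hj)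
  have e5 : ∑ T ∈ U.powerset,
      (splitWt g (insert b U) (insert b T) * (∏ j ∈ insert b U \ insert b T, g a j) *
          (y ^ (insert b T).card * z ^ (insert b U \ insert b T).card) * y -
        splitWt g' (insert b U) (insert b T) * (∏ j ∈ insert b U \ insert b T, g' a j) *
          (y ^ (insert b T).card * z ^ (insert b U \ insert b T).card) * y) = 0 := by
    refine sum_eq_zero fun T hT => ?_
    rw [e3 T hT, e1 _ (by simpa using insert_subset_insert b (mem_powerset.1 hT)), sub_self]
  rw [e5, add_zero, pairSum, mul_sum]
  refine sum_congr rfl fun T hT => ?_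
  have hTU := mem_powerset.1 hT
  have hbT : b ∉ T := fun h => hb (hTU h)
  have hp : ∀ W ⊆ U, ∀ f : α → A, (∀ u ∈ M, f u = q) → (∀ u ∈ U, u ∉ M → f u = 1) →
      ∏ u ∈ W, f u = q ^ (W ∩ M).card := by
    intro W hW f hf1 hf2
    rw [← prod_const, ← prod_inter_mul_prod_sdiff W M f,
      prod_congr rfl (fun u hu => hf1 u (mem_inter.1 hu).2),
      prod_eq_one (s := W \ M) (fun u hu => hf2 u (hW (mem_sdiff.1 hu).1) (mem_sdiff.1 hu).2),
        mul_one]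
  have hcard : (T ∩ M).card + ((U \ T) ∩ M).card = M.card := by
    rw [← card_union_of_disjoint]
    · congr 1
      ext u
      simp only [mem_union, mem_inter, mem_sdiff]
      constructor
      · tauto
      · intro h; have := hM h; tauto
    · rw [disjoint_left]; intro u hu hu'
      simp only [mem_inter, mem_sdiff] at hu hu'; tauto
  have e4 : ∏ j ∈ U \ T, g' a j = ∏ j ∈ U \ T, g a j :=
    prod_congr rfl fun j hj => (hgg a j fun h => hb (h.2 ▸ (mem_sdiff.1 hj).1)).symm
  rw [← e1 T (powerset_mono.2 (subset_insert _ _) hT), splitWt_insert_left g hb hTU,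
    card_insert_sdiff_left hb hTU, insert_sdiff_of_notMem _ hbT, prod_insert (by simp [hb]),
    prod_insert (by simp [hb]), h1, e4, hp T hTU (fun u => g u b) (fun u hu => (hMq u hu).2)
      (fun u hu h => (hM1 u hu h).2),
    hp (U \ T) sdiff_subset (fun u => g a u) (fun u hu => (hMq u hu).1)
      (fun u hu h => (hM1 u hu h).1), ← hcard, pow_add]
  ring

/-- The two-letter generating polynomial is symmetric if the interacting pairs form a unit
interval order all of whose inner pairs have weight `q`. -/
theorem pairSum_comm {α A : Type*} [DecidableEq α] [CommRing A] {β : Type*} [LinearOrder β]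
    (rd : α → β) (hrd : Function.Injective rd) (q : A) (V : Finset α) :
    ∀ g : α → α → A, (∀ i ∈ V, ∀ j ∈ V, rd j ≤ rd i → g i j = 1) →
    (∀ i ∈ V, ∀ j ∈ V, ∀ k ∈ V, rd i < rd j → rd j < rd k → g i k ≠ 1 → g i j = q ∧ g j k = q) →
    ∀ y z : A, pairSum g V y z = pairSum g V z y := by
  suffices H : ∀ n : ℕ, ∀ V : Finset α, ∀ g : α → α → A,
      V.card + ((V ×ˢ V).filter fun p => g p.1 p.2 ≠ 1).card = n →
      (∀ i ∈ V, ∀ j ∈ V, rd j ≤ rd i → g i j = 1) →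
      (∀ i ∈ V, ∀ j ∈ V, ∀ k ∈ V, rd i < rd j → rd j < rd k → g i k ≠ 1 → g i j = q ∧ g j k = q) →
      ∀ y z : A, pairSum g V y z = pairSum g V z y by
    intro g; exact H _ V g rfl
  intro n
  induction n using Nat.strong_induction_on with
  | _ n ih =>
  intro V g hn hle hg y z
  have mono : ∀ U ⊂ V, pairSum g U y z = pairSum g U z y := by
    intro U hU
    refine ih _ ?_ U g rfl (fun i hi j hj => hle i (hU.1 hi) j (hU.1 hj))
      (fun i hi j hj k hk => hg i (hU.1 hi) j (hU.1 hj) k (hU.1 hk)) y z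
    have h1 := card_lt_card hU
    have h2 := card_le_card (filter_subset_filter (fun p : α × α => g p.1 p.2 ≠ 1)
      (product_subset_product hU.1 hU.1))
    omega
  rcases V.eq_empty_or_nonempty with rfl | hV
  · simp [pairSum, splitWt]
  obtain ⟨a, haV, hamin⟩ := V.exists_min_image rd hV
  have hmin : ∀ i ∈ V, i ≠ a → rd a < rd i := fun i hi h =>
    lt_of_le_of_ne (hamin i hi) (fun h' => h (hrd h').symm)
  by_cases hN : ((V.erase a).filter fun j => g a j ≠ 1).Nonempty
  · obtain ⟨b, hbm, hbmax⟩ := ((V.erase a).filter fun j => g a j ≠ 1).exists_max_image rd hN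
    rw [mem_filter, mem_erase] at hbm
    obtain ⟨⟨hba, hbV⟩, hgab⟩ := hbm
    have hmax : ∀ j ∈ V, rd b < rd j → g a j = 1 := by
      intro j hj hbj
      by_contra hc
      refine absurd hbj (not_lt.2 (hbmax j (mem_filter.2 ⟨mem_erase.2 ⟨?_, hj⟩, hc⟩)))
      rintro rfl
      exact absurd hbj (not_lt.2 (hamin b hbV))
    set U := (V.erase a).erase b with hU
    have haU : a ∉ U := by simp [hU]
    have hbU : b ∉ U := by simp [hU]
    have hVU : V = insert a (insert b U) := by
      rw [hU, insert_erase (mem_erase.2 ⟨hba, hbV⟩), insert_erase haV]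
    have hUV : U ⊂ V := by
      rw [ssubset_iff_of_subset ((erase_subset _ _).trans (erase_subset _ _))]
      exact ⟨a, haV, haU⟩
    have hab := hmin b hbV hba
    let g' : α → α → A := fun i j => if i = a ∧ j = b then 1 else g i j
    have hgg : ∀ i j, ¬ (i = a ∧ j = b) → g i j = g' i j := fun i j h => by simp [g', h]
    have key := fun y z => pairSum_sub q g g' (Ne.symm hba) haU hbU hgg (by simp [g'])
      (U.filter fun u => rd u < rd b) (filter_subset _ _)
      (fun u hu => by
        rw [mem_filter] at hu
        have huV := hUV.1 hu.1
        exact hg a haV u huV b hbV (hmin u huV fun h => haU (h ▸ hu.1)) hu.2 hgab)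
      (fun u hu hu' => by
        have huV := hUV.1 hu
        have hbu : rd b < rd u := lt_of_le_of_ne (not_lt.1 fun h => hu' (mem_filter.2 ⟨hu, h⟩))
          (fun h => hbU (hrd h ▸ hu))
        exact ⟨hmax u huV hbu, hle u huV b hbV hbu.le⟩) y z
    rw [← hVU] at key
    have hrec : pairSum g' V y z = pairSum g' V z y := by
      refine ih _ ?_ V g' rfl ?_ ?_ y z
      · rw [← hn]
        refine Nat.add_lt_add_left (card_lt_card ?_) _
        rw [ssubset_iff_of_subset]
        · exact ⟨(a, b), by simp [haV, hbV, hgab], by simp [g']⟩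
        · intro p hp
          simp only [mem_filter, g'] at hp ⊢
          refine ⟨hp.1, fun h => hp.2 ?_⟩
          split_ifs <;> simp [h]
      · intro i hi j hj hij
        rw [← hgg i j (by rintro ⟨rfl, rfl⟩; exact absurd hij (not_le.2 hab))]
        exact hle i hi j hj hij
      · intro i hi j hj k hk hij hjk hik
        have hik' : g i k ≠ 1 := by
          intro h; apply hik; simp only [g']; split_ifs <;> simp [h]
        rw [← hgg i j, ← hgg j k]
        · exact hg i hi j hj k hk hij hjk hik'
        · rintro ⟨rfl, rfl⟩
          exact absurd hij (not_lt.2 (hamin i hi))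
        · rintro ⟨rfl, rfl⟩
          exact hik' (hmax k hk hjk)
    have h1 := key y z
    have h2 := key z y
    rw [mono U hUV] at h1
    linear_combination h1 - h2 + hrec
  · rw [not_nonempty_iff_eq_empty, filter_eq_empty_iff] at hN
    have hVa : V = insert a (V.erase a) := (insert_erase haV).symm
    have hr := mono (V.erase a) (erase_ssubset haV)
    have hi := pairSum_insert_isolated g (notMem_erase a V)
      (fun i hi => hle i (mem_of_mem_erase hi) a haV (hamin i (mem_of_mem_erase hi)))
      (fun i hi => not_not.1 (hN hi))
    rw [← hVa] at hi
    rw [hi, hi, hr, add_comm]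

/-! ### Generating polynomials of fillings -/

/-- Fillings of a finite set `C` by `{1, …, N}`, extended by zero. -/
def fills {α : Type*} [DecidableEq α] (C : Finset α) (N : ℕ) : Finset (α → ℕ) :=
  (C.pi (fun _ => Finset.Icc 1 N)).image (fun g c => if h : c ∈ C then g c h else 0)

lemma mem_fills {α : Type*} [DecidableEq α] {C : Finset α} {N : ℕ} {σ : α → ℕ} :
    σ ∈ fills C N ↔ (∀ c ∈ C, 1 ≤ σ c ∧ σ c ≤ N) ∧ ∀ c, c ∉ C → σ c = 0 := by
  rw [fills, mem_image]
  constructor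
  · rintro ⟨g, hg, rfl⟩
    rw [mem_pi] at hg
    refine ⟨fun c hc => ?_, fun c hc => by simp [hc]⟩
    have := hg c hc
    rw [mem_Icc] at this
    simpa [hc] using this
  · rintro ⟨h1, h2⟩
    refine ⟨fun c _ => σ c, ?_, ?_⟩
    · rw [mem_pi]; intro c hc; rw [mem_Icc]; exact h1 c hc
    · funext c
      by_cases hc : c ∈ C
      · simp [hc]
      · simp [hc, h2 c hc]

lemma mem_fillings {f : ℕ → ℕ} {N : ℕ} {σ : ℕ × ℕ → ℕ} :
    σ ∈ fillings f N ↔ (∀ c ∈ cells f, 1 ≤ σ c ∧ σ c ≤ N) ∧ ∀ c, c ∉ cells f → σ c = 0 := by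
  simp only [← mem_fills, fillings, fills, mem_image]

lemma fillings_eq_fills (f : ℕ → ℕ) (N : ℕ) : fillings f N = fills (cells f) N := by
  ext σ; rw [mem_fillings, mem_fills]

/-- The polynomial `Σ_σ wt(σ) x^σ`. -/
def fillPoly {α F : Type*} [DecidableEq α] [CommRing F] (C : Finset α) (N : ℕ)
    (wt : (α → ℕ) → F) : MvPolynomial ℕ F :=
  ∑ σ ∈ fills C N, MvPolynomial.C (wt σ) * ∏ c ∈ C, MvPolynomial.X (σ c)

/-- Symmetry in the variables `x_1, …, x_N`. -/
def IsSym {F : Type*} [CommRing F] (N : ℕ) (p : MvPolynomial ℕ F) : Prop :=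
  ∀ a, 1 ≤ a → a + 1 ≤ N → MvPolynomial.rename (Equiv.swap a (a + 1)) p = p

/-- Replace the value of `τ` on `S` by `b`. -/
def raise {α : Type*} [DecidableEq α] (b : ℕ) (τ : α → ℕ) (S : Finset α) : α → ℕ :=
  fun c => if c ∈ S then b else τ c

lemma sum_fills_eq_sum_raise {α M : Type*} [DecidableEq α] [AddCommMonoid M] (C : Finset α)
    {N a : ℕ} (ha : 1 ≤ a) (haN : a + 1 ≤ N) (G : (α → ℕ) → M) :
    ∑ σ ∈ fills C N, G σ =
      ∑ τ ∈ (fills C N).filter (fun τ => ∀ c, τ c ≠ a + 1),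
        ∑ S ∈ (C.filter fun c => τ c = a).powerset, G (raise (a + 1) τ S) := by
  rw [sum_sigma']
  refine sum_bij' (fun σ _ => ⟨fun c => if σ c = a + 1 then a else σ c,
    C.filter fun c => σ c = a + 1⟩)
    (fun p _ => raise (a + 1) p.1 p.2) ?_ ?_ ?_ ?_ ?_
  · intro σ hσ
    rw [mem_fills] at hσ
    simp only [mem_sigma, mem_filter, mem_fills, mem_powerset]
    refine ⟨⟨⟨fun c hc => ?_, fun c hc => ?_⟩, fun c => ?_⟩, fun c hc => ?_⟩
    · have := hσ.1 c hc
      split_ifs <;> omega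
    · simp [hσ.2 c hc]
    · split_ifs with h
      · omega
      · exact h
    · simp only [mem_filter] at hc ⊢
      exact ⟨hc.1, by simp [hc.2]⟩
  · rintro ⟨τ, S⟩ h
    simp only [mem_sigma, mem_filter, mem_fills, mem_powerset] at h
    obtain ⟨⟨⟨h1, h2⟩, h3⟩, h4⟩ := h
    rw [mem_fills]
    refine ⟨fun c hc => ?_, fun c hc => ?_⟩
    · have := h1 c hc
      simp only [raise]; split_ifs <;> omega
    · simp only [raise]
      rw [if_neg (fun h => hc (mem_filter.1 (h4 h)).1), h2 c hc]
  · intro σ hσ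
    rw [mem_fills] at hσ
    funext c
    simp only [raise, mem_filter]
    by_cases hc : σ c = a + 1
    · have : c ∈ C := by
        by_contra h; rw [hσ.2 c h] at hc; omega
      simp [hc, this]
    · simp [hc]
  · rintro ⟨τ, S⟩ h
    simp only [mem_sigma, mem_filter, mem_fills, mem_powerset] at h
    obtain ⟨⟨⟨h1, h2⟩, h3⟩, h4⟩ := h
    have e : ∀ c, raise (a + 1) τ S c = a + 1 ↔ c ∈ S := by
      intro c; simp only [raise]; split_ifs with hc <;> simp [hc, h3 c]
    simp only [e]
    have e1 : (fun c => if c ∈ S then a else raise (a + 1) τ S c) = τ := by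
      funext c; simp only [raise]; split_ifs with hc
      · exact (mem_filter.1 (h4 hc)).2.symm
      · rfl
    have e2 : (C.filter fun c => c ∈ S) = S := by
      ext c; rw [mem_filter]; exact ⟨fun h => h.2, fun h => ⟨(mem_filter.1 (h4 h)).1, h⟩⟩
    rw [e1, e2]
  · intro σ hσ
    rw [mem_fills] at hσ
    congr 1
    funext c
    simp only [raise, mem_filter]
    by_cases hc : σ c = a + 1
    · have : c ∈ C := by
        by_contra h; rw [hσ.2 c h] at hc; omega
      simp [hc, this]
    · simp [hc]

lemma prod_raise {α A : Type*} [DecidableEq α] [CommRing A] (C : Finset α) {a b : ℕ} (τ : α → ℕ)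
    {S : Finset α} (hS : S ⊆ C.filter fun c => τ c = a) (x : ℕ → A) :
    ∏ c ∈ C, x (raise b τ S c) =
      x b ^ S.card * x a ^ ((C.filter fun c => τ c = a) \ S).card *
        ∏ c ∈ C.filter (fun c => τ c ≠ a), x (τ c) := by
  rw [← prod_filter_mul_prod_filter_not C (fun c => τ c = a), ← prod_sdiff hS,
    mul_comm (∏ c ∈ _ \ S, _)]
  congr 1
  · congr 1
    · rw [← prod_const]
      exact prod_congr rfl fun c hc => by simp [raise, hc]
    · rw [← prod_const]
      refine prod_congr rfl fun c hc => ?_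
      simp only [mem_sdiff, mem_filter] at hc
      simp [raise, hc.2, hc.1.2]
  · refine prod_congr rfl fun c hc => ?_
    have : c ∉ S := fun h => (mem_filter.1 hc).2 (mem_filter.1 (hS h)).2
    simp [raise, this]

theorem fillPoly_isSym {α F : Type*} [DecidableEq α] [CommRing F] (C : Finset α) (N : ℕ)
    (wt : (α → ℕ) → F)
    (h : ∀ a, 1 ≤ a → a + 1 ≤ N → ∀ τ ∈ fills C N, (∀ c, τ c ≠ a + 1) →
      ∀ y z : MvPolynomial ℕ F,
      ∑ S ∈ (C.filter fun c => τ c = a).powerset,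
          MvPolynomial.C (wt (raise (a + 1) τ S)) *
            (y ^ S.card * z ^ ((C.filter fun c => τ c = a) \ S).card) =
        ∑ S ∈ (C.filter fun c => τ c = a).powerset,
          MvPolynomial.C (wt (raise (a + 1) τ S)) *
            (z ^ S.card * y ^ ((C.filter fun c => τ c = a) \ S).card)) :
    IsSym N (fillPoly C N wt) := by
  intro a ha haN
  rw [fillPoly, map_sum]
  rw [sum_fills_eq_sum_raise C ha haN, sum_fills_eq_sum_raise C ha haN]
  refine sum_congr rfl fun τ hτ => ?_
  rw [mem_filter] at hτ
  have key := congrArg (fun p => p * ∏ c ∈ C.filter (fun c => τ c ≠ a), MvPolynomial.X (R := F)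
      (τ c))
    (h a ha haN τ hτ.1 hτ.2 (MvPolynomial.X a) (MvPolynomial.X (a + 1)))
  simp only [sum_mul] at key
  convert key using 1
  · refine sum_congr rfl fun S hS => ?_
    rw [map_mul, MvPolynomial.rename_C, map_prod]
    simp only [MvPolynomial.rename_X]
    rw [prod_raise C τ (mem_powerset.1 hS)
      (fun k => MvPolynomial.X (R := F) (Equiv.swap a (a+1) k))]
    rw [Equiv.swap_apply_left, Equiv.swap_apply_right]
    rw [← mul_assoc, ← mul_assoc, mul_assoc (MvPolynomial.C _)]
    congr 1
    refine prod_congr rfl fun c hc => ?_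
    rw [Equiv.swap_apply_of_ne_of_ne (mem_filter.1 hc).2 (hτ.2 c)]
  · refine sum_congr rfl fun S hS => ?_
    rw [prod_raise C τ (mem_powerset.1 hS) (fun k => MvPolynomial.X (R := F) k)]
    ring

/-- A filling polynomial whose weight is a product over descents of a unit interval type order is
symmetric. -/
theorem fillPoly_isSym_of_desc {α F : Type*} [DecidableEq α] [CommRing F] {β : Type*}
    [LinearOrder β] (rd : α → β) (hrd : Function.Injective rd) (q : F) (w : α → α → F)
    (C : Finset α) (N : ℕ) (wt : (α → ℕ) → F)
    (hw : ∀ i ∈ C, ∀ j ∈ C, ∀ k ∈ C, rd i < rd j → rd j < rd k → w i k ≠ 1 → w i j = q ∧ w j k = q)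
    (κ : F) (hwt : ∀ σ ∈ fills C N, wt σ =
      κ * ∏ i ∈ C, ∏ j ∈ C, if rd i < rd j ∧ σ j < σ i then w i j else 1) :
    IsSym N (fillPoly C N wt) := by
  refine fillPoly_isSym C N wt fun a ha haN τ hτ hτa y z => ?_
  set V := C.filter fun c => τ c = a with hV
  let g : α → α → F := fun i j => if rd i < rd j then w i j else 1
  let κ' : F := κ * ∏ i ∈ C, ∏ j ∈ C,
    if (i ∈ V ∧ j ∈ V) then 1 else if rd i < rd j ∧ τ j < τ i then w i j else 1
  have key : ∀ S ∈ V.powerset, wt (raise (a + 1) τ S) = κ' * splitWt g V S := by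
    intro S hS
    rw [mem_powerset] at hS
    have hmem : raise (a + 1) τ S ∈ fills C N := by
      rw [mem_fills] at hτ ⊢
      refine ⟨fun c hc => ?_, fun c hc => ?_⟩
      · have := hτ.1 c hc
        simp only [raise]; split_ifs <;> omega
      · have : c ∉ S := fun h => hc (mem_filter.1 (hS h)).1
        simp [raise, this, hτ.2 c hc]
    have hsp : splitWt g V S = ∏ i ∈ C, ∏ j ∈ C, if i ∈ S ∧ j ∈ V \ S then g i j else 1 := by
      have hSC : S ⊆ C := hS.trans (filter_subset _ _)
      have hVC : V \ S ⊆ C := sdiff_subset.trans (filter_subset _ _)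
      rw [splitWt, ← prod_subset hSC]
      · refine prod_congr rfl fun i hi => ?_
        rw [← prod_subset hVC]
        · exact prod_congr rfl fun j hj => by rw [if_pos ⟨hi, hj⟩]
        · intro j _ hj; rw [if_neg (fun h => hj h.2)]
      · intro i _ hi; exact prod_eq_one fun j _ => by rw [if_neg (fun h => hi h.1)]
    rw [hwt _ hmem, hsp, mul_assoc, ← prod_mul_distrib]
    congr 1
    refine prod_congr rfl fun i hi => ?_
    rw [← prod_mul_distrib]
    refine prod_congr rfl fun j hj => ?_
    have hSV : ∀ c, c ∈ S → τ c = a := fun c hc => (mem_filter.1 (hS hc)).2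
    have hVm : ∀ c ∈ C, (c ∈ V ↔ τ c = a) := fun c hc => by simp [hV, hc]
    have e1 := hτa i
    have e2 := hτa j
    by_cases hi' : i ∈ V <;> by_cases hj' : j ∈ V
    · have t1 := (hVm i hi).1 hi'
      have t2 := (hVm j hj).1 hj'
      by_cases hiS : i ∈ S <;> by_cases hjS : j ∈ S <;>
        simp [raise, hi', hj', hiS, hjS, t1, t2, g]
    all_goals
      have t1 := hVm i hi
      have t2 := hVm j hj
      simp only [hi', hj', true_iff, false_iff] at t1 t2
      have : (raise (a + 1) τ S j < raise (a + 1) τ S i) ↔ τ j < τ i := by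
        have s1 := hSV i
        have s2 := hSV j
        simp only [raise]; split_ifs with h1 h2 h2
        · have := s2 h1; have := s1 h2; omega
        · have := s2 h1; omega
        · have := s1 h2; omega
        · rfl
      simp only [this]
      rw [if_neg (by tauto : ¬ (i ∈ V ∧ j ∈ V))]
      by_cases hS2 : i ∈ S ∧ j ∈ V \ S
      · exfalso
        have := hS hS2.1
        have := (mem_sdiff.1 hS2.2).1
        tauto
      · rw [if_neg hS2, mul_one]
  have hsym := pairSum_comm rd hrd (MvPolynomial.C q : MvPolynomial ℕ F) V
    (fun i j => MvPolynomial.C (g i j))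
    (fun i _ j _ hij => by simp [g, not_lt.2 hij]) (by
      intro i hi j hj k hk hij hjk hik
      have hik' : w i k ≠ 1 := by
        intro h; apply hik; simp [g, h]
      have := hw i (mem_filter.1 hi).1 j (mem_filter.1 hj).1 k (mem_filter.1 hk).1 hij hjk hik'
      simp [g, hij, hjk, this]) y z
  have conv : ∀ y z : MvPolynomial ℕ F, ∑ S ∈ V.powerset,
      MvPolynomial.C (wt (raise (a + 1) τ S)) * (y ^ S.card * z ^ (V \ S).card) =
      MvPolynomial.C κ' * pairSum (fun i j => MvPolynomial.C (g i j)) V y z := by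
    intro y z
    rw [pairSum, mul_sum]
    refine sum_congr rfl fun S hS => ?_
    rw [key S hS, map_mul, mul_assoc]
    simp only [splitWt, map_prod]
  rw [conv, conv, hsym]

/-! ### Cells of a Young diagram -/

/-- `f` is weakly decreasing on positive integers and eventually zero. -/
def IsShape (f : ℕ → ℕ) : Prop :=
  (∀ i j, 1 ≤ i → i ≤ j → f j ≤ f i) ∧ ∃ N, ∀ j, N ≤ j → f j = 0

lemma le_nRows {f : ℕ → ℕ} (hf : IsShape f) {j : ℕ} (hj : 1 ≤ j) : j ≤ nRows f ↔ f j ≠ 0 := by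
  obtain ⟨h1, N, hN⟩ := hf
  have hb : BddAbove {j | f j ≠ 0} := ⟨N, fun k hk => by
    by_contra h; exact hk (hN k (by omega))⟩
  constructor
  · intro h
    have hne : ({j | f j ≠ 0} : Set ℕ).Nonempty := by
      by_contra hne
      rw [Set.not_nonempty_iff_eq_empty] at hne
      rw [nRows, hne] at h
      simp at h; omega
    have h2 : f (nRows f) ≠ 0 := Nat.sSup_mem hne hb
    have := h1 j (nRows f) hj h
    omega
  · intro h
    exact le_csSup hb h

lemma mem_cells {f : ℕ → ℕ} (hf : IsShape f) {c : ℕ × ℕ} :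
    c ∈ cells f ↔ 1 ≤ c.1 ∧ 1 ≤ c.2 ∧ c.1 ≤ f c.2 := by
  obtain ⟨i, j⟩ := c
  simp only [cells, mem_filter, mem_product, mem_Icc]
  constructor
  · rintro ⟨⟨⟨h1, h2⟩, h3, h4⟩, h5⟩; exact ⟨h1, h3, h5⟩
  · rintro ⟨h1, h2, h3⟩
    have := hf.1 1 j le_rfl h2
    exact ⟨⟨⟨h1, by omega⟩, h2, (le_nRows hf h2).2 (by omega)⟩, h3⟩

lemma le_colLen {f : ℕ → ℕ} (hf : IsShape f) {i j : ℕ} (hi : 1 ≤ i) (hj : 1 ≤ j) :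
    j ≤ colLen f i ↔ i ≤ f j := by
  constructor
  · intro h
    by_contra hc
    have : colLen f i ≤ (Finset.Icc 1 (j - 1)).card := by
      refine card_le_card fun k hk => ?_
      simp only [mem_filter, mem_Icc] at hk ⊢
      refine ⟨hk.1.1, ?_⟩
      by_contra hkj
      have := hf.1 j k hj (by omega)
      omega
    simp at this; omega
  · intro h
    have : (Finset.Icc 1 j).card ≤ colLen f i := by
      refine card_le_card fun k hk => ?_
      simp only [mem_filter, mem_Icc] at hk ⊢
      have := hf.1 k j hk.1 hk.2
      exact ⟨⟨hk.1, (le_nRows hf hk.1).2 (by omega)⟩, by omega⟩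
    simpa using this

lemma isShape_lamB {r : ℕ} {lam : Fin (r+1) → ℕ → ℕ} (hlam : ∀ b, IsPartitionFun (lam b))
    (B : Finset (Fin (r+1))) : IsShape (lamB lam B) := by
  refine ⟨fun i j _ hij => sum_le_sum fun b _ => (hlam b).1 hij, ?_⟩
  choose M hM using fun b => (hlam b).2
  refine ⟨∑ b, M b, fun j hj => sum_eq_zero fun b _ => ?_⟩
  have h1 : M b ≤ ∑ b, M b := single_le_sum (f := M) (fun _ _ => Nat.zero_le _) (mem_univ b)
  have := (hlam b).1 (h1.trans hj)
  rw [hM] at this; omega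

/-- Reading order: rows from top to bottom, each row from left to right. -/
def rdKey (c : ℕ × ℕ) : ℕᵒᵈ ×ₗ ℕ := toLex (OrderDual.toDual c.2, c.1)

lemma rdKey_injective : Function.Injective rdKey := by
  rintro ⟨a, b⟩ ⟨c, d⟩ h
  simp only [rdKey, EmbeddingLike.apply_eq_iff_eq, Prod.mk.injEq] at h
  rw [h.1, h.2]

lemma rdKey_lt {c d : ℕ × ℕ} : rdKey c < rdKey d ↔ d.2 < c.2 ∨ (c.2 = d.2 ∧ c.1 < d.1) := by
  simp [rdKey, Prod.Lex.toLex_lt_toLex, OrderDual.toDual_lt_toDual]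

/-- Number of cells strictly to the right of `c` in its row. -/
def armLen (f : ℕ → ℕ) (c : ℕ × ℕ) : ℕ :=
  ((cells f).filter fun d => d.2 = c.2 ∧ c.1 < d.1).card

lemma invStat_add_arm {f : ℕ → ℕ} (hf : IsShape f) {N : ℕ} {σ : ℕ × ℕ → ℕ}
    (hσ : σ ∈ fillings f N) :
    invStat f σ + ∑ c ∈ desSet f σ, armLen f c =
      (∑ u ∈ cells f, ∑ w ∈ cells f, if (u.2 = w.2 ∧ u.1 < w.1) ∧ σ w < σ u then 1 else 0) +
      ∑ w ∈ cells f, ∑ v ∈ cells f, if (v.2 + 1 = w.2 ∧ v.1 < w.1) ∧ σ v < σ w then 1 else 0 := by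
  rw [mem_fillings] at hσ
  have e1 : invStat f σ = ∑ u ∈ cells f, ∑ w ∈ cells f,
      if u.2 = w.2 ∧ u.1 < w.1 ∧ invTriple σ u w then 1 else 0 := by
    rw [invStat, invPairs, card_filter, sum_product]
  have e2 : ∑ c ∈ desSet f σ, armLen f c = ∑ u ∈ cells f, ∑ w ∈ cells f,
      if (u.2 = w.2 ∧ u.1 < w.1) ∧ 2 ≤ u.2 ∧ σ (u.1, u.2 - 1) < σ u then 1 else 0 := by
    rw [desSet, sum_filter]
    refine sum_congr rfl fun u _ => ?_
    split_ifs with h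
    · rw [armLen, card_filter]
      refine sum_congr rfl fun w _ => ?_
      simp only [h, and_true, eq_comm]
    · simp [h]
  have e3 : (∑ w ∈ cells f, ∑ v ∈ cells f,
        if (v.2 + 1 = w.2 ∧ v.1 < w.1) ∧ σ v < σ w then 1 else 0) =
      ∑ u ∈ cells f, ∑ w ∈ cells f,
        if (u.2 = w.2 ∧ u.1 < w.1) ∧ 2 ≤ u.2 ∧ σ (u.1, u.2 - 1) < σ w then 1 else 0 := by
    rw [sum_comm (s := cells f) (t := cells f) (f := fun u w =>
      if (u.2 = w.2 ∧ u.1 < w.1) ∧ 2 ≤ u.2 ∧ σ (u.1, u.2 - 1) < σ w then 1 else 0)]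
    refine sum_congr rfl fun w hw => ?_
    rw [← card_filter, ← card_filter]
    refine card_bij' (fun v _ => (v.1, v.2 + 1)) (fun u _ => (u.1, u.2 - 1)) ?_ ?_ ?_ ?_
    · rintro ⟨x, y⟩ hv
      simp only [mem_filter, mem_cells hf] at hv hw ⊢
      obtain ⟨⟨h1, h2, h3⟩, ⟨h4, h5⟩, h6⟩ := hv
      refine ⟨⟨h1, by omega, ?_⟩, ⟨h4, h5⟩, by omega, by simpa using h6⟩
      rw [h4]; omega
    · rintro ⟨x, y⟩ hv
      simp only [mem_filter, mem_cells hf] at hv hw ⊢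
      obtain ⟨⟨h1, h2, h3⟩, ⟨h4, h5⟩, h6, h7⟩ := hv
      have := hf.1 (y - 1) y (by omega) (by omega)
      exact ⟨⟨h1, by omega, by omega⟩, ⟨by omega, h5⟩, h7⟩
    · rintro ⟨x, y⟩ hv
      simp
    · rintro ⟨x, y⟩ hv
      simp only [mem_filter] at hv
      simp only [Prod.mk.injEq, true_and]; omega
  rw [e1, e2, e3, ← sum_add_distrib, ← sum_add_distrib]
  refine sum_congr rfl fun u hu => ?_
  rw [← sum_add_distrib, ← sum_add_distrib]
  refine sum_congr rfl fun w hw => ?_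
  have hu1 := hσ.1 u hu
  have hw1 := hσ.1 w hw
  obtain ⟨ux, y⟩ := u
  obtain ⟨wx, y'⟩ := w
  by_cases hr : y = y' ∧ ux < wx
  · obtain ⟨rfl, hx⟩ := hr
    by_cases h2 : 2 ≤ y
    · simp only [invTriple, hx, h2, true_and]
      split_ifs <;> omega
    · have h3 : σ (ux, y - 1) = 0 := by
        apply hσ.2
        rw [mem_cells hf]; simp only; omega
      simp only [invTriple, hx, true_and, h3, h2, false_and, if_false]
      split_ifs <;> omega
  · rw [if_neg (fun h => hr ⟨h.1, h.2.1⟩), if_neg (fun h => hr h.1), if_neg (fun h => hr h.1),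
      if_neg (fun h => hr h.1)]

/-- Descent weights of Haglund's formula. -/
def macW {F : Type*} [Field F] (f : ℕ → ℕ) (Q T : F) (i j : ℕ × ℕ) : F :=
  if i.2 = j.2 ∧ i.1 < j.1 then Q else
    if j.2 + 1 = i.2 ∧ j.1 < i.1 then Q else
      if j.2 + 1 = i.2 ∧ j.1 = i.1 then T ^ (colLen f i.1 - i.2 + 1) * (Q ^ armLen f i)⁻¹ else 1

lemma macWt_eq {F : Type*} [Field F] {f : ℕ → ℕ} (hf : IsShape f) {Q : F} (hQ : Q ≠ 0) (T : F)
    {N : ℕ} {σ : ℕ × ℕ → ℕ} (hσ : σ ∈ fillings f N) :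
    Q ^ invStat f σ * T ^ majStat f σ =
      ∏ i ∈ cells f, ∏ j ∈ cells f,
        if rdKey i < rdKey j ∧ σ j < σ i then macW f Q T i j else 1 := by
  have e : ∀ i ∈ cells f, ∀ j ∈ cells f,
      (if rdKey i < rdKey j ∧ σ j < σ i then macW f Q T i j else 1) =
      (if (i.2 = j.2 ∧ i.1 < j.1) ∧ σ j < σ i then Q else 1) *
      ((if (j.2 + 1 = i.2 ∧ j.1 < i.1) ∧ σ j < σ i then Q else 1) *
       (if (j.2 + 1 = i.2 ∧ j.1 = i.1) ∧ σ j < σ i then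
          T ^ (colLen f i.1 - i.2 + 1) * (Q ^ armLen f i)⁻¹ else 1)) := by
    intro i _ j _
    simp only [rdKey_lt, macW]
    by_cases h : σ j < σ i
    · simp only [h, and_true]
      split_ifs <;> first | (exfalso; omega) | simp
    · simp [h]
  rw [prod_congr rfl fun i hi => prod_congr rfl fun j hj => e i hi j hj]
  simp only [prod_mul_distrib]
  have p1 : ∀ (P : ℕ × ℕ → ℕ × ℕ → Prop) [∀ i j, Decidable (P i j)], ∏ i ∈ cells f, ∏ j ∈ cells f,
      (if P i j then Q else 1) =
      Q ^ (∑ i ∈ cells f, ∑ j ∈ cells f, if P i j then 1 else 0) := by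
    intro P _
    rw [← prod_pow_eq_pow_sum]
    refine prod_congr rfl fun i _ => ?_
    rw [← prod_pow_eq_pow_sum]
    refine prod_congr rfl fun j _ => ?_
    split_ifs <;> simp
  have p2 : ∏ i ∈ cells f, ∏ j ∈ cells f, (if (j.2 + 1 = i.2 ∧ j.1 = i.1) ∧ σ j < σ i then
          T ^ (colLen f i.1 - i.2 + 1) * (Q ^ armLen f i)⁻¹ else 1) =
      ∏ i ∈ desSet f σ, (T ^ (colLen f i.1 - i.2 + 1) * (Q ^ armLen f i)⁻¹) := by
    rw [desSet, prod_filter]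
    refine prod_congr rfl fun i hi => ?_
    split_ifs with h
    · rw [prod_eq_single (i.1, i.2 - 1)]
      · rw [if_pos ⟨⟨by simp only; omega, rfl⟩, h.2⟩]
      · intro j _ hj
        rw [if_neg]
        rintro ⟨⟨h1, h2⟩, _⟩
        exact hj (Prod.ext h2 (by simp only; omega))
      · intro hn
        exfalso; apply hn
        rw [mem_cells hf] at hi ⊢
        have := hf.1 (i.2 - 1) i.2 (by omega) (by omega)
        simp only; omega
    · refine prod_eq_one fun j hj => ?_
      rw [if_neg]
      rintro ⟨⟨h1, h2⟩, h3⟩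
      rw [mem_cells hf] at hj
      apply h
      have : j = (i.1, i.2 - 1) := Prod.ext h2 (by simp only; omega)
      rw [← this]; exact ⟨by omega, h3⟩
  rw [p1 (fun i j => (i.2 = j.2 ∧ i.1 < j.1) ∧ σ j < σ i),
    p1 (fun i j => (j.2 + 1 = i.2 ∧ j.1 < i.1) ∧ σ j < σ i), p2, prod_mul_distrib,
      prod_pow_eq_pow_sum, prod_inv_distrib, prod_pow_eq_pow_sum,
    majStat]
  have := invStat_add_arm hf hσ
  rw [← mul_assoc, ← pow_add, ← this, pow_add]
  field_simp

lemma macPoly_isSym {F : Type*} [Field F] {f : ℕ → ℕ} (hf : IsShape f) {Q : F} (hQ : Q ≠ 0) (T : F)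
    (N : ℕ) : IsSym N (fillPoly (cells f) N fun σ => Q ^ invStat f σ * T ^ majStat f σ) := by
  refine fillPoly_isSym_of_desc rdKey rdKey_injective Q (macW f Q T) _ N _ ?_ 1 ?_
  · intro i _ j _ k _ hij hjk hik
    rw [rdKey_lt] at hij hjk
    have : (i.2 = k.2 ∧ i.1 < k.1) ∨ (k.2 + 1 = i.2 ∧ k.1 ≤ i.1) := by
      by_contra hc
      apply hik
      rw [macW, if_neg (by omega), if_neg (by omega), if_neg (by omega)]
    constructor <;> (rw [macW]; split_ifs <;> first | rfl | (exfalso; omega))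
  · intro σ hσ
    rw [one_mul]
    exact macWt_eq hf hQ T (by rwa [fillings_eq_fills])

/-! ### Symmetry of Schur polynomials -/

/-- Semistandardness of a filling. -/
def IsSSYT (f : ℕ → ℕ) (T : ℕ × ℕ → ℕ) : Prop :=
  (∀ c ∈ cells f, ∀ c' ∈ cells f, c.2 = c'.2 → c.1 ≤ c'.1 → T c ≤ T c') ∧
    (∀ c ∈ cells f, ∀ c' ∈ cells f, c.1 = c'.1 → c.2 < c'.2 → T c < T c')

lemma schurK_eq (f : ℕ → ℕ) (N : ℕ) :
    schurK f N = fillPoly (cells f) N (fun σ => if IsSSYT f σ then 1 else 0) := by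
  rw [schurK, ssytFinset, sum_filter, fillPoly, fillings_eq_fills]
  refine sum_congr rfl fun σ _ => ?_
  by_cases h : IsSSYT f σ
  · rw [if_pos h, map_one, one_mul]; exact if_pos h
  · rw [if_neg h, map_zero, zero_mul]; exact if_neg h

lemma isSSYT_raise {f : ℕ → ℕ} {a : ℕ} {τ : ℕ × ℕ → ℕ} (hτ : ∀ c, τ c ≠ a + 1)
    {S S0 : Finset (ℕ × ℕ)} (hS : S ⊆ (cells f).filter fun c => τ c = a)
    (hS0 : S0 ⊆ (cells f).filter fun c => τ c = a) (h0 : IsSSYT f (raise (a + 1) τ S0)) :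
    IsSSYT f (raise (a + 1) τ S) ↔
      (∀ c ∈ cells f, ∀ c' ∈ cells f, τ c = a → τ c' = a →
        (c.2 = c'.2 → c.1 ≤ c'.1 → c ∈ S → c' ∈ S) ∧
        (c.1 = c'.1 → c.2 < c'.2 → c ∉ S ∧ c' ∈ S)) := by
  have v : ∀ {S : Finset (ℕ × ℕ)}, S ⊆ (cells f).filter (fun c => τ c = a) → ∀ c,
      (c ∈ S ∧ τ c = a ∧ raise (a + 1) τ S c = a + 1) ∨ (c ∉ S ∧ raise (a + 1) τ S c = τ c) := by
    intro S hS c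
    by_cases h : c ∈ S
    · exact Or.inl ⟨h, (mem_filter.1 (hS h)).2, by simp [raise, h]⟩
    · exact Or.inr ⟨h, by simp [raise, h]⟩
  constructor
  · intro h c hc c' hc' hca hca'
    have e := v hS c
    have e' := v hS c'
    have r1 := h.1 c hc c' hc'
    have r2 := h.2 c hc c' hc'
    constructor
    · intro h1 h2 h3
      have := r1 h1 h2
      by_contra h4
      simp only [h3, h4, true_and, not_true, not_false_eq_true, false_and, or_false, false_or]
        at e e'
      omega
    · intro h1 h2
      have := r2 h1 h2
      rcases e with e | e <;> rcases e' with e' | e'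
      · omega
      · omega
      · exact ⟨e.1, e'.1⟩
      · omega
  · intro h
    constructor
    · intro c hc c' hc' h1 h2
      have e := v hS c
      have e' := v hS c'
      have e0 := v hS0 c
      have e0' := v hS0 c'
      have r := h0.1 c hc c' hc' h1 h2
      have d := hτ c
      have d' := hτ c'
      by_cases hh : τ c = a ∧ τ c' = a
      · have := (h c hc c' hc' hh.1 hh.2).1 h1 h2
        rcases e with e | e
        · have := this e.1
          rcases e' with e' | e'
          · omega
          · exact absurd this e'.1
        · rcases e' with e' | e' <;> omega
      · omega
    · intro c hc c' hc' h1 h2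
      have e := v hS c
      have e' := v hS c'
      have e0 := v hS0 c
      have e0' := v hS0 c'
      have r := h0.2 c hc c' hc' h1 h2
      have d := hτ c
      have d' := hτ c'
      by_cases hh : τ c = a ∧ τ c' = a
      · have := (h c hc c' hc' hh.1 hh.2).2 h1 h2
        rcases e with e | e
        · exact absurd e.1 this.1
        · rcases e' with e' | e'
          · omega
          · exact absurd this.2 e'.1
      · omega

set_option maxHeartbeats 1000000 in
theorem schurK_isSym {f : ℕ → ℕ} (hf : IsShape f) (N : ℕ) : IsSym N (schurK f N) := by
  rw [schurK_eq]
  refine fillPoly_isSym _ _ _ fun a ha haN τ hτ hτa y z => ?_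
  set V := (cells f).filter fun c => τ c = a with hV
  by_cases hex : ∃ S0, S0 ⊆ V ∧ IsSSYT f (raise (a + 1) τ S0)
  swap
  · have : ∀ S ∈ V.powerset, ¬ IsSSYT f (raise (a + 1) τ S) := fun S hS h =>
      hex ⟨S, mem_powerset.1 hS, h⟩
    rw [sum_eq_zero fun S hS => by rw [if_neg (this S hS), map_zero, zero_mul],
      sum_eq_zero fun S hS => by rw [if_neg (this S hS), map_zero, zero_mul]]
  obtain ⟨S0, hS0, h0⟩ := hex
  have key := (isSSYT_raise hτa hS0 hS0 h0).1 h0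
  have val : ∀ c ∈ cells f, (c ∈ S0 ↔ raise (a + 1) τ S0 c = a + 1) ∧
      (c ∈ V ∧ c ∉ S0 ↔ raise (a + 1) τ S0 c = a) := by
    intro c hc
    have d := hτa c
    by_cases h : c ∈ S0
    · simp [raise, h]
    · simp [raise, h, hV, hc, d]
  have memV : ∀ c, c ∈ V ↔ c ∈ cells f ∧ τ c = a := fun c => by simp [hV]
  set Up := V.filter fun c => ∃ d ∈ V, d.1 = c.1 ∧ d.2 < c.2 with hUp
  set Lo := V.filter fun c => ∃ d ∈ V, d.1 = c.1 ∧ c.2 < d.2 with hLo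
  set V1 := (V \ Up) \ Lo with hV1
  have up0 : Up ⊆ S0 := by
    intro c hc
    obtain ⟨h1, d, hd, h2, h3⟩ := mem_filter.1 hc
    rw [memV] at hd h1
    exact ((key d hd.1 c h1.1 hd.2 h1.2).2 h2 h3).2
  have lo0 : ∀ c ∈ Lo, c ∉ S0 := by
    intro c hc
    obtain ⟨h1, d, hd, h2, h3⟩ := mem_filter.1 hc
    rw [memV] at hd h1
    exact ((key c h1.1 d hd.1 h1.2 hd.2).2 h2.symm h3).1
  have hcard : Up.card = Lo.card := by
    refine card_bij' (fun c _ => (c.1, c.2 - 1)) (fun c _ => (c.1, c.2 + 1)) ?_ ?_ ?_ ?_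
    · intro c hc
      have hcS := up0 hc
      obtain ⟨h1, d, hd, h2, h3⟩ := mem_filter.1 hc
      have hd' := (memV d).1 hd
      have hc' := (memV c).1 h1
      have hdS : d ∉ S0 := ((key d hd'.1 c hc'.1 hd'.2 hc'.2).2 h2 h3).1
      have e1 := (val c hc'.1).1.1 hcS
      have e2 := (val d hd'.1).2.1 ⟨hd, hdS⟩
      have hdc : d = (c.1, c.2 - 1) := by
        refine Prod.ext h2 ?_
        simp only
        by_contra hne
        have hm : (c.1, c.2 - 1) ∈ cells f := by
          have := (mem_cells hf).1 hc'.1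
          have := (mem_cells hf).1 hd'.1
          rw [mem_cells hf]
          have := hf.1 (c.2 - 1) c.2 (by omega) (by omega)
          simp only; omega
        have := h0.2 d hd'.1 _ hm h2 (by simp only; omega)
        have := h0.2 _ hm c hc'.1 rfl (by simp only; omega)
        omega
      rw [hLo, mem_filter, ← hdc]
      exact ⟨hd, c, h1, h2.symm, h3⟩
    · intro c hc
      have hcS := lo0 c hc
      obtain ⟨h1, d, hd, h2, h3⟩ := mem_filter.1 hc
      have hd' := (memV d).1 hd
      have hc' := (memV c).1 h1
      have hdS : d ∈ S0 := ((key c hc'.1 d hd'.1 hc'.2 hd'.2).2 h2.symm h3).2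
      have e1 := (val d hd'.1).1.1 hdS
      have e2 := (val c hc'.1).2.1 ⟨h1, hcS⟩
      have hdc : d = (c.1, c.2 + 1) := by
        refine Prod.ext h2 ?_
        simp only
        by_contra hne
        have hm : (c.1, c.2 + 1) ∈ cells f := by
          have := (mem_cells hf).1 hc'.1
          have := (mem_cells hf).1 hd'.1
          rw [mem_cells hf]
          have := hf.1 (c.2 + 1) d.2 (by omega) (by omega)
          simp only; omega
        have := h0.2 c hc'.1 _ hm rfl (by simp only; omega)
        have := h0.2 _ hm d hd'.1 h2.symm (by simp only; omega)
        omega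
      rw [hUp, mem_filter, ← hdc]
      exact ⟨hd, c, h1, h2.symm, h3⟩
    · intro c hc
      obtain ⟨_, d, hd, h2, h3⟩ := mem_filter.1 hc
      refine Prod.ext rfl ?_
      simp only; omega
    · intro c hc
      simp
  let g : ℕ × ℕ → ℕ × ℕ → MvPolynomial ℕ KField := fun l r =>
    if l.2 = r.2 ∧ l.1 < r.1 then 0 else 1
  have char : ∀ S ∈ V.powerset, (IsSSYT f (raise (a + 1) τ S) ↔
      (Up ⊆ S ∧ Disjoint Lo S) ∧ ∀ l ∈ S \ Up, ∀ r ∈ V1 \ S, ¬ (l.2 = r.2 ∧ l.1 < r.1)) := by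
    intro S hS
    rw [mem_powerset] at hS
    rw [isSSYT_raise hτa hS hS0 h0]
    constructor
    · intro h
      refine ⟨⟨fun c hc => ?_, disjoint_left.2 fun c hc => ?_⟩, fun l hl r hr hlr => ?_⟩
      · obtain ⟨h1, d, hd, h2, h3⟩ := mem_filter.1 hc
        rw [memV] at hd h1
        exact ((h d hd.1 c h1.1 hd.2 h1.2).2 h2 h3).2
      · obtain ⟨h1, d, hd, h2, h3⟩ := mem_filter.1 hc
        rw [memV] at hd h1
        exact ((h c h1.1 d hd.1 h1.2 hd.2).2 h2.symm h3).1
      · simp only [hV1, mem_sdiff] at hl hr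
        have h1 := (memV l).1 (hS hl.1)
        have h2 := (memV r).1 hr.1.1.1
        exact hr.2 ((h l h1.1 r h2.1 h1.2 h2.2).1 hlr.1 hlr.2.le hl.1)
    · rintro ⟨⟨hU, hL⟩, hnb⟩ c hc c' hc' hca hca'
      have hcV := (memV c).2 ⟨hc, hca⟩
      have hcV' := (memV c').2 ⟨hc', hca'⟩
      rw [disjoint_left] at hL
      constructor
      · intro h1 h2 h3
        by_contra h4
        have hne : c.1 ≠ c'.1 := fun h => h4 (Prod.ext h h1 ▸ h3)
        have hcl : c ∉ Lo := fun h => hL h h3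
        have hcu : c' ∉ Up := fun h => h4 (hU h)
        have hcUp : c ∉ Up := by
          intro hcu'
          apply hcu
          have e1 := up0 hcu'
          have e2 := (key c hc c' hc' hca hca').1 h1 h2 e1
          obtain ⟨_, d, hd, h5, h6⟩ := mem_filter.1 hcu'
          have hd' := (memV d).1 hd
          have e3 := ((key d hd'.1 c hc hd'.2 hca).2 h5 h6).1
          have hm : (c'.1, d.2) ∈ cells f := by
            have := (mem_cells hf).1 hc'
            have := (mem_cells hf).1 hd'.1
            rw [mem_cells hf]
            have := hf.1 d.2 c'.2 (by omega) (by omega)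
            simp only; omega
          have v1 := (val d hd'.1).2.1 ⟨hd, e3⟩
          have v2 := (val c' hc').1.1 e2
          have v3 := h0.1 d hd'.1 _ hm rfl (by simp only; omega)
          have v4 := h0.2 _ hm c' hc' rfl (by simp only; omega)
          rw [hUp, mem_filter]
          exact ⟨hcV', _, ((val _ hm).2.2 (by omega)).1, rfl, by simp only; omega⟩
        have hcLo : c' ∉ Lo := by
          intro hcl'
          apply hcl
          have e1 := lo0 _ hcl'
          have e2 : c ∉ S0 := fun h => e1 ((key c hc c' hc' hca hca').1 h1 h2 h)
          obtain ⟨_, d, hd, h5, h6⟩ := mem_filter.1 hcl'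
          have hd' := (memV d).1 hd
          have e3 := ((key c' hc' d hd'.1 hca' hd'.2).2 h5.symm h6).2
          have hm : (c.1, d.2) ∈ cells f := by
            have := (mem_cells hf).1 hc
            have := (mem_cells hf).1 hd'.1
            rw [mem_cells hf]
            simp only; omega
          have v1 := (val d hd'.1).1.1 e3
          have v2 := (val c hc).2.1 ⟨hcV, e2⟩
          have v3 := h0.1 _ hm d hd'.1 rfl (by simp only; omega)
          have v4 := h0.2 c hc _ hm rfl (by simp only; omega)
          rw [hLo, mem_filter]
          exact ⟨hcV, _, hS0 ((val _ hm).1.2 (by omega)), rfl, by simp only; omega⟩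
        refine hnb c (mem_sdiff.2 ⟨h3, hcUp⟩) c' ?_ ⟨h1, by omega⟩
        simp only [hV1, mem_sdiff]
        exact ⟨⟨⟨hcV', hcu⟩, hcLo⟩, h4⟩
      · intro h1 h2
        exact ⟨hL (mem_filter.2 ⟨hcV, c', hcV', h1.symm, h2⟩),
          hU (mem_filter.2 ⟨hcV', c, hcV, h1, h2⟩)⟩
  have hUL : Disjoint Up Lo := disjoint_left.2 fun c h1 h2 => lo0 c h2 (up0 h1)
  have conv : ∀ y z : MvPolynomial ℕ KField, ∑ S ∈ V.powerset,
      MvPolynomial.C (if IsSSYT f (raise (a + 1) τ S) then 1 else 0) *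
        (y ^ S.card * z ^ (V \ S).card) = (y * z) ^ Up.card * pairSum g V1 y z := by
    intro y z
    rw [← sum_filter_of_ne (p := fun S => Up ⊆ S ∧ Disjoint Lo S)]
    swap
    · intro S hS hne
      by_contra hcon
      apply hne
      rw [if_neg (fun h => hcon ((char S hS).1 h).1), map_zero, zero_mul]
    rw [pairSum, mul_sum]
    refine sum_bij' (fun S _ => S \ Up) (fun S _ => S ∪ Up) ?_ ?_ ?_ ?_ ?_
    · intro S hS
      simp only [mem_filter, mem_powerset] at hS ⊢
      intro c hc
      rw [mem_sdiff] at hc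
      rw [hV1, mem_sdiff, mem_sdiff]
      exact ⟨⟨hS.1 hc.1, hc.2⟩, fun h => disjoint_left.1 hS.2.2 h hc.1⟩
    · intro S hS
      simp only [mem_filter, mem_powerset] at hS ⊢
      refine ⟨union_subset (hS.trans ?_) (filter_subset _ _), subset_union_right, ?_⟩
      · exact sdiff_subset.trans sdiff_subset
      · rw [disjoint_union_right]
        refine ⟨disjoint_left.2 fun c h1 h2 => (mem_sdiff.1 (hS h2)).2 h1, hUL.symm⟩
    · intro S hS
      simp only [mem_filter] at hS
      exact sdiff_union_of_subset hS.2.1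
    · intro S hS
      rw [mem_powerset] at hS
      rw [union_sdiff_right]
      exact sdiff_eq_self_of_disjoint (disjoint_left.2 fun c h1 h2 =>
        (mem_sdiff.1 (mem_sdiff.1 (hS h1)).1).2 h2)
    · intro S hS
      simp only [mem_filter] at hS
      have hSV := mem_powerset.1 hS.1
      have hV1S : V1 \ (S \ Up) = V1 \ S := by
        ext c; simp only [hV1, mem_sdiff]; tauto
      have hc1 : S.card = Up.card + (S \ Up).card := by
        rw [card_sdiff_of_subset hS.2.1]; have := card_le_card hS.2.1; omega
      have hc2 : (V \ S).card = Up.card + (V1 \ (S \ Up)).card := by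
        rw [hV1S, hcard]
        have : V \ S = Lo ∪ (V1 \ S) := by
          ext c
          simp only [hV1, mem_sdiff, mem_union]
          constructor
          · rintro ⟨h1, h2⟩
            by_cases h : c ∈ Lo
            · exact Or.inl h
            · exact Or.inr ⟨⟨⟨h1, fun h => h2 (hS.2.1 h)⟩, h⟩, h2⟩
          · rintro (h | h)
            · exact ⟨(mem_filter.1 h).1, disjoint_left.1 hS.2.2 h⟩
            · exact ⟨h.1.1.1, h.2⟩
        rw [this, card_union_of_disjoint]
        exact disjoint_left.2 fun c h1 h2 => (mem_sdiff.1 (mem_sdiff.1 h2).1).2 h1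
      have hsp : splitWt g V1 (S \ Up) =
          MvPolynomial.C (if IsSSYT f (raise (a + 1) τ S) then 1 else 0) := by
        rw [splitWt, hV1S]
        by_cases hss : IsSSYT f (raise (a + 1) τ S)
        · rw [if_pos hss, map_one]
          refine prod_eq_one fun l hl => prod_eq_one fun r hr => ?_
          exact if_neg (((char S hS.1).1 hss).2 l hl r hr)
        · rw [if_neg hss, map_zero]
          rw [char S hS.1] at hss
          push Not at hss
          obtain ⟨l, hl, r, hr, hlr⟩ := hss hS.2
          refine prod_eq_zero hl (prod_eq_zero hr ?_)
          exact if_pos hlr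
      rw [hsp, hc1, hc2]
      ring
  rw [conv, conv, mul_comm y z]
  congr 1
  refine pairSum_comm rdKey rdKey_injective 0 V1 g ?_ ?_ y z
  · intro i _ j _ hij
    rw [← not_lt, rdKey_lt] at hij
    exact if_neg (fun h => hij (Or.inr h))
  · intro i _ j _ k _ hij hjk hik
    have h : i.2 = k.2 ∧ i.1 < k.1 := by
      by_contra h; exact hik (if_neg h)
    rw [rdKey_lt] at hij hjk
    exact ⟨if_pos (by omega), if_pos (by omega)⟩

/-! ### Coefficients of filling polynomials -/

/-- The content of a filling. -/
def cont {α : Type*} (C : Finset α) (σ : α → ℕ) : ℕ →₀ ℕ := ∑ c ∈ C, Finsupp.single (σ c) 1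

lemma cont_apply {α : Type*} (C : Finset α) (σ : α → ℕ) (k : ℕ) :
    cont C σ k = (C.filter fun c => σ c = k).card := by
  rw [cont, Finsupp.finsetSum_apply, card_filter]
  refine sum_congr rfl fun c _ => ?_
  rw [Finsupp.single_apply]

/-- The additive statistic `d ↦ Σ i * d i`. -/
def wsum : (ℕ →₀ ℕ) →+ ℕ := Finsupp.liftAddHom fun i => AddMonoidHom.mulLeft i

lemma wsum_single (i k : ℕ) : wsum (Finsupp.single i k) = i * k := by
  simp [wsum]

lemma wsum_cont {α : Type*} (C : Finset α) (σ : α → ℕ) : wsum (cont C σ) = ∑ c ∈ C, σ c := by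
  simp [cont, wsum_single]

lemma prod_X_eq {α F : Type*} [CommRing F] (C : Finset α) (σ : α → ℕ) :
    ∏ c ∈ C, (MvPolynomial.X (σ c) : MvPolynomial ℕ F) = MvPolynomial.monomial (cont C σ) 1 := by
  rw [cont, MvPolynomial.monomial_sum_one]; rfl

lemma coeff_fillPoly {α F : Type*} [DecidableEq α] [CommRing F] (C : Finset α) (N : ℕ)
    (wt : (α → ℕ) → F) (d : ℕ →₀ ℕ) :
    (fillPoly C N wt).coeff d = ∑ σ ∈ fills C N, if cont C σ = d then wt σ else 0 := by
  rw [fillPoly, MvPolynomial.coeff_sum]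
  refine sum_congr rfl fun σ _ => ?_
  rw [prod_X_eq, MvPolynomial.coeff_C_mul, MvPolynomial.coeff_monomial]
  split_ifs <;> simp

lemma mem_partFinset {n N : ℕ} {f : ℕ → ℕ} : f ∈ partFinset n N ↔
    f 0 = 0 ∧ (∀ j, N < j → f j = 0) ∧ (∀ i j, 1 ≤ i → i ≤ j → f j ≤ f i) ∧
      ∑ j ∈ Finset.Icc 1 N, f j = n := by
  have hsum : ∀ g : ℕ → ℕ, ∑ a : Fin N, g (a + 1) = ∑ j ∈ Finset.Icc 1 N, g j := by
    intro g
    rw [Fin.sum_univ_eq_sum_range (fun a => g (a + 1)), Finset.range_eq_Ico,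
      Finset.sum_Ico_add' g 0 N 1]
    rfl
  rw [partFinset, mem_image]
  constructor
  · rintro ⟨m, hm, rfl⟩
    rw [mem_filter] at hm
    obtain ⟨-, h1, h2⟩ := hm
    refine ⟨by simp, fun j hj => dif_neg (by omega), fun i j hi hij => ?_, ?_⟩
    · beta_reduce
      by_cases hj : j ≤ N
      · rw [dif_pos ⟨by omega, hj⟩, dif_pos ⟨hi, by omega⟩]
        exact h1 _ _ (by rw [Fin.le_def]; simp only; omega)
      · rw [dif_neg (by omega)]; exact Nat.zero_le _
    · rw [← hsum]
      refine Eq.trans (sum_congr rfl fun a _ => ?_) h2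
      rw [dif_pos ⟨by omega, by omega⟩]
      simp
  · rintro ⟨h0, h1, h2, h3⟩
    have hle : ∀ a : Fin N, f (a + 1) < n + 1 := by
      intro a
      have : f (a + 1) ≤ ∑ j ∈ Finset.Icc 1 N, f j :=
        single_le_sum (f := f) (fun _ _ => Nat.zero_le _) (mem_Icc.2 ⟨by omega, by omega⟩)
      omega
    refine ⟨fun a => ⟨f (a + 1), hle a⟩, ?_, ?_⟩
    · rw [mem_filter]
      refine ⟨mem_univ _, fun a b hab => h2 _ _ (by omega) (by rw [Fin.le_def] at hab; omega), ?_⟩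
      exact (hsum f).trans h3
    · funext j
      by_cases hj : 1 ≤ j ∧ j ≤ N
      · rw [dif_pos hj]
        simp only
        congr 1; omega
      · rw [dif_neg hj]
        rcases Nat.eq_zero_or_pos j with rfl | h
        · rw [h0]
        · rw [h1 j (by omega)]

lemma isShape_of_mem {n N : ℕ} {f : ℕ → ℕ} (h : f ∈ partFinset n N) : IsShape f := by
  rw [mem_partFinset] at h
  exact ⟨h.2.2.1, N + 1, fun j hj => h.2.1 j (by omega)⟩

/-- The exponent vector of a partition. -/
def partExp (N : ℕ) (f : ℕ → ℕ) : ℕ →₀ ℕ := ∑ j ∈ Finset.Icc 1 N, Finsupp.single j (f j)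

lemma partExp_apply {n N : ℕ} {f : ℕ → ℕ} (h : f ∈ partFinset n N) (j : ℕ) :
    partExp N f j = f j := by
  rw [mem_partFinset] at h
  rw [partExp, Finsupp.finsetSum_apply]
  simp only [Finsupp.single_apply, sum_ite_eq']
  split_ifs with hj
  · rfl
  · rw [mem_Icc] at hj
    rcases Nat.eq_zero_or_pos j with rfl | h'
    · rw [h.1]
    · rw [h.2.1 j (by omega)]

lemma cont_row {n N : ℕ} {f : ℕ → ℕ} (h : f ∈ partFinset n N) :
    cont (cells f) (fun c => c.2) = partExp N f := by
  ext j
  rw [partExp_apply h, cont_apply]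
  have hs := isShape_of_mem h
  rcases Nat.eq_zero_or_pos j with rfl | hj
  · rw [(mem_partFinset.1 h).1, card_eq_zero, filter_eq_empty_iff]
    intro c hc
    rw [mem_cells hs] at hc
    omega
  · have : ((cells f).filter fun c => c.2 = j) = (Finset.Icc 1 (f j)).image fun i => (i, j) := by
      ext ⟨a, b⟩
      simp only [mem_filter, mem_cells hs, mem_image, mem_Icc, Prod.mk.injEq]
      constructor
      · rintro ⟨⟨h1, h2, h3⟩, rfl⟩; exact ⟨a, ⟨h1, h3⟩, rfl, rfl⟩
      · rintro ⟨i, ⟨h1, h2⟩, rfl, rfl⟩; exact ⟨⟨h1, hj, h2⟩, rfl⟩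
    rw [this, card_image_of_injective _ (Prod.mk_left_injective j)]
    simp

lemma card_cells {n N : ℕ} {f : ℕ → ℕ} (h : f ∈ partFinset n N) : (cells f).card = n := by
  have h1 := congrArg Finsupp.degree (cont_row h)
  rw [cont, partExp, map_sum, map_sum] at h1
  simp only [Finsupp.degree_single, sum_const, smul_eq_mul, mul_one] at h1
  rw [h1]
  exact (mem_partFinset.1 h).2.2.2

lemma row_le_of_isSSYT {f : ℕ → ℕ} (hf : IsShape f) {N : ℕ} {T : ℕ × ℕ → ℕ}
    (hT : T ∈ fills (cells f) N) (h : IsSSYT f T) : ∀ c ∈ cells f, c.2 ≤ T c := by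
  rintro ⟨x, y⟩ hc
  rw [mem_fills] at hT
  induction y with
  | zero => exact Nat.zero_le _
  | succ y ih =>
    rcases Nat.eq_zero_or_pos y with rfl | hy
    · exact (hT.1 _ hc).1
    · have hm : (x, y) ∈ cells f := by
        rw [mem_cells hf] at hc ⊢
        have := hf.1 y (y + 1) hy (by omega)
        simp only at hc ⊢; omega
      have h1 := ih hm
      have h2 := h.2 _ hm _ hc rfl (by simp only; omega)
      simp only at h1 ⊢; omega

lemma coeff_schurK {n N : ℕ} {f : ℕ → ℕ} (hf : f ∈ partFinset n N) (d : ℕ →₀ ℕ)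
    (hd : wsum d ≤ wsum (partExp N f)) :
    (schurK f N).coeff d = if d = partExp N f then 1 else 0 := by
  have hs := isShape_of_mem hf
  have key : ∀ σ ∈ fills (cells f) N, IsSSYT f σ → cont (cells f) σ = d →
      ∀ c ∈ cells f, σ c = c.2 := by
    intro σ hσ h1 h2 c hc
    have h3 := row_le_of_isSSYT hs hσ h1
    rw [← h2, ← cont_row hf, wsum_cont, wsum_cont] at hd
    exact ((sum_eq_sum_iff_of_le h3).1 (le_antisymm (sum_le_sum h3) hd) c hc).symm
  have key2 : ∀ σ ∈ fills (cells f) N, IsSSYT f σ → cont (cells f) σ = d → d = partExp N f := by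
    intro σ hσ h1 h2
    rw [← h2, ← cont_row hf, cont, cont]
    exact sum_congr rfl fun c hc => by rw [key σ hσ h1 h2 c hc]
  rw [schurK_eq, coeff_fillPoly]
  split_ifs with hd'
  · let σ0 : ℕ × ℕ → ℕ := fun c => if c ∈ cells f then c.2 else 0
    have hσ0 : ∀ c ∈ cells f, σ0 c = c.2 := fun c hc => if_pos hc
    have hm : σ0 ∈ fills (cells f) N := by
      rw [mem_fills]
      refine ⟨fun c hc => ?_, fun c hc => if_neg hc⟩
      rw [hσ0 c hc]
      rw [mem_cells hs] at hc
      refine ⟨hc.2.1, ?_⟩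
      by_contra h
      have := (mem_partFinset.1 hf).2.1 c.2 (by omega)
      omega
    have hss : IsSSYT f σ0 := by
      refine ⟨fun c hc c' hc' h _ => ?_, fun c hc c' hc' _ h => ?_⟩
      · rw [hσ0 c hc, hσ0 c' hc', h]
      · rw [hσ0 c hc, hσ0 c' hc']; exact h
    have hc0 : cont (cells f) σ0 = d := by
      rw [hd', ← cont_row hf, cont, cont]
      exact sum_congr rfl fun c hc => by rw [hσ0 c hc]
    rw [sum_eq_single σ0]
    · rw [if_pos hc0, if_pos hss]
    · intro σ hσ hne
      split_ifs with h1 h2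
      · exfalso; apply hne
        funext c
        by_cases hc : c ∈ cells f
        · rw [key σ hσ h2 h1 c hc, hσ0 c hc]
        · rw [(mem_fills.1 hσ).2 c hc, (mem_fills.1 hm).2 c hc]
      · rfl
      · rfl
    · exact fun h => absurd hm h
  · refine sum_eq_zero fun σ hσ => ?_
    split_ifs with h1 h2
    · exact absurd (key2 σ hσ h2 h1) hd'
    · rfl
    · rfl

lemma partExp_injOn {n N : ℕ} {f g : ℕ → ℕ} (hf : f ∈ partFinset n N) (hg : g ∈ partFinset n N)
    (h : partExp N f = partExp N g) : f = g := by
  funext j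
  rw [← partExp_apply hf, ← partExp_apply hg, h]

/-- The matrix of coefficients of Schur polynomials at partitions is invertible. -/
lemma schur_matrix_injective (n N : ℕ) (K : (ℕ → ℕ) → KField)
    (h : ∀ ν ∈ partFinset n N,
      ∑ μ ∈ partFinset n N, K μ * (schurK μ N).coeff (partExp N ν) = 0) :
    ∀ μ ∈ partFinset n N, K μ = 0 := by
  by_contra hcon
  push Not at hcon
  obtain ⟨μ1, hμ1, hK1⟩ := hcon
  obtain ⟨μ, hμ, hmin⟩ := exists_min_image ((partFinset n N).filter fun μ => K μ ≠ 0)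
    (fun μ => wsum (partExp N μ)) ⟨μ1, mem_filter.2 ⟨hμ1, hK1⟩⟩
  rw [mem_filter] at hμ
  have h1 := h μ hμ.1
  rw [sum_eq_single μ] at h1
  · rw [coeff_schurK hμ.1 _ le_rfl, if_pos rfl, mul_one] at h1
    exact hμ.2 h1
  · intro ν hν hne
    by_cases hK : K ν = 0
    · rw [hK, zero_mul]
    · rw [coeff_schurK hν _ (hmin ν (mem_filter.2 ⟨hν, hK⟩)),
        if_neg (fun h => hne (partExp_injOn hμ.1 hν h).symm), mul_zero]
  · exact fun h => absurd hμ.1 h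

lemma schur_matrix_surjective (n N : ℕ) (g : (ℕ → ℕ) → KField) :
    ∃ K : (ℕ → ℕ) → KField, (∀ m, m ∉ partFinset n N → K m = 0) ∧
      ∀ ν ∈ partFinset n N,
        ∑ μ ∈ partFinset n N, K μ * (schurK μ N).coeff (partExp N ν) = g ν := by
  let Φ : (partFinset n N → KField) →ₗ[KField] (partFinset n N → KField) :=
    { toFun := fun K ν => ∑ μ, K μ * (schurK μ N).coeff (partExp N ν)
      map_add' := fun K L => by funext ν; simp [add_mul, sum_add_distrib]
      map_smul' := fun a K => by funext ν; simp [mul_assoc, mul_sum] }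
  have ext0 : ∀ (K : partFinset n N → KField) (ν : ℕ →₀ ℕ),
      ∑ μ ∈ partFinset n N, (if h : μ ∈ partFinset n N then K ⟨μ, h⟩ else 0) *
        (schurK μ N).coeff ν = ∑ μ, K μ * (schurK μ N).coeff ν := by
    intro K ν
    rw [← sum_coe_sort (partFinset n N)]
    refine sum_congr rfl fun μ _ => ?_
    rw [dif_pos μ.2]
  have hinj : Function.Injective Φ := by
    rw [← LinearMap.ker_eq_bot, LinearMap.ker_eq_bot']
    intro K hK
    have := schur_matrix_injective n N (fun μ => if h : μ ∈ partFinset n N then K ⟨μ, h⟩ else 0)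
      (fun ν hν => by rw [ext0]; exact congrFun hK ⟨ν, hν⟩)
    funext μ
    simpa using this μ μ.2
  obtain ⟨K, hK⟩ := LinearMap.injective_iff_surjective.1 hinj fun ν => g ν
  refine ⟨fun μ => if h : μ ∈ partFinset n N then K ⟨μ, h⟩ else 0, fun m hm => dif_neg hm,
    fun ν hν => ?_⟩
  rw [ext0]
  exact congrFun hK ⟨ν, hν⟩

/-- All monomials are of degree `n` in the variables `x_1, …, x_N`. -/
def IsHomog {F : Type*} [CommRing F] (n N : ℕ) (p : MvPolynomial ℕ F) : Prop :=
  ∀ d, p.coeff d ≠ 0 → (∀ j, d j ≠ 0 → 1 ≤ j ∧ j ≤ N) ∧ ∑ j ∈ Finset.Icc 1 N, d j = n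

lemma fillPoly_isHomog {α F : Type*} [DecidableEq α] [CommRing F] (C : Finset α) (N : ℕ)
    (wt : (α → ℕ) → F) : IsHomog C.card N (fillPoly C N wt) := by
  intro d hd
  rw [coeff_fillPoly] at hd
  obtain ⟨σ, hσ, h⟩ := exists_ne_zero_of_sum_ne_zero hd
  have hc : cont C σ = d := by
    by_contra hc; rw [if_neg hc] at h; exact h rfl
  rw [mem_fills] at hσ
  subst hc
  constructor
  · intro j hj
    rw [cont_apply, Ne, card_eq_zero, ← Ne, ← nonempty_iff_ne_empty] at hj
    obtain ⟨c, hc⟩ := hj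
    rw [mem_filter] at hc
    rw [← hc.2]; exact hσ.1 c hc.1
  · simp only [cont_apply]
    exact (card_eq_sum_card_fiberwise fun c hc => by
      rw [coe_Icc, Set.mem_Icc]; exact hσ.1 c hc).symm

lemma IsHomog.sub {F : Type*} [CommRing F] {n N : ℕ} {p p' : MvPolynomial ℕ F}
    (h : IsHomog n N p) (h' : IsHomog n N p') : IsHomog n N (p - p') := by
  intro d hd
  rw [MvPolynomial.coeff_sub] at hd
  by_cases h1 : p.coeff d = 0
  · exact h' d fun h2 => hd (by rw [h1, h2, sub_zero])
  · exact h d h1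

lemma IsHomog.sum {F ι : Type*} [CommRing F] {n N : ℕ} {s : Finset ι} {p : ι → MvPolynomial ℕ F}
    (h : ∀ i ∈ s, IsHomog n N (p i)) : IsHomog n N (∑ i ∈ s, p i) := by
  intro d hd
  rw [MvPolynomial.coeff_sum] at hd
  obtain ⟨i, hi, h1⟩ := exists_ne_zero_of_sum_ne_zero hd
  exact h i hi d h1

lemma IsHomog.C_mul {F : Type*} [CommRing F] {n N : ℕ} {p : MvPolynomial ℕ F}
    (h : IsHomog n N p) (a : F) : IsHomog n N (MvPolynomial.C a * p) := by
  intro d hd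
  rw [MvPolynomial.coeff_C_mul] at hd
  exact h d (right_ne_zero_of_mul hd)

lemma IsSym.sub {F : Type*} [CommRing F] {N : ℕ} {p p' : MvPolynomial ℕ F}
    (h : IsSym N p) (h' : IsSym N p') : IsSym N (p - p') := by
  intro a h1 h2
  rw [map_sub, h a h1 h2, h' a h1 h2]

lemma IsSym.sum {F ι : Type*} [CommRing F] {N : ℕ} {s : Finset ι} {p : ι → MvPolynomial ℕ F}
    (h : ∀ i ∈ s, IsSym N (p i)) : IsSym N (∑ i ∈ s, p i) := by
  intro a h1 h2
  rw [map_sum]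
  exact sum_congr rfl fun i hi => h i hi a h1 h2

lemma IsSym.prod {F ι : Type*} [CommRing F] {N : ℕ} {s : Finset ι} {p : ι → MvPolynomial ℕ F}
    (h : ∀ i ∈ s, IsSym N (p i)) : IsSym N (∏ i ∈ s, p i) := by
  intro a h1 h2
  rw [map_prod]
  exact prod_congr rfl fun i hi => h i hi a h1 h2

lemma IsSym.C_mul {F : Type*} [CommRing F] {N : ℕ} {p : MvPolynomial ℕ F}
    (h : IsSym N p) (c : F) : IsSym N (MvPolynomial.C c * p) := by
  intro a h1 h2
  rw [map_mul, MvPolynomial.rename_C, h a h1 h2]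

lemma IsSym.eq_zero {F : Type*} [CommRing F] {n N : ℕ} {p : MvPolynomial ℕ F} (hs : IsSym N p)
    (hh : IsHomog n N p) (h0 : ∀ μ ∈ partFinset n N, p.coeff (partExp N μ) = 0) : p = 0 := by
  ext d
  rw [MvPolynomial.coeff_zero]
  induction hk : wsum d using Nat.strong_induction_on generalizing d with
  | _ k ih =>
  by_contra hd
  obtain ⟨h1, h2⟩ := hh d hd
  by_cases hex : ∃ a, 1 ≤ a ∧ a + 1 ≤ N ∧ d a < d (a + 1)
  · obtain ⟨a, ha, haN, hlt⟩ := hex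
    have e1 := hs a ha haN
    have e2 : p.coeff (d.mapDomain (Equiv.swap a (a + 1))) = p.coeff d := by
      conv_lhs => rw [← e1]
      exact MvPolynomial.coeff_rename_mapDomain _ (Equiv.injective _) _ _
    apply hd
    rw [← e2]
    refine ih _ ?_ _ rfl
    rw [← hk]
    have hsplit : d = Finsupp.single a (d a) + (Finsupp.single (a + 1) (d (a + 1)) +
        (d.erase (a + 1)).erase a) := by
      ext j
      simp only [Finsupp.add_apply, Finsupp.single_apply, Finsupp.erase_apply]
      split_ifs <;> first | omega | (subst_vars; simp)
    have hfix : ((d.erase (a + 1)).erase a).mapDomain (Equiv.swap a (a + 1)) =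
        (d.erase (a + 1)).erase a := by
      rw [Finsupp.mapDomain_congr (g := id)]
      · exact Finsupp.mapDomain_id
      · intro j hj
        simp only [Finsupp.support_erase, mem_erase] at hj
        exact Equiv.swap_apply_of_ne_of_ne hj.1 hj.2.1
    generalize hd' : (d.erase (a + 1)).erase a = d' at hsplit hfix
    generalize d a = u at *
    generalize d (a + 1) = v at *
    rw [hsplit, Finsupp.mapDomain_add, Finsupp.mapDomain_add, hfix, Finsupp.mapDomain_single,
      Finsupp.mapDomain_single, Equiv.swap_apply_left, Equiv.swap_apply_right]
    simp only [map_add, wsum_single]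
    nlinarith
  · push Not at hex
    have hm : (fun j => d j) ∈ partFinset n N := by
      rw [mem_partFinset]
      have hz : ∀ j, N < j → d j = 0 := fun j hj => by
        by_contra h; have := h1 j h; omega
      refine ⟨?_, hz, ?_, h2⟩
      · by_contra h; have := h1 0 h; omega
      · intro i j hi hij
        induction j, hij using Nat.le_induction with
        | base => exact le_rfl
        | succ j hij ih' =>
          refine le_trans ?_ ih'
          by_cases hj : j + 1 ≤ N
          · exact hex j (by omega) hj
          · show d (j + 1) ≤ d j
            rw [hz (j + 1) (by omega)]; exact Nat.zero_le _
    apply hd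
    rw [← h0 _ hm]
    congr 1
    ext j
    rw [partExp_apply hm]

lemma schurK_isHomog {n N : ℕ} {f : ℕ → ℕ} (h : f ∈ partFinset n N) :
    IsHomog n N (schurK f N) := by
  rw [schurK_eq]
  have := fillPoly_isHomog (cells f) N (fun σ => if IsSSYT f σ then (1 : KField) else 0)
  rwa [card_cells h] at this

/-- Unique Schur expansion of a symmetric homogeneous polynomial. -/
theorem existsUnique_schur_expansion {n N : ℕ} {p : MvPolynomial ℕ KField} (hs : IsSym N p)
    (hh : IsHomog n N p) {c : KField} (hc : c ≠ 0) :
    ∃! K : (ℕ → ℕ) → KField, (∀ m, m ∉ partFinset n N → K m = 0) ∧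
      p = MvPolynomial.C c * ∑ m ∈ partFinset n N, MvPolynomial.C (K m) * schurK m N := by
  have hco : ∀ (K : (ℕ → ℕ) → KField) (d : ℕ →₀ ℕ),
      (MvPolynomial.C c * ∑ m ∈ partFinset n N, MvPolynomial.C (K m) * schurK m N).coeff d =
      c * ∑ m ∈ partFinset n N, K m * (schurK m N).coeff d := by
    intro K d
    rw [MvPolynomial.coeff_C_mul, MvPolynomial.coeff_sum]
    simp only [MvPolynomial.coeff_C_mul]
  obtain ⟨K, hK0, hK⟩ := schur_matrix_surjective n N fun ν => c⁻¹ * p.coeff (partExp N ν)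
  refine ⟨K, ⟨hK0, ?_⟩, ?_⟩
  · rw [← sub_eq_zero]
    refine IsSym.eq_zero (n := n) (N := N) (hs.sub (IsSym.C_mul (IsSym.sum fun m hm =>
      IsSym.C_mul (schurK_isSym (isShape_of_mem hm) N) _) _))
      (hh.sub (IsHomog.C_mul (IsHomog.sum fun m hm => (schurK_isHomog hm).C_mul _) _)) ?_
    intro ν hν
    rw [MvPolynomial.coeff_sub, hco, hK ν hν]
    field_simp
    ring
  · rintro L ⟨hL0, hL⟩
    funext m
    by_cases hm : m ∈ partFinset n N
    · rw [← sub_eq_zero]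
      refine schur_matrix_injective n N (fun m => L m - K m) (fun ν hν => ?_) m hm
      have e1 := congrArg (MvPolynomial.coeff (partExp N ν)) hL
      rw [hco] at e1
      simp only [sub_mul, sum_sub_distrib]
      rw [hK ν hν, e1]
      field_simp
      ring
    · rw [hL0 m hm, hK0 m hm]

/-! ### The hook functional -/

section HookFunctional

variable {α β : Type*} [DecidableEq α] [LinearOrder β] (rd : α → β) (C : Finset α)

/-- `σ` is onto `{1, …, m}` and takes values smaller than `m` at most `s` times. -/
def GoodFill (s m : ℕ) (σ : α → ℕ) : Prop :=
  (∀ c ∈ C, 1 ≤ σ c ∧ σ c ≤ m) ∧ (∀ k, 1 ≤ k → k ≤ m → ∃ c ∈ C, σ c = k) ∧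
    (C.filter fun c => σ c < m).card ≤ s

/-- The value `i` is taken once, and later than some occurrence of `i + 1`. -/
def DescAt (σ : α → ℕ) (i : ℕ) : Prop :=
  ∃ f ∈ C, σ f = i ∧ (∀ c ∈ C, σ c = i → c = f) ∧ ∃ w ∈ C, σ w = i + 1 ∧ rd w < rd f

variable {rd C}

omit [DecidableEq α] in
lemma GoodFill.sup_eq {s m : ℕ} {σ : α → ℕ} (h : GoodFill C s m σ) : C.sup σ = m := by
  refine le_antisymm (Finset.sup_le fun c hc => (h.1 c hc).2) ?_
  rcases Nat.eq_zero_or_pos m with rfl | hm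
  · exact Nat.zero_le _
  · obtain ⟨c, hc, rfl⟩ := h.2.1 m hm le_rfl
    exact Finset.le_sup hc

omit [DecidableEq α] in
lemma GoodFill.le {s m : ℕ} {σ : α → ℕ} (h : GoodFill C s m σ) : m ≤ s + 1 := by
  have h1 : Finset.Icc 1 (m - 1) ⊆ (C.filter fun c => σ c < m).image σ := by
    intro k hk
    rw [mem_Icc] at hk
    obtain ⟨c, hc, rfl⟩ := h.2.1 k hk.1 (by omega)
    exact mem_image_of_mem _ (mem_filter.2 ⟨hc, by omega⟩)
  have h2 := (card_le_card h1).trans (card_image_le.trans h.2.2)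
  rw [Nat.card_Icc] at h2
  omega

omit [DecidableEq α] in
lemma DescAt.unique {σ : α → ℕ} {i : ℕ} (h : DescAt rd C σ i) {c d : α} (hc : c ∈ C) (hd : d ∈ C)
    (h1 : σ c = i) (h2 : σ d = i) : c = d := by
  obtain ⟨f, _, _, h, _⟩ := h
  rw [h c hc h1, h d hd h2]

/-- Merge the value `p + 1` with `p`. -/
def mergeFill (p : ℕ) (σ : α → ℕ) : α → ℕ := fun c => if p < σ c then σ c - 1 else σ c

omit [DecidableEq α] [LinearOrder β] in
lemma mergeFill_lt {p i : ℕ} (hi : i < p) (σ : α → ℕ) (c : α) :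
    mergeFill p σ c = i ↔ σ c = i := by
  simp only [mergeFill]; split_ifs <;> omega

omit [DecidableEq α] in
lemma mergeFill_desc {p i : ℕ} (hi : i < p) (σ : α → ℕ) (h : DescAt rd C σ i) :
    DescAt rd C (mergeFill p σ) i := by
  obtain ⟨f, hf, h1, h2, w, hw, h3, h4⟩ := h
  refine ⟨f, hf, (mergeFill_lt hi σ f).2 h1, fun c hc h => h2 c hc ((mergeFill_lt hi σ c).1 h),
    w, hw, ?_, h4⟩
  simp only [mergeFill]; split_ifs <;> omega

/-- The values `1, …, p - 1` are descents. -/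
def DescBelow (rd : α → β) (C : Finset α) (p : ℕ) (σ : α → ℕ) : Prop :=
  ∀ i, 1 ≤ i → i < p → DescAt rd C σ i

/-- Good fillings whose values `1, …, p - 1` are descents. -/
def goodSet (rd : α → β) (C : Finset α) (N s p : ℕ) : Finset (α → ℕ) :=
  (fills C N).filter fun σ => GoodFill C s (C.sup σ) σ ∧ DescBelow rd C p σ

lemma mem_goodSet {N s p : ℕ} {σ : α → ℕ} : σ ∈ goodSet rd C N s p ↔
    σ ∈ fills C N ∧ GoodFill C s (C.sup σ) σ ∧ ∀ i, 1 ≤ i → i < p → DescAt rd C σ i := by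
  rw [goodSet, mem_filter]; rfl

lemma sum_goodSet_not_desc {F : Type*} [CommRing F] (hrd : Function.Injective rd) {N s p : ℕ}
    (hp : 1 ≤ p) (hps : p ≤ s) (hs : s + 1 ≤ C.card) (hN : s + 1 ≤ N) (wt : (α → ℕ) → F)
    (hwt : ∀ σ ∈ fills C N, ∀ τ ∈ fills C N, (∀ u ∈ C, ∀ w ∈ C, rd u < rd w →
      (σ w < σ u ↔ τ w < τ u)) → wt σ = wt τ) :
    ∑ σ ∈ (goodSet rd C N s p).filter (fun σ => ¬ DescAt rd C σ p),
      (-1 : F) ^ (s + 1 + C.sup σ) * wt σ = 0 := by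
  rw [← sum_filter_add_sum_filter_not _ fun σ : α → ℕ =>
    ∃ f ∈ C, σ f = p ∧ ∀ c ∈ C, σ c = p → c = f]
  rw [add_eq_zero_iff_eq_neg, ← sum_neg_distrib]
  simp only [filter_filter]
  -- facts on a singleton value `p`
  have fact : ∀ σ, σ ∈ goodSet rd C N s p → ¬ DescAt rd C σ p →
      ∀ f ∈ C, σ f = p → (∀ c ∈ C, σ c = p → c = f) →
      p < C.sup σ ∧ ∀ w ∈ C, σ w = p + 1 → rd f < rd w := by
    intro σ hσ hnd f hf hfp huniq
    rw [mem_goodSet] at hσ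
    obtain ⟨hσf, hg, hd⟩ := hσ
    refine ⟨?_, fun w hw hwp => ?_⟩
    · have hle : p ≤ C.sup σ := hfp ▸ Finset.le_sup hf
      rcases hle.lt_or_eq with h | h
      · exact h
      · exfalso
        have hinj : C.card ≤ (Finset.Icc 1 p).card := by
          refine card_le_card_of_injOn σ (fun c hc => ?_) (fun c hc c' hc' h' => ?_)
          · rw [coe_Icc, Set.mem_Icc, h]; exact hg.1 c hc
          · rw [mem_coe] at hc hc'
            have := hg.1 c hc
            rcases (this.2.trans h.symm.le).lt_or_eq with h1 | h1
            · exact (hd (σ c) this.1 h1).unique hc hc' rfl h'.symm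
            · rw [huniq c hc h1, huniq c' hc' (by omega)]
        rw [Nat.card_Icc] at hinj
        omega
    · by_contra hlt
      apply hnd
      refine ⟨f, hf, hfp, huniq, w, hw, hwp, lt_of_le_of_ne (not_lt.1 hlt) fun h => ?_⟩
      rw [hrd h] at hwp; omega
  refine sum_bij (fun σ _ => mergeFill p σ) ?_ ?_ ?_ ?_
  · intro σ hσ
    rw [mem_filter] at hσ ⊢
    obtain ⟨hσ, hnd, f, hf, hfp, huniq⟩ := hσ
    obtain ⟨hpm, hbef⟩ := fact σ hσ hnd f hf hfp huniq
    rw [mem_goodSet] at hσ ⊢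
    obtain ⟨hσf, hg, hd⟩ := hσ
    obtain ⟨w, hw, hwp⟩ := hg.2.1 (p + 1) (by omega) (by omega)
    have hfm : mergeFill p σ f = p := by simp [mergeFill, hfp]
    have hwm : mergeFill p σ w = p := by simp [mergeFill, hwp]
    have hne : f ≠ w := by rintro rfl; omega
    have hgm : GoodFill C s (C.sup σ - 1) (mergeFill p σ) := by
      refine ⟨fun c hc => ?_, fun k hk1 hk2 => ?_, (card_le_card ?_).trans hg.2.2⟩
      · have := hg.1 c hc
        simp only [mergeFill]; split_ifs <;> omega
      · by_cases hkp : k ≤ p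
        · obtain ⟨c, hc, h⟩ := hg.2.1 k hk1 (by omega)
          refine ⟨c, hc, ?_⟩
          simp only [mergeFill]; split_ifs <;> omega
        · obtain ⟨c, hc, h⟩ := hg.2.1 (k + 1) (by omega) (by omega)
          refine ⟨c, hc, ?_⟩
          simp only [mergeFill]; split_ifs <;> omega
      · intro c hc
        rw [mem_filter] at hc ⊢
        refine ⟨hc.1, ?_⟩
        have := hc.2
        simp only [mergeFill] at this
        split_ifs at this <;> omega
    have hgm' := hgm.sup_eq ▸ hgm
    have hsingle : ¬ ∃ f ∈ C, mergeFill p σ f = p ∧ ∀ c ∈ C, mergeFill p σ c = p → c = f := by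
      rintro ⟨g, _, _, h⟩
      exact hne ((h f hf hfm).trans (h w hw hwm).symm)
    refine ⟨⟨?_, by rwa [hgm.sup_eq], fun i hi1 hi2 => mergeFill_desc hi2 σ (hd i hi1 hi2)⟩, ?_,
      hsingle⟩
    · rw [mem_fills] at hσf ⊢
      refine ⟨fun c hc => ?_, fun c hc => ?_⟩
      · have := hσf.1 c hc
        simp only [mergeFill]; split_ifs <;> omega
      · have := hσf.2 c hc
        simp only [mergeFill]; split_ifs <;> omega
    · rintro ⟨g, hg1, hg2, hg3, _⟩
      exact hsingle ⟨g, hg1, hg2, hg3⟩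
  · intro σ hσ τ hτ he
    rw [mem_filter] at hσ hτ
    obtain ⟨hσ, hnd, f, hf, hfp, huniq⟩ := hσ
    obtain ⟨hτ, hnd', f', hf', hfp', huniq'⟩ := hτ
    obtain ⟨hpm, hbef⟩ := fact σ hσ hnd f hf hfp huniq
    obtain ⟨hpm', hbef'⟩ := fact τ hτ hnd' f' hf' hfp' huniq'
    have he' : ∀ c, mergeFill p σ c = mergeFill p τ c := fun c => congrFun he c
    have hff : f = f' := by
      have h1 := he' f
      have h2 := he' f'
      simp only [mergeFill, hfp, hfp', lt_irrefl, if_false] at h1 h2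
      by_contra hne
      have h3 : τ f = p + 1 := by
        have : τ f ≠ p := fun h => hne (huniq' f hf h)
        split_ifs at h1 <;> omega
      have h4 : σ f' = p + 1 := by
        have : σ f' ≠ p := fun h => hne (huniq f' hf' h).symm
        split_ifs at h2 <;> omega
      exact lt_asymm (hbef f' hf' h4) (hbef' f hf h3)
    subst hff
    rw [mem_goodSet, mem_fills] at hσ hτ
    funext c
    by_cases hc : c ∈ C
    · have h1 := he' c
      have h2 := huniq c hc
      have h3 := huniq' c hc
      simp only [mergeFill] at h1
      by_cases hcf : c = f
      · rw [hcf, hfp, hfp']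
      · have h2 := mt h2 hcf
        have h3 := mt h3 hcf
        split_ifs at h1 <;> omega
    · rw [hσ.1.2 c hc, hτ.1.2 c hc]
  · intro σ hσ
    rw [mem_filter] at hσ
    obtain ⟨hσ, hnd, hns⟩ := hσ
    have hσ' := hσ
    rw [mem_goodSet] at hσ
    obtain ⟨hσf, hg, hd⟩ := hσ
    have hpm : p ≤ C.sup σ := by
      by_contra hlt
      have hC : C.Nonempty := card_pos.1 (by omega)
      obtain ⟨c, hc⟩ := hC
      have hm1 := (hg.1 c hc)
      obtain ⟨_, _, _, _, w, hw, hw1, _⟩ := hd (C.sup σ) (by omega) (by omega)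
      have := (hg.1 w hw).2
      omega
    obtain ⟨c0, hc0, hc0p⟩ := hg.2.1 p hp hpm
    obtain ⟨f, hf, hmin⟩ := exists_min_image (C.filter fun c => σ c = p) rd
      ⟨c0, mem_filter.2 ⟨hc0, hc0p⟩⟩
    rw [mem_filter] at hf
    obtain ⟨hf, hfp⟩ := hf
    push Not at hns
    obtain ⟨c1, hc1, hc1p, hc1f⟩ := hns f hf hfp
    let τ : α → ℕ := fun c => if σ c < p ∨ c = f then σ c else σ c + 1
    have hτf : τ f = p := by simp [τ, hfp]
    have hlt : ∀ c, ∀ i < p, τ c = i ↔ σ c = i := by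
      intro c i hi
      simp only [τ]
      by_cases hcf : c = f
      · simp [hcf]
      · simp only [hcf, or_false]; split_ifs <;> omega
    have hp' : ∀ c, τ c = p → c = f := by
      intro c h
      by_contra hcf
      simp only [τ, hcf, or_false] at h
      split_ifs at h <;> omega
    have hp1 : ∀ c ∈ C, τ c = p + 1 → rd f < rd c := by
      intro c hc h
      have hcf : c ≠ f := by rintro rfl; omega
      simp only [τ, hcf, or_false] at h
      have : σ c = p := by split_ifs at h <;> omega
      exact lt_of_le_of_ne (hmin c (mem_filter.2 ⟨hc, this⟩)) fun h => hcf (hrd h).symm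
    have hmerge : mergeFill p τ = σ := by
      funext c
      simp only [mergeFill, τ]
      by_cases hcf : c = f
      · subst hcf; simp [hfp]
      · simp only [hcf, or_false]; split_ifs <;> omega
    have hdτ : ∀ i, 1 ≤ i → i < p → DescAt rd C τ i := by
      intro i hi1 hi2
      obtain ⟨g, hg1, hg2, hg3, w, hw, hw1, hw2⟩ := hd i hi1 hi2
      refine ⟨g, hg1, (hlt g i hi2).2 hg2, fun c hc h => hg3 c hc ((hlt c i hi2).1 h), ?_⟩
      by_cases hip : i + 1 < p
      · exact ⟨w, hw, (hlt w _ hip).2 hw1, hw2⟩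
      · refine ⟨f, hf, by omega, lt_of_le_of_lt (hmin w (mem_filter.2 ⟨hw, by omega⟩)) hw2⟩
    have hgτ : GoodFill C s (C.sup σ + 1) τ := by
      refine ⟨fun c hc => ?_, fun k hk1 hk2 => ?_, ?_⟩
      · have := hg.1 c hc
        simp only [τ]; split_ifs <;> omega
      · rcases lt_trichotomy k p with h | h | h
        · obtain ⟨c, hc, h'⟩ := hg.2.1 k hk1 (by omega)
          exact ⟨c, hc, (hlt c k h).2 h'⟩
        · exact ⟨f, hf, by omega⟩
        · by_cases hkp : k = p + 1
          · refine ⟨c1, hc1, ?_⟩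
            simp only [τ, hc1f, or_false, hc1p, lt_irrefl, if_false, hkp]
          · obtain ⟨c, hc, h'⟩ := hg.2.1 (k - 1) (by omega) (by omega)
            refine ⟨c, hc, ?_⟩
            have hcf : c ≠ f := by rintro rfl; omega
            simp only [τ, hcf, or_false]; split_ifs <;> omega
      · rcases hpm.lt_or_eq with h | h
        · refine (card_le_card fun c hc => ?_).trans hg.2.2
          rw [mem_filter] at hc ⊢
          refine ⟨hc.1, ?_⟩
          have h1 := hc.2
          have h2 := hg.1 c hc.1
          simp only [τ] at h1
          by_cases hcf : c = f
          · rw [hcf, hfp]; exact h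
          · simp only [hcf, or_false] at h1; split_ifs at h1 <;> omega
        · have hinj : (C.filter fun c => τ c < C.sup σ + 1).card ≤ (Finset.Icc 1 p).card := by
            refine card_le_card_of_injOn τ (fun c hc => ?_) (fun c hc c' hc' h' => ?_)
            · rw [mem_coe, mem_filter] at hc
              rw [coe_Icc, Set.mem_Icc]
              have := hg.1 c hc.1
              refine ⟨?_, by omega⟩
              simp only [τ]; split_ifs <;> omega
            · rw [mem_coe, mem_filter] at hc hc'
              by_cases h1 : τ c = p
              · rw [hp' c h1, hp' c' (by omega)]
              · have h2 : τ c < p := by omega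
                have h3 : 1 ≤ τ c := by
                  have := hg.1 c hc.1
                  simp only [τ]; split_ifs <;> omega
                exact (hdτ _ h3 h2).unique hc.1 hc'.1 rfl h'.symm
          rw [Nat.card_Icc] at hinj
          omega
    have hsup := hgτ.sup_eq
    have hle := hgτ.le
    refine ⟨τ, ?_, hmerge⟩
    rw [mem_filter, mem_goodSet, hsup]
    refine ⟨⟨?_, hgτ, hdτ⟩, ?_, f, hf, hτf, fun c _ h => hp' c h⟩
    · rw [mem_fills] at hσf ⊢
      refine ⟨fun c hc => ?_, fun c hc => ?_⟩
      · have := hgτ.1 c hc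
        omega
      · have h0 := hσf.2 c hc
        simp only [τ]; rw [if_pos (by omega), h0]
    · rintro ⟨g, hg1, hg2, hg3, w, hw, hw1, hw2⟩
      rw [hp' g hg2] at hw2
      exact lt_asymm hw2 (hp1 w hw hw1)
  · intro σ hσ
    rw [mem_filter] at hσ
    obtain ⟨hσ, hnd, f, hf, hfp, huniq⟩ := hσ
    obtain ⟨hpm, hbef⟩ := fact σ hσ hnd f hf hfp huniq
    rw [mem_goodSet] at hσ
    obtain ⟨hσf, hg, hd⟩ := hσ
    have hsup : C.sup (mergeFill p σ) = C.sup σ - 1 := by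
      refine le_antisymm (Finset.sup_le fun c hc => ?_) ?_
      · have := hg.1 c hc
        simp only [mergeFill]; split_ifs <;> omega
      · obtain ⟨c, hc, h⟩ := hg.2.1 (C.sup σ) (by omega) le_rfl
        have h1 : mergeFill p σ c = C.sup σ - 1 := by
          simp only [mergeFill]; rw [if_pos (by omega), h]
        rw [← h1]; exact Finset.le_sup hc
    have hw : wt (mergeFill p σ) = wt σ := by
      refine hwt _ ?_ _ hσf fun u hu w hw huw => ?_
      · rw [mem_fills] at hσf ⊢
        refine ⟨fun c hc => ?_, fun c hc => ?_⟩
        · have := hσf.1 c hc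
          simp only [mergeFill]; split_ifs <;> omega
        · have := hσf.2 c hc
          simp only [mergeFill]; split_ifs <;> omega
      · have h1 : ¬ (σ u = p + 1 ∧ σ w = p) := by
          rintro ⟨h1, h2⟩
          rw [huniq w hw h2] at huw
          exact lt_asymm huw (hbef u hu h1)
        simp only [mergeFill]; split_ifs <;> omega
    rw [hw, hsup]
    obtain ⟨m, hm⟩ : ∃ m, C.sup σ = m + 1 := ⟨C.sup σ - 1, by omega⟩
    rw [hm, Nat.add_sub_cancel, ← add_assoc, pow_succ]
    ring

end HookFunctional

section HookFill

variable {α β : Type*} [DecidableEq α] [LinearOrder β] {rd : α → β} {C : Finset α}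

lemma goodSet_succ (N s p : ℕ) (hp : 1 ≤ p) :
    goodSet rd C N s (p + 1) = (goodSet rd C N s p).filter fun σ => DescAt rd C σ p := by
  ext σ
  rw [mem_filter, mem_goodSet, mem_goodSet, and_assoc, and_assoc]
  refine and_congr_right fun _ => and_congr_right fun _ => ⟨fun h => ⟨fun i h1 h2 =>
    h i h1 (by omega), h p hp (by omega)⟩, fun h i h1 h2 => ?_⟩
  rcases (Nat.lt_succ_iff.1 h2).lt_or_eq with h3 | rfl
  exacts [h.1 i h1 h3, h.2]

lemma sum_goodSet {F : Type*} [CommRing F] (hrd : Function.Injective rd) {N s : ℕ}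
    (hs : s + 1 ≤ C.card) (hN : s + 1 ≤ N) (wt : (α → ℕ) → F)
    (hwt : ∀ σ ∈ fills C N, ∀ τ ∈ fills C N, (∀ u ∈ C, ∀ w ∈ C, rd u < rd w →
      (σ w < σ u ↔ τ w < τ u)) → wt σ = wt τ) (p : ℕ) (hp : p ≤ s) :
    ∑ σ ∈ goodSet rd C N s 1, (-1 : F) ^ (s + 1 + C.sup σ) * wt σ =
      ∑ σ ∈ goodSet rd C N s (p + 1), (-1 : F) ^ (s + 1 + C.sup σ) * wt σ := by
  induction p with
  | zero => rfl
  | succ p ih =>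
    rw [ih (by omega), goodSet_succ N s (p + 1) (by omega),
      ← sum_filter_add_sum_filter_not (goodSet rd C N s (p + 1)) fun σ => DescAt rd C σ (p + 1),
      sum_goodSet_not_desc hrd (by omega) hp hs hN wt hwt, add_zero]

variable (rd C) in
/-- The filling with the value `s + 1` off `D`, and `1, …, #D` on `D`, backwards. -/
def hookFill (s : ℕ) (D : Finset α) : α → ℕ := fun c =>
  if c ∈ D then (D.filter fun d => rd c ≤ rd d).card else if c ∈ C then s + 1 else 0

lemma hookFill_pos {s : ℕ} {D : Finset α} {c : α} (hc : c ∈ D) : 1 ≤ hookFill rd C s D c := by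
  rw [hookFill, if_pos hc]
  exact card_pos.2 ⟨c, mem_filter.2 ⟨hc, le_rfl⟩⟩

lemma hookFill_le {s : ℕ} {D : Finset α} (hs : D.card ≤ s) {c : α} (hc : c ∈ D) :
    hookFill rd C s D c ≤ s := by
  rw [hookFill, if_pos hc]
  exact (card_filter_le _ _).trans hs

lemma hookFill_of_notMem {s : ℕ} {D : Finset α} {c : α} (hc : c ∉ D) (hC : c ∈ C) :
    hookFill rd C s D c = s + 1 := by
  rw [hookFill, if_neg hc, if_pos hC]

lemma hookFill_lt_of_mem {s : ℕ} {D : Finset α} {u w : α} (hu : u ∈ D)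
    (hw : w ∈ D) (h : rd u < rd w) : hookFill rd C s D w < hookFill rd C s D u := by
  rw [hookFill, hookFill, if_pos hu, if_pos hw]
  refine card_lt_card ⟨fun d hd => ?_, fun hd => ?_⟩
  · rw [mem_filter] at hd ⊢
    exact ⟨hd.1, h.le.trans hd.2⟩
  · have := (mem_filter.1 (hd (mem_filter.2 ⟨hu, le_rfl⟩))).2
    exact absurd h (not_lt.2 this)

lemma hookFill_lt_iff {s : ℕ} {D : Finset α} (hs : D.card ≤ s) {u w : α} (hu : u ∈ C)
    (hw : w ∈ C) (h : rd u < rd w) :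
    hookFill rd C s D w < hookFill rd C s D u ↔ w ∈ D := by
  by_cases hwD : w ∈ D
  · refine iff_of_true ?_ hwD
    by_cases huD : u ∈ D
    · exact hookFill_lt_of_mem huD hwD h
    · have := hookFill_le (rd := rd) (C := C) hs hwD
      rw [hookFill_of_notMem huD hu]
      omega
  · refine iff_of_false ?_ hwD
    rw [hookFill_of_notMem hwD hw, not_lt]
    by_cases huD : u ∈ D
    · exact (hookFill_le hs huD).trans (by omega)
    · rw [hookFill_of_notMem huD hu]

lemma hookFill_mem_goodSet (hrd : Function.Injective rd) {N s : ℕ} (hN : s + 1 ≤ N) {c0 : α}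
    (hc0 : c0 ∈ C) (hmin : ∀ c ∈ C, rd c0 ≤ rd c) {D : Finset α}
    (hD : D ∈ (C.erase c0).powersetCard s) :
    hookFill rd C s D ∈ goodSet rd C N s (s + 1) ∧ C.sup (hookFill rd C s D) = s + 1 := by
  rw [mem_powersetCard] at hD
  obtain ⟨hDC, hcard⟩ := hD
  have hDC' := hDC.trans (erase_subset _ _)
  have h0 : c0 ∉ D := fun h => notMem_erase _ _ (hDC h)
  have hinj : Set.InjOn (hookFill rd C s D) D := by
    intro c hc d hd h
    rcases lt_trichotomy (rd c) (rd d) with h1 | h1 | h1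
    · exact absurd h (hookFill_lt_of_mem hc hd h1).ne'
    · exact hrd h1
    · exact absurd h (hookFill_lt_of_mem hd hc h1).ne
  have himg : D.image (hookFill rd C s D) = Finset.Icc 1 s := by
    refine eq_of_subset_of_card_le (fun k hk => ?_) ?_
    · obtain ⟨c, hc, rfl⟩ := mem_image.1 hk
      exact mem_Icc.2 ⟨hookFill_pos hc, hookFill_le hcard.le hc⟩
    · rw [card_image_of_injOn hinj, hcard, Nat.card_Icc]; omega
  have hsurj : ∀ k, 1 ≤ k → k ≤ s → ∃ c ∈ D, hookFill rd C s D c = k := fun k h1 h2 =>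
    mem_image.1 (himg ▸ mem_Icc.2 ⟨h1, h2⟩)
  have hmemD : ∀ c ∈ C, hookFill rd C s D c ≤ s → c ∈ D := by
    intro c hc h
    by_contra hcD
    rw [hookFill_of_notMem hcD hc] at h
    omega
  have hbd : ∀ c ∈ C, 1 ≤ hookFill rd C s D c ∧ hookFill rd C s D c ≤ s + 1 := by
    intro c hc
    by_cases hcD : c ∈ D
    · exact ⟨hookFill_pos hcD, (hookFill_le hcard.le hcD).trans (by omega)⟩
    · rw [hookFill_of_notMem hcD hc]; omega
  have hg : GoodFill C s (s + 1) (hookFill rd C s D) := by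
    refine ⟨hbd, fun k h1 h2 => ?_, ?_⟩
    · rcases (Nat.lt_or_ge s k) with h | h
      · exact ⟨c0, hc0, by rw [hookFill_of_notMem h0 hc0]; omega⟩
      · obtain ⟨c, hc, hk⟩ := hsurj k h1 h
        exact ⟨c, hDC' hc, hk⟩
    · refine (card_le_card fun c hc => ?_).trans hcard.le
      rw [mem_filter] at hc
      exact hmemD c hc.1 (by omega)
  refine ⟨mem_goodSet.2 ⟨?_, by rwa [hg.sup_eq], fun i h1 h2 => ?_⟩, hg.sup_eq⟩
  · rw [mem_fills]
    refine ⟨fun c hc => ⟨(hbd c hc).1, (hbd c hc).2.trans hN⟩, fun c hc => ?_⟩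
    rw [hookFill, if_neg fun h => hc (hDC' h), if_neg hc]
  · obtain ⟨f, hf, hfi⟩ := hsurj i h1 (by omega)
    refine ⟨f, hDC' hf, hfi, fun c hc h => hinj (hmemD c hc (by omega)) hf (h.trans hfi.symm), ?_⟩
    rcases (Nat.lt_or_ge i s) with h | h
    · obtain ⟨w, hw, hwi⟩ := hsurj (i + 1) (by omega) h
      refine ⟨w, hDC' hw, hwi, lt_of_not_ge fun hle => ?_⟩
      rcases hle.lt_or_eq with h3 | h3
      · have := hookFill_lt_of_mem (C := C) (s := s) hf hw h3
        omega
      · rw [hrd h3] at hfi; omega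
    · refine ⟨c0, hc0, by rw [hookFill_of_notMem h0 hc0]; omega,
        lt_of_le_of_ne (hmin f (hDC' hf)) fun h => ?_⟩
      rw [hrd h] at h0
      exact h0 hf

lemma exists_hookFill {N s : ℕ} {c0 : α}
    (hc0 : c0 ∈ C) (hmin : ∀ c ∈ C, rd c0 ≤ rd c) {σ : α → ℕ}
    (hσ : σ ∈ goodSet rd C N s (s + 1)) :
    ∃ D ∈ (C.erase c0).powersetCard s, hookFill rd C s D = σ := by
  rw [mem_goodSet, mem_fills] at hσ
  obtain ⟨⟨hσC, hσ0⟩, hg, hd⟩ := hσ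
  have hsup : C.sup σ = s + 1 := by
    refine le_antisymm hg.le ?_
    rcases Nat.eq_zero_or_pos s with rfl | hs
    · exact (hσC c0 hc0).1.trans (Finset.le_sup hc0)
    · obtain ⟨_, _, _, _, w, hw, hws, _⟩ := hd s hs (by omega)
      rw [← hws]; exact Finset.le_sup hw
  rw [hsup] at hg
  let D := C.filter fun c => σ c < s + 1
  have hD : ∀ c, c ∈ D ↔ c ∈ C ∧ σ c < s + 1 := fun c => mem_filter
  have hinj : Set.InjOn σ D := fun c hc d hd' h => by
    rw [mem_coe, hD] at hc hd'
    exact (hd (σ c) (hσC c hc.1).1 hc.2).unique hc.1 hd'.1 rfl h.symm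
  have himg : D.image σ = Finset.Icc 1 s := by
    ext k
    rw [mem_image, mem_Icc]
    constructor
    · rintro ⟨c, hc, rfl⟩
      rw [hD] at hc
      exact ⟨(hσC c hc.1).1, by omega⟩
    · rintro ⟨h1, h2⟩
      obtain ⟨c, hc, h⟩ := hg.2.1 k h1 (by omega)
      exact ⟨c, (hD c).2 ⟨hc, by omega⟩, h⟩
  have hcard : D.card = s := by
    rw [← card_image_of_injOn hinj, himg, Nat.card_Icc]; omega
  have step : ∀ k c d, c ∈ D → d ∈ C → σ d = σ c + k + 1 → σ d ≤ s + 1 →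
      ∃ w ∈ C, σ w = σ d ∧ rd w < rd c := by
    intro k
    induction k with
    | zero =>
      intro c d hc hdd h h'
      rw [hD] at hc
      obtain ⟨f, hf, hf1, hf2, w, hw, hw1, hw2⟩ := hd (σ c) (hσC c hc.1).1 hc.2
      rw [← hf2 c hc.1 rfl] at hw2
      exact ⟨w, hw, by omega, hw2⟩
    | succ k ih =>
      intro c d hc hdd h h'
      have hc' := (hD c).1 hc
      obtain ⟨f, hf, hf1, hf2, w, hw, hw1, hw2⟩ := hd (σ c) (hσC c hc'.1).1 hc'.2
      rw [← hf2 c hc'.1 rfl] at hw2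
      obtain ⟨w', hw', h1, h2⟩ := ih w d ((hD w).2 ⟨hw, by omega⟩) hdd (by omega) h'
      exact ⟨w', hw', h1, h2.trans hw2⟩
  have hlt : ∀ c ∈ D, ∀ d ∈ D, σ c < σ d → rd d < rd c := by
    intro c hc d hdD h
    have hd' := (hD d).1 hdD
    obtain ⟨w, hw, hw1, hw2⟩ := step (σ d - σ c - 1) c d hc hd'.1 (by omega) hd'.2.le
    rwa [hinj ((hD w).2 ⟨hw, by omega⟩) hdD hw1] at hw2
  have hle : ∀ c ∈ D, ∀ d ∈ D, (rd c ≤ rd d ↔ σ d ≤ σ c) := by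
    intro c hc d hdD
    constructor
    · intro h
      by_contra h'
      exact absurd h (not_le.2 (hlt c hc d hdD (not_le.1 h')))
    · intro h
      rcases h.lt_or_eq with h | h
      · exact (hlt d hdD c hc h).le
      · rw [hinj hdD hc h]
  refine ⟨D, mem_powersetCard.2 ⟨fun c hc => mem_erase.2 ⟨?_, ((hD c).1 hc).1⟩, hcard⟩, ?_⟩
  · rintro rfl
    have hc' := (hD c).1 hc
    obtain ⟨d, hdC, hds⟩ := hg.2.1 (s + 1) (by omega) le_rfl
    obtain ⟨w, hw, _, h⟩ := step (s - σ c) c d hc hdC (by omega) hds.le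
    exact absurd h (not_lt.2 (hmin w hw))
  · funext c
    by_cases hc : c ∈ D
    · rw [hookFill, if_pos hc, filter_congr fun d hdD => hle c hc d hdD]
      have h1 : (D.filter fun d => σ d ≤ σ c).image σ = Finset.Icc 1 (σ c) := by
        ext k
        have hk := congrArg (fun S => k ∈ S) himg
        simp only [mem_image, mem_Icc, eq_iff_iff] at hk
        rw [mem_image, mem_Icc]
        have hcs := ((hD c).1 hc).2
        constructor
        · rintro ⟨d, hdD, rfl⟩
          rw [mem_filter] at hdD
          exact ⟨(hσC d ((hD d).1 hdD.1).1).1, hdD.2⟩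
        · rintro ⟨h1, h2⟩
          obtain ⟨d, hdD, h⟩ := hk.2 ⟨h1, by omega⟩
          exact ⟨d, mem_filter.2 ⟨hdD, by omega⟩, h⟩
      rw [← card_image_of_injOn (hinj.mono (coe_subset.2 (filter_subset _ _))), h1, Nat.card_Icc]
      omega
    · by_cases hcC : c ∈ C
      · rw [hookFill_of_notMem hc hcC]
        have h1 : ¬ σ c < s + 1 := fun h => hc ((hD c).2 ⟨hcC, h⟩)
        have h2 := (hg.1 c hcC).2
        omega
      · rw [hookFill, if_neg hc, if_neg hcC, hσ0 c hcC]

/-- The signed sum over good fillings is a sum over subsets. -/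
lemma sum_goodSet_one {F : Type*} [CommRing F] (hrd : Function.Injective rd) {N s : ℕ}
    (hs : s + 1 ≤ C.card) (hN : s + 1 ≤ N) {c0 : α} (hc0 : c0 ∈ C)
    (hmin : ∀ c ∈ C, rd c0 ≤ rd c) (wt : (α → ℕ) → F)
    (hwt : ∀ σ ∈ fills C N, ∀ τ ∈ fills C N, (∀ u ∈ C, ∀ w ∈ C, rd u < rd w →
      (σ w < σ u ↔ τ w < τ u)) → wt σ = wt τ) :
    ∑ σ ∈ (fills C N).filter (fun σ => GoodFill C s (C.sup σ) σ),
        (-1 : F) ^ (s + 1 + C.sup σ) * wt σ =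
      ∑ D ∈ (C.erase c0).powersetCard s, wt (hookFill rd C s D) := by
  have h1 : (fills C N).filter (fun σ => GoodFill C s (C.sup σ) σ) = goodSet rd C N s 1 := by
    ext σ
    rw [mem_filter, mem_goodSet]
    exact and_congr_right fun _ => ⟨fun h => ⟨h, fun i h1 h2 => by omega⟩, fun h => h.1⟩
  rw [h1, sum_goodSet hrd hs hN wt hwt s le_rfl]
  symm
  refine sum_bij (fun D _ => hookFill rd C s D)
    (fun D hD => (hookFill_mem_goodSet hrd hN hc0 hmin hD).1) (fun D hD E hE h => ?_)
    (fun σ hσ => ?_) (fun D hD => ?_)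
  · have key : ∀ D ∈ (C.erase c0).powersetCard s, ∀ c, c ∈ D ↔ c ∈ C ∧ hookFill rd C s D c ≤ s := by
      intro D hD c
      rw [mem_powersetCard] at hD
      refine ⟨fun h => ⟨mem_of_mem_erase (hD.1 h), hookFill_le hD.2.le h⟩, fun h => ?_⟩
      by_contra hcD
      have := h.2
      rw [hookFill_of_notMem hcD h.1] at this
      omega
    ext c
    rw [key D hD, key E hE, h]
  · obtain ⟨D, hD, h⟩ := exists_hookFill hc0 hmin hσ
    exact ⟨D, hD, h⟩
  · rw [(hookFill_mem_goodSet hrd hN hc0 hmin hD).2]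
    rw [← two_mul, pow_mul, neg_one_sq, one_pow, one_mul]

end HookFill

/-- `d` has support `{1, …, m}` and sum at most `s` below `m`. -/
def IsHookExp (s : ℕ) (d : ℕ →₀ ℕ) : Prop :=
  (∀ k ∈ Finset.Icc 1 (d.support.sup id), d k ≠ 0) ∧
    ∑ j ∈ Finset.range (d.support.sup id), d j ≤ s

/-- Value of the hook functional on the monomial of exponent `d`. -/
def hookVal {F : Type*} [CommRing F] (s : ℕ) (d : ℕ →₀ ℕ) : F :=
  if IsHookExp s d then (-1) ^ (s + 1 + d.support.sup id) else 0

/-- The linear functional which extracts the coefficient of a hook Schur polynomial. -/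
def hookL {F : Type*} [CommRing F] (s : ℕ) : MvPolynomial ℕ F →ₗ[F] F :=
  (MvPolynomial.basisMonomials ℕ F).constr F (hookVal s)

lemma hookL_monomial {F : Type*} [CommRing F] (s : ℕ) (d : ℕ →₀ ℕ) :
    hookL s (MvPolynomial.monomial d (1 : F)) = hookVal s d := by
  have h := (MvPolynomial.basisMonomials ℕ F).constr_basis F (hookVal (F := F) s) d
  rwa [MvPolynomial.coe_basisMonomials] at h

lemma hookL_C_mul {F : Type*} [CommRing F] (s : ℕ) (a : F) (p : MvPolynomial ℕ F) :
    hookL s (MvPolynomial.C a * p) = a * hookL s p := by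
  rw [← MvPolynomial.smul_eq_C_mul, map_smul, smul_eq_mul]

lemma support_cont {α : Type*} (C : Finset α) (σ : α → ℕ) : (cont C σ).support = C.image σ := by
  ext k
  rw [Finsupp.mem_support_iff, cont_apply, mem_image, ← pos_iff_ne_zero, card_pos]
  constructor
  · rintro ⟨c, hc⟩
    exact ⟨c, mem_filter.1 hc⟩
  · rintro ⟨c, hc⟩
    exact ⟨c, mem_filter.2 hc⟩

lemma hookVal_cont {α F : Type*} [DecidableEq α] [CommRing F] {C : Finset α} {N : ℕ} (s : ℕ)
    {σ : α → ℕ} (hσ : σ ∈ fills C N) :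
    hookVal s (cont C σ) =
      if GoodFill C s (C.sup σ) σ then (-1 : F) ^ (s + 1 + C.sup σ) else 0 := by
  have hsup : (cont C σ).support.sup id = C.sup σ := by
    rw [support_cont, Finset.sup_image]; rfl
  rw [hookVal, hsup]
  refine if_congr ?_ rfl rfl
  rw [IsHookExp, hsup]
  rw [mem_fills] at hσ
  have h1 : (∀ k ∈ Finset.Icc 1 (C.sup σ), cont C σ k ≠ 0) ↔
      ∀ k, 1 ≤ k → k ≤ C.sup σ → ∃ c ∈ C, σ c = k := by
    simp only [mem_Icc, and_imp]
    refine forall_congr' fun k => forall_congr' fun _ => forall_congr' fun _ => ?_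
    rw [← Finsupp.mem_support_iff, support_cont, mem_image]
  have h2 : ∑ j ∈ Finset.range (C.sup σ), cont C σ j = (C.filter fun c => σ c < C.sup σ).card := by
    rw [card_eq_sum_card_fiberwise (f := σ) (t := Finset.range (C.sup σ))
      fun c hc => mem_coe.2 (mem_range.2 (mem_filter.1 hc).2)]
    refine sum_congr rfl fun j hj => ?_
    rw [cont_apply, filter_filter]
    refine congrArg card (filter_congr fun c _ => ?_)
    rw [mem_range] at hj
    constructor
    · intro h; exact ⟨h ▸ hj, h⟩
    · exact fun h => h.2
  rw [h1, h2, GoodFill]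
  exact ⟨fun h => ⟨fun c hc => ⟨(hσ.1 c hc).1, Finset.le_sup hc⟩, h⟩, fun h => h.2⟩

theorem hookL_fillPoly {α β F : Type*} [DecidableEq α] [LinearOrder β] [CommRing F] {rd : α → β}
    (hrd : Function.Injective rd) {C : Finset α} {N s : ℕ}
    (hs : s + 1 ≤ C.card) (hN : s + 1 ≤ N) {c0 : α} (hc0 : c0 ∈ C)
    (hmin : ∀ c ∈ C, rd c0 ≤ rd c) (wt : (α → ℕ) → F)
    (hwt : ∀ σ ∈ fills C N, ∀ τ ∈ fills C N, (∀ u ∈ C, ∀ w ∈ C, rd u < rd w →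
      (σ w < σ u ↔ τ w < τ u)) → wt σ = wt τ) :
    hookL s (fillPoly C N wt) = ∑ D ∈ (C.erase c0).powersetCard s, wt (hookFill rd C s D) := by
  rw [← sum_goodSet_one hrd hs hN hc0 hmin wt hwt, fillPoly, map_sum, sum_filter]
  refine sum_congr rfl fun σ hσ => ?_
  rw [hookL_C_mul, prod_X_eq, hookL_monomial, hookVal_cont s hσ]
  split_ifs
  · ring
  · ring

lemma corner_mem {f : ℕ → ℕ} (hf : IsShape f) (hne : (cells f).Nonempty) :
    (1, nRows f) ∈ cells f ∧ ∀ c ∈ cells f, rdKey (1, nRows f) ≤ rdKey c := by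
  obtain ⟨c, hc⟩ := hne
  rw [mem_cells hf] at hc
  have h1 : 1 ≤ nRows f := hc.2.1.trans ((le_nRows hf hc.2.1).2 (by omega))
  refine ⟨(mem_cells hf).2 ⟨le_rfl, h1, ?_⟩, fun d hd => not_lt.1 fun h => ?_⟩
  · have := (le_nRows hf h1).1 le_rfl
    simp only; omega
  · rw [mem_cells hf] at hd
    have h2 := (le_nRows hf hd.2.1).2 (by omega)
    rw [rdKey_lt] at h
    simp only at h
    omega

lemma isSSYT_congr {f : ℕ → ℕ} {σ τ : ℕ × ℕ → ℕ}
    (h : ∀ u ∈ cells f, ∀ w ∈ cells f, rdKey u < rdKey w → (σ w < σ u ↔ τ w < τ u)) :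
    IsSSYT f σ ↔ IsSSYT f τ := by
  refine and_congr ?_ ?_
  · refine forall₄_congr fun c hc c' hc' => forall₂_congr fun h1 h2 => ?_
    rcases h2.lt_or_eq with h3 | h3
    · have := h c hc c' hc' (rdKey_lt.2 (Or.inr ⟨h1, h3⟩))
      omega
    · rw [Prod.ext h3 h1]; simp
  · refine forall₄_congr fun c hc c' hc' => forall₂_congr fun h1 h2 => ?_
    exact h c' hc' c hc (rdKey_lt.2 (Or.inl h2))

lemma isSSYT_hookFill {f : ℕ → ℕ} {s : ℕ} {D : Finset (ℕ × ℕ)} (hD : D.card ≤ s) :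
    IsSSYT f (hookFill rdKey (cells f) s D) ↔
      (∀ c ∈ cells f, ∀ c' ∈ cells f, c.2 = c'.2 → c.1 < c'.1 → c' ∉ D) ∧
        ∀ c ∈ cells f, ∀ c' ∈ cells f, c.1 = c'.1 → c.2 < c'.2 → c ∈ D := by
  refine and_congr ?_ ?_
  · refine forall₄_congr fun c hc c' hc' => ⟨fun h h1 h2 => ?_, fun h h1 h2 => ?_⟩
    · rw [← hookFill_lt_iff hD hc hc' (rdKey_lt.2 (Or.inr ⟨h1, h2⟩)), not_lt]
      exact h h1 h2.le
    · rcases h2.lt_or_eq with h3 | h3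
      · rw [← not_lt, hookFill_lt_iff hD hc hc' (rdKey_lt.2 (Or.inr ⟨h1, h3⟩))]
        exact h h1 h3
      · rw [Prod.ext h3 h1]
  · refine forall₄_congr fun c hc c' hc' => forall₂_congr fun h1 h2 => ?_
    exact hookFill_lt_iff hD hc' hc (rdKey_lt.2 (Or.inl h2))

lemma hookFun_mem {n N s : ℕ} (hn : 1 ≤ n) (hN : n ≤ N) (hs : s ≤ n - 1) :
    hookFun n s ∈ partFinset n N := by
  rw [mem_partFinset]
  refine ⟨by simp [hookFun], fun j hj => ?_, fun i j hi hij => ?_, ?_⟩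
  · rw [hookFun, if_neg (by omega), if_neg (by omega)]
  · simp only [hookFun]; split_ifs <;> omega
  · have h1 : ∑ j ∈ Finset.Icc 1 N, hookFun n s j =
        ∑ j ∈ Finset.Icc 1 N, ((if j = 1 then n - s else 0) +
          if j ∈ Finset.Icc 2 (s + 1) then 1 else 0) := by
      refine sum_congr rfl fun j _ => ?_
      simp only [hookFun, mem_Icc]
      split_ifs <;> omega
    rw [h1, sum_add_distrib, sum_ite_eq', if_pos (mem_Icc.2 (by omega)), sum_ite_mem,
      inter_eq_right.2 (Icc_subset_Icc (by omega) (by omega)), sum_const, Nat.card_Icc]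
    simp only [smul_eq_mul]; omega

lemma hookL_schurK {n N s : ℕ} (hn : 1 ≤ n) (hN : n ≤ N) (hs : s ≤ n - 1) {f : ℕ → ℕ}
    (hf : f ∈ partFinset n N) :
    hookL s (schurK f N) = if f = hookFun n s then 1 else 0 := by
  have hsh := isShape_of_mem hf
  have hcard := card_cells hf
  obtain ⟨hc0, hmin⟩ := corner_mem hsh (card_pos.1 (by omega))
  rw [schurK_eq, hookL_fillPoly rdKey_injective (by omega) (by omega) hc0 hmin]
  swap
  · intro σ _ τ _ h
    rw [isSSYT_congr h]
  have huniq : ∀ D ∈ ((cells f).erase (1, nRows f)).powersetCard s,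
      IsSSYT f (hookFill rdKey (cells f) s D) →
        D = (Finset.Icc 1 s).image (fun j => (1, j)) ∧ f = hookFun n s := by
    intro D hD h
    rw [mem_powersetCard] at hD
    obtain ⟨hDC, hDs⟩ := hD
    rw [isSSYT_hookFill hDs.le] at h
    obtain ⟨hr, hc⟩ := h
    have hmem := @mem_cells f hsh
    have hD1 : D = (Finset.Icc 1 (nRows f - 1)).image (fun j => (1, j)) := by
      ext ⟨x, y⟩
      simp only [mem_image, mem_Icc, Prod.mk.injEq]
      constructor
      · intro h
        have h1 := mem_erase.1 (hDC h)
        have h2 := hmem.1 h1.2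
        simp only at h2
        have hx : x = 1 := by
          by_contra hx
          exact hr (1, y) (hmem.2 ⟨le_rfl, h2.2.1, by simp only; omega⟩) (x, y) h1.2 rfl
            (by simp only; omega) h
        have h3 := (le_nRows hsh h2.2.1).2 (by omega)
        have h4 : y ≠ nRows f := by rintro rfl; exact h1.1 (by rw [hx])
        exact ⟨y, ⟨h2.2.1, by omega⟩, hx.symm, rfl⟩
      · rintro ⟨j, ⟨h1, h2⟩, rfl, rfl⟩
        have h3 := (le_nRows hsh h1).1 (by omega)
        exact hc (1, j) (hmem.2 ⟨le_rfl, h1, by simp only; omega⟩) _ hc0 rfl (by simp only; omega)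
    have hrows : nRows f - 1 = s := by
      rw [← hDs, hD1, card_image_of_injective _ (fun a b h => (Prod.mk.inj h).2), Nat.card_Icc]
      omega
    have hpos := (hmem.1 hc0).2.1
    simp only at hpos
    refine ⟨by rw [hD1, hrows], ?_⟩
    have hf2 : f 2 ≤ 1 := by
      by_contra h2
      have h3 := hsh.1 1 2 le_rfl (by omega)
      have h4 := hc (2, 1) (hmem.2 ⟨by simp, le_rfl, by simp only; omega⟩) (2, 2)
        (hmem.2 ⟨by simp, by simp, by simp only; omega⟩) rfl (by simp)
      rw [hD1] at h4
      simp at h4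
    have hne : ∀ j, j ≠ 1 → f j = hookFun n s j := by
      intro j hj
      have hh : hookFun n s j = if 2 ≤ j ∧ j ≤ s + 1 then 1 else 0 := by rw [hookFun, if_neg hj]
      rw [hh]
      rcases Nat.eq_zero_or_pos j with rfl | hj0
      · simp [(mem_partFinset.1 hf).1]
      · have h1 := hsh.1 2 j (by omega) (by omega)
        have h2 := le_nRows hsh hj0
        split_ifs with h3
        · have := h2.1 (by omega); omega
        · by_contra h4
          have := h2.2 h4
          omega
    have hsum := (mem_partFinset.1 hf).2.2.2.trans
        (mem_partFinset.1 (hookFun_mem hn hN hs)).2.2.2.symm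
    have h1N : 1 ∈ Finset.Icc 1 N := mem_Icc.2 (by omega)
    rw [← add_sum_erase _ _ h1N, ← add_sum_erase _ _ h1N,
      sum_congr rfl fun j hj => hne j (ne_of_mem_erase hj)] at hsum
    funext j
    by_cases hj : j = 1
    · rw [hj]; exact Nat.add_right_cancel hsum
    · exact hne j hj
  by_cases hfh : f = hookFun n s
  · rw [if_pos hfh]
    have hD0 : ((Finset.Icc 1 s).image fun j => (1, j)) ∈
        ((cells f).erase (1, nRows f)).powersetCard s ∧
        IsSSYT f (hookFill rdKey (cells f) s ((Finset.Icc 1 s).image fun j => (1, j))) := by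
      have hval : ∀ j, f j = if j = 1 then n - s else if 2 ≤ j ∧ j ≤ s + 1 then 1 else 0 :=
        fun j => by rw [hfh]; rfl
      have hcardD : ((Finset.Icc 1 s).image fun j : ℕ => (1, j)).card = s := by
        rw [card_image_of_injective _ (fun a b h => (Prod.mk.inj h).2), Nat.card_Icc]; omega
      have hrow : s + 1 ≤ nRows f := by
        rw [le_nRows hsh (by omega), hval]; split_ifs <;> omega
      have hmem := @mem_cells f hsh
      refine ⟨mem_powersetCard.2 ⟨fun c hc => ?_, hcardD⟩, ?_⟩
      · obtain ⟨j, hj, rfl⟩ := mem_image.1 hc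
        rw [mem_Icc] at hj
        refine mem_erase.2 ⟨fun h => ?_, hmem.2 ⟨le_rfl, hj.1, ?_⟩⟩
        · have := (Prod.mk.inj h).2; omega
        · simp only [hval]; split_ifs <;> omega
      · rw [isSSYT_hookFill hcardD.le]
        refine ⟨?_, ?_⟩
        · rintro ⟨a, b⟩ h1 ⟨c, d⟩ h2 h3 h4 h5
          obtain ⟨j, hj, h⟩ := mem_image.1 h5
          rw [hmem] at h1 
          obtain ⟨rfl, rfl⟩ := Prod.mk.inj h
          simp only at h1 h4
          omega
        · rintro ⟨a, b⟩ h1 ⟨c, d⟩ h2 h3 h4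
          rw [hmem] at h1 h2
          simp only at h1 h2 h3 h4
          rw [hval] at h2
          refine mem_image.2 ⟨b, mem_Icc.2 ⟨h1.2.1, ?_⟩, ?_⟩
          · split_ifs at h2 <;> omega
          · have : a = 1 := by split_ifs at h2 <;> omega
            rw [this]
    rw [sum_eq_single_of_mem _ hD0.1 fun D hD hne => if_neg fun h => hne (huniq D hD h).1,
      if_pos hD0.2]
  · rw [if_neg hfh]
    exact sum_eq_zero fun D hD => if_neg fun h => hfh (huniq D hD h).2

/-! ### Cumulants -/

lemma mem_setPartitions {α : Type*} {H : Finset α} {π : Finset (Finset α)} :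
    π ∈ setPartitions H ↔ IsSetPartition π H := by
  rw [setPartitions, mem_filter, and_iff_right_iff_imp]
  exact fun h => mem_powerset.2 fun B hB => mem_powerset.2 (h.1 B hB)

lemma IsSetPartition.eq_of_mem {α : Type*} {H : Finset α} {π : Finset (Finset α)}
    (h : IsSetPartition π H) {B C : Finset α} (hB : B ∈ π) (hC : C ∈ π) {a : α} (ha : a ∈ B)
    (ha' : a ∈ C) : B = C := by
  by_contra hne
  exact disjoint_left.1 (h.2.2.1 B hB C hC hne) ha ha'

lemma IsSetPartition.erase {α : Type*} [DecidableEq α] [DecidableEq (Finset α)] {H : Finset α}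
    {π : Finset (Finset α)} (h : IsSetPartition π H) {C : Finset α} (hC : C ∈ π) :
    IsSetPartition (π.erase C) (H \ C) := by
  refine ⟨fun B hB a ha => ?_, fun B hB => h.2.1 B (mem_of_mem_erase hB),
    fun B hB D hD => h.2.2.1 B (mem_of_mem_erase hB) D (mem_of_mem_erase hD), fun a ha => ?_⟩
  · rw [mem_erase] at hB
    exact mem_sdiff.2 ⟨h.1 B hB.2 ha, fun h' => hB.1 (h.eq_of_mem hB.2 hC ha h')⟩
  · rw [mem_sdiff] at ha
    obtain ⟨B, hB, haB⟩ := h.2.2.2 a ha.1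
    exact ⟨B, mem_erase.2 ⟨fun h' => ha.2 (h' ▸ haB), hB⟩, haB⟩

lemma IsSetPartition.insert {α : Type*} [DecidableEq α] [DecidableEq (Finset α)] {H B : Finset α}
    {π : Finset (Finset α)} (h : IsSetPartition π B) (hB : B ⊆ H) (hne : (H \ B).Nonempty) :
    IsSetPartition (insert (H \ B) π) H := by
  refine ⟨fun C hC => ?_, fun C hC => ?_, fun C hC D hD hCD => ?_, fun a ha => ?_⟩
  · rcases mem_insert.1 hC with rfl | hC
    exacts [sdiff_subset, (h.1 C hC).trans hB]
  · rcases mem_insert.1 hC with rfl | hC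
    exacts [hne, h.2.1 C hC]
  · rcases mem_insert.1 hC with rfl | hC <;> rcases mem_insert.1 hD with rfl | hD
    · exact absurd rfl hCD
    · exact disjoint_of_subset_right (h.1 D hD) sdiff_disjoint
    · exact disjoint_of_subset_left (h.1 C hC) disjoint_sdiff
    · exact h.2.2.1 C hC D hD hCD
  · by_cases haB : a ∈ B
    · obtain ⟨C, hC, h'⟩ := h.2.2.2 a haB
      exact ⟨C, mem_insert_of_mem hC, h'⟩
    · exact ⟨_, mem_insert_self _ _, mem_sdiff.2 ⟨ha, haB⟩⟩

lemma IsSetPartition.sdiff_notMem {α : Type*} [DecidableEq α] {H B : Finset α}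
    {π : Finset (Finset α)} (h : IsSetPartition π B) (hne : (H \ B).Nonempty) : H \ B ∉ π := by
  intro hmem
  obtain ⟨a, ha⟩ := hne
  exact (mem_sdiff.1 ha).2 (h.1 _ hmem ha)

/-- Expansion of a moment along the block of `v`. -/
lemma moment_eq_sum_cumulant {A ι : Type*} [CommRing A] [DecidableEq ι] (u : Finset ι → A)
    (h0 : u ∅ = 1) {H : Finset ι} {v : ι} (hv : v ∈ H) :
    u H = ∑ B ∈ H.powerset.filter (fun B => v ∈ B), jointCumulant u B * u (H \ B) := by
  have hH : H ∈ H.powerset.filter (fun B => v ∈ B) := mem_filter.2 ⟨mem_powerset_self H, hv⟩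
  rw [← add_sum_erase _ _ hH, sdiff_self, bot_eq_empty, h0, mul_one]
  have key : ∑ B ∈ (H.powerset.filter (fun B => v ∈ B)).erase H, jointCumulant u B * u (H \ B) =
      ∑ ρ ∈ setPartitions H, ∑ C ∈ ρ.filter (fun C => v ∉ C),
        (-1 : A) ^ (ρ.card - 2) * ((ρ.card - 2).factorial : A) * ∏ D ∈ ρ, u D := by
    simp only [jointCumulant, sum_mul]
    rw [sum_sigma', sum_sigma']
    refine sum_bij' (fun x _ => ⟨insert (H \ x.1) x.2, H \ x.1⟩)
      (fun y _ => ⟨H \ y.2, y.1.erase y.2⟩) ?_ ?_ ?_ ?_ ?_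
    · rintro ⟨B, π⟩ hx
      rw [mem_sigma, mem_erase, mem_filter, mem_powerset, mem_setPartitions] at hx
      obtain ⟨⟨hne, hBH, hvB⟩, hπ⟩ := hx
      have hne' : (H \ B).Nonempty := sdiff_nonempty.2 fun h => hne (hBH.antisymm h)
      rw [mem_sigma, mem_setPartitions, mem_filter]
      exact ⟨hπ.insert hBH hne', mem_insert_self _ _, fun h => (mem_sdiff.1 h).2 hvB⟩
    · rintro ⟨ρ, C⟩ hx
      rw [mem_sigma, mem_setPartitions, mem_filter] at hx
      obtain ⟨hρ, hC, hvC⟩ := hx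
      rw [mem_sigma, mem_erase, mem_filter, mem_powerset, mem_setPartitions]
      refine ⟨⟨fun h => ?_, sdiff_subset, mem_sdiff.2 ⟨hv, hvC⟩⟩, hρ.erase hC⟩
      obtain ⟨a, ha⟩ := hρ.2.1 C hC
      have ha' : a ∈ H := hρ.1 C hC ha
      simp only at h
      rw [← h] at ha'
      exact (mem_sdiff.1 ha').2 ha
    · rintro ⟨B, π⟩ hx
      rw [mem_sigma, mem_erase, mem_filter, mem_powerset, mem_setPartitions] at hx
      obtain ⟨⟨hne, hBH, hvB⟩, hπ⟩ := hx
      have hne' : (H \ B).Nonempty := sdiff_nonempty.2 fun h => hne (hBH.antisymm h)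
      simp only
      rw [erase_insert (hπ.sdiff_notMem hne'), Finset.sdiff_sdiff_eq_self hBH]
    · rintro ⟨ρ, C⟩ hx
      rw [mem_sigma, mem_setPartitions, mem_filter] at hx
      obtain ⟨hρ, hC, hvC⟩ := hx
      simp only at hρ hC
      simp only
      rw [Finset.sdiff_sdiff_eq_self (hρ.1 C hC), insert_erase hC]
    · rintro ⟨B, π⟩ hx
      rw [mem_sigma, mem_erase, mem_filter, mem_powerset, mem_setPartitions] at hx
      obtain ⟨⟨hne, hBH, hvB⟩, hπ⟩ := hx
      have hne' : (H \ B).Nonempty := sdiff_nonempty.2 fun h => hne (hBH.antisymm h)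
      simp only
      rw [prod_insert (hπ.sdiff_notMem hne'), card_insert_of_notMem (hπ.sdiff_notMem hne'),
        Nat.add_sub_add_right π.card 1 1]
      ring
  have hcount : ∀ ρ ∈ setPartitions H, (ρ.filter fun C => v ∉ C).card = ρ.card - 1 := by
    intro ρ hρ
    rw [mem_setPartitions] at hρ
    obtain ⟨B, hB, hvB⟩ := hρ.2.2.2 v hv
    have : (ρ.filter fun C => v ∉ C) = ρ.erase B := by
      ext C
      rw [mem_filter, mem_erase, and_comm]
      refine and_congr_left fun hC => ⟨fun h h' => h (h' ▸ hvB), fun h h' => h ?_⟩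
      exact hρ.eq_of_mem hC hB h' hvB
    rw [this, card_erase_of_mem hB]
  have htop : {H} ∈ setPartitions H := by
    rw [mem_setPartitions]
    refine ⟨by simp, by simpa using ⟨v, hv⟩, ?_, by simp⟩
    intro B hB C hC hne
    rw [mem_singleton] at hB hC
    exact absurd (hB.trans hC.symm) hne
  have hone : ∀ ρ ∈ setPartitions H, ρ ≠ {H} → 2 ≤ ρ.card := by
    intro ρ hρ hne
    rw [mem_setPartitions] at hρ
    by_contra hlt
    obtain ⟨B, hB, hvB⟩ := hρ.2.2.2 v hv
    have h1 := card_pos.2 ⟨B, hB⟩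
    obtain ⟨C, rfl⟩ := card_eq_one.1 (show ρ.card = 1 by omega)
    apply hne
    congr 1
    refine (hρ.1 C (mem_singleton_self C)).antisymm fun a ha => ?_
    obtain ⟨D, hD, haD⟩ := hρ.2.2.2 a ha
    rwa [← mem_singleton.1 hD]
  rw [key, jointCumulant, ← sum_add_distrib, sum_eq_single_of_mem _ htop]
  · rw [sum_const, hcount _ htop]
    simp
  · intro ρ hρ hne
    have h2 := hone ρ hρ hne
    rw [sum_const, hcount ρ hρ]
    obtain ⟨k, hk⟩ : ∃ k, ρ.card = k + 2 := ⟨ρ.card - 2, by omega⟩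
    rw [hk, Nat.add_sub_cancel, show k + 2 - 1 = k + 1 by omega, Nat.factorial_succ, pow_succ,
      nsmul_eq_mul]
    push_cast
    ring

lemma jointCumulant_singleton {A ι : Type*} [CommRing A] [DecidableEq ι] (u : Finset ι → A)
    (h0 : u ∅ = 1) (v : ι) : jointCumulant u {v} = u {v} := by
  rw [moment_eq_sum_cumulant u h0 (mem_singleton_self v)]
  have : ({v} : Finset ι).powerset.filter (fun B => v ∈ B) = {{v}} := by
    ext B
    rw [mem_filter, mem_powerset, mem_singleton, subset_singleton_iff]
    constructor
    · rintro ⟨rfl | rfl, h⟩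
      exacts [absurd h (notMem_empty v), rfl]
    · rintro rfl
      exact ⟨Or.inr rfl, mem_singleton_self v⟩
  rw [this, sum_singleton, sdiff_self, bot_eq_empty, h0, mul_one]

lemma sum_subset_reindex {A ι : Type*} [AddCommMonoid A] [DecidableEq ι] (S : Finset ι) (m : ι)
    (g : Finset ι → Finset ι → A) :
    ∑ B ∈ S.powerset.filter (fun B => m ∈ B), ∑ C ∈ (S \ B).powerset, g B C =
      ∑ T ∈ S.powerset.filter (fun T => m ∈ T),
        ∑ B ∈ T.powerset.filter (fun B => m ∈ B), g B (T \ B) := by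
  rw [sum_sigma', sum_sigma']
  refine sum_bij' (fun x _ => ⟨x.1 ∪ x.2, x.1⟩) (fun y _ => ⟨y.2, y.1 \ y.2⟩) ?_ ?_ ?_ ?_ ?_
  · rintro ⟨B, C⟩ hx
    simp only [mem_sigma, mem_filter, mem_powerset] at hx ⊢
    exact ⟨⟨union_subset hx.1.1 (hx.2.trans sdiff_subset), mem_union_left _ hx.1.2⟩,
      subset_union_left, hx.1.2⟩
  · rintro ⟨T, B⟩ hx
    simp only [mem_sigma, mem_filter, mem_powerset] at hx ⊢
    exact ⟨⟨hx.2.1.trans hx.1.1, hx.2.2⟩, sdiff_subset_sdiff hx.1.1 le_rfl⟩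
  · rintro ⟨B, C⟩ hx
    simp only [mem_sigma, mem_filter, mem_powerset] at hx ⊢
    rw [union_sdiff_cancel_left (disjoint_of_subset_right hx.2 disjoint_sdiff)]
  · rintro ⟨T, B⟩ hx
    simp only [mem_sigma, mem_filter, mem_powerset] at hx ⊢
    rw [union_sdiff_of_subset hx.2.1]
  · rintro ⟨B, C⟩ hx
    simp only [mem_sigma, mem_filter, mem_powerset] at hx ⊢
    rw [union_sdiff_cancel_left (disjoint_of_subset_right hx.2 disjoint_sdiff)]

/-- The recursion for cumulants of a family of moments with multiplicative increments at `v`. -/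
lemma cumulant_insert {A ι : Type*} [CommRing A] [DecidableEq ι] (u : Finset ι → A)
    (h0 : u ∅ = 1) {v : ι} (L : A) (χ : Finset ι → A)
    (hχ : ∀ B C, Disjoint B C → χ (B ∪ C) = χ B * χ C)
    (hu : ∀ B, v ∉ B → u (insert v B) = L * χ B * u B) {m : ι} (S : Finset ι) (hv : v ∉ S)
    (hm : m ∈ S) :
    jointCumulant u (insert v S) =
      ∑ B ∈ S.powerset.filter (fun B => m ∈ B),
        (χ B - 1) * jointCumulant u B * jointCumulant u (insert v (S \ B)) := by
  have hE : ∀ S : Finset ι, v ∉ S → L * χ S * u S =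
      ∑ C ∈ S.powerset, jointCumulant u (insert v C) * u (S \ C) := by
    intro S hv
    rw [← hu S hv, moment_eq_sum_cumulant u h0 (mem_insert_self v S)]
    symm
    refine sum_bij' (fun C _ => insert v C) (fun B _ => B.erase v) ?_ ?_ ?_ ?_ ?_
    · intro C hC
      exact mem_filter.2 ⟨mem_powerset.2 (insert_subset_insert _ (mem_powerset.1 hC)),
        mem_insert_self _ _⟩
    · intro B hB
      rw [mem_filter, mem_powerset] at hB
      rw [mem_powerset, ← erase_insert hv]
      exact erase_subset_erase _ hB.1
    · intro C hC
      exact erase_insert fun h => hv (mem_powerset.1 hC h)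
    · intro B hB
      exact insert_erase (mem_filter.1 hB).2
    · intro C hC
      rw [insert_sdiff_insert, sdiff_insert_of_notMem hv]
  have hmem : ∀ S : Finset ι, S ∈ S.powerset.filter (fun T => m ∈ T) ↔ m ∈ S := by
    intro S; simp
  induction hS : S.card using Nat.strong_induction_on generalizing S with
  | _ k ih =>
  let R : Finset ι → A := fun T => ∑ B ∈ T.powerset.filter (fun B => m ∈ B),
    (χ B - 1) * jointCumulant u B * jointCumulant u (insert v (T \ B))
  change _ = R S
  have h1 : L * χ S * u S = ∑ B ∈ S.powerset.filter (fun B => m ∈ B), ∑ C ∈ (S \ B).powerset,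
      χ B * jointCumulant u B * jointCumulant u (insert v C) * u ((S \ B) \ C) := by
    rw [moment_eq_sum_cumulant u h0 hm, mul_sum]
    refine sum_congr rfl fun B hB => ?_
    rw [mem_filter, mem_powerset] at hB
    have h2 := hE (S \ B) fun h => hv (mem_sdiff.1 h).1
    have h3 := hχ B (S \ B) disjoint_sdiff
    rw [union_sdiff_of_subset hB.1] at h3
    rw [h3]
    calc _ = χ B * jointCumulant u B * (L * χ (S \ B) * u (S \ B)) := by ring
      _ = _ := by
        rw [h2, mul_sum]
        exact sum_congr rfl fun C _ => by ring
  have h2 : L * χ S * u S =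
      ∑ T ∈ S.powerset.filter (fun T => m ∈ T), jointCumulant u (insert v T) * u (S \ T) +
        ∑ B ∈ S.powerset.filter (fun B => m ∈ B), ∑ C ∈ (S \ B).powerset,
          jointCumulant u B * jointCumulant u (insert v C) * u ((S \ B) \ C) := by
    rw [hE S hv, ← sum_filter_add_sum_filter_not S.powerset (fun T => m ∈ T)]
    congr 1
    have h3 : ∀ C ∈ S.powerset.filter (fun C => m ∉ C),
        jointCumulant u (insert v C) * u (S \ C) =
          ∑ B ∈ (S \ C).powerset.filter (fun B => m ∈ B),
            jointCumulant u B * jointCumulant u (insert v C) * u ((S \ B) \ C) := by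
      intro C hC
      rw [mem_filter] at hC
      rw [moment_eq_sum_cumulant u h0 (mem_sdiff.2 ⟨hm, hC.2⟩), mul_sum]
      refine sum_congr rfl fun B _ => ?_
      rw [sdiff_right_comm]
      ring
    rw [sum_congr rfl h3]
    refine sum_comm' fun C B => ?_
    simp only [mem_filter, mem_powerset, subset_sdiff]
    constructor
    · rintro ⟨⟨h1, h2⟩, ⟨h3, h4⟩, h5⟩
      exact ⟨⟨h1, h4.symm⟩, h3, h5⟩
    · rintro ⟨⟨h1, h2⟩, h3, h5⟩
      exact ⟨⟨h1, fun h => disjoint_left.1 h2 h h5⟩, ⟨h3, h2.symm⟩, h5⟩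
  rw [h1, ← sub_eq_iff_eq_add, ← sum_sub_distrib] at h2
  simp only [← sum_sub_distrib] at h2
  rw [sum_subset_reindex S m fun B C =>
    χ B * jointCumulant u B * jointCumulant u (insert v C) * u ((S \ B) \ C) -
      jointCumulant u B * jointCumulant u (insert v C) * u ((S \ B) \ C)] at h2
  have h3 : ∀ T ∈ S.powerset.filter (fun T => m ∈ T),
      ∑ B ∈ T.powerset.filter (fun B => m ∈ B),
        (χ B * jointCumulant u B * jointCumulant u (insert v (T \ B)) * u ((S \ B) \ (T \ B)) -
          jointCumulant u B * jointCumulant u (insert v (T \ B)) * u ((S \ B) \ (T \ B))) =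
      R T * u (S \ T) := by
    intro T _
    simp only [R, sum_mul]
    refine sum_congr rfl fun B hB => ?_
    rw [mem_filter, mem_powerset] at hB
    have : (S \ B) \ (T \ B) = S \ T := by
      rw [sdiff_sdiff_left, sup_eq_union, union_sdiff_of_subset hB.1]
    rw [this]
    ring
  rw [sum_congr rfl h3, ← add_sum_erase _ _ ((hmem S).2 hm),
    ← add_sum_erase _ (fun T => jointCumulant u (insert v T) * u (S \ T)) ((hmem S).2 hm)] at h2
  have h4 : ∀ T ∈ (S.powerset.filter (fun T => m ∈ T)).erase S,
      jointCumulant u (insert v T) * u (S \ T) = R T * u (S \ T) := by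
    intro T hT
    rw [mem_erase, mem_filter, mem_powerset] at hT
    rw [ih T.card (hS ▸ card_lt_card (hT.2.1.ssubset_of_ne hT.1)) T (fun h => hv (hT.2.1 h))
      hT.2.2 rfl]
  rw [sum_congr rfl h4, sdiff_self, bot_eq_empty, h0, mul_one, mul_one] at h2
  exact (add_right_cancel h2).symm

/-! ### Trees -/

section Trees

variable {V : Type*}

/-- `i` is an iterated image of `j` under the parent map `p`. -/
def Reach (p : V → V) (i j : V) : Prop := ∃ k, p^[k] j = i

lemma Reach.refl (p : V → V) (i : V) : Reach p i i := ⟨0, rfl⟩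

lemma Reach.step {p : V → V} {i j : V} (h : Reach p i (p j)) : Reach p i j := by
  obtain ⟨k, hk⟩ := h
  exact ⟨k + 1, hk⟩

lemma Reach.tail {p : V → V} {i j : V} (h : Reach p i j) (hne : j ≠ i) : Reach p i (p j) := by
  obtain ⟨k, hk⟩ := h
  cases k with
  | zero => exact absurd hk hne
  | succ k => exact ⟨k, hk⟩

lemma Reach.trans {p : V → V} {i j k : V} (h : Reach p i j) (h' : Reach p j k) : Reach p i k := by
  obtain ⟨a, rfl⟩ := h
  obtain ⟨b, rfl⟩ := h'
  exact ⟨a + b, Function.iterate_add_apply p a b k⟩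

lemma Reach.eq_of_fixed {p : V → V} {i j : V} (h : Reach p i j) (hj : p j = j) : i = j := by
  obtain ⟨k, rfl⟩ := h
  exact Function.iterate_fixed hj k

lemma Reach.mem_of_closed {p : V → V} {A : Set V} (hA : ∀ w ∈ A, p w ∈ A) {i j : V}
    (h : Reach p i j) (hj : j ∈ A) : i ∈ A := by
  obtain ⟨k, rfl⟩ := h
  induction k generalizing j with
  | zero => exact hj
  | succ k ih => exact ih (hA j hj)

lemma Reach.congr {f g : V → V} {i j : V} (h : Reach f i j)
    (hfg : ∀ w, Reach f w j → Reach f i w → w ≠ i → g w = f w) : Reach g i j := by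
  obtain ⟨k, hk⟩ := h
  induction k generalizing j with
  | zero => exact ⟨0, hk⟩
  | succ k ih =>
    by_cases hj : j = i
    · exact hj ▸ Reach.refl g j
    · apply Reach.step
      rw [hfg j (Reach.refl f j) ⟨k + 1, hk⟩ hj]
      exact ih (fun w h => hfg w h.step) hk

lemma Reach.total {p : V → V} {i j w : V} (h : Reach p i w) (h' : Reach p j w) :
    Reach p i j ∨ Reach p j i := by
  obtain ⟨a, rfl⟩ := h
  obtain ⟨b, rfl⟩ := h'
  rcases le_total a b with hab | hab
  · right; exact ⟨b - a, by rw [← Function.iterate_add_apply, Nat.sub_add_cancel hab]⟩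
  · left; exact ⟨a - b, by rw [← Function.iterate_add_apply, Nat.sub_add_cancel hab]⟩

/-- Glue a tree on `B` with root `b` to a tree with root `v`. -/
def glueMap [DecidableEq V] (v b : V) (B : Finset V) (p1 p2 : V → V) : V → V := fun w =>
  if w = b then v else if w ∈ B then p1 w else p2 w

lemma glueMap_root [DecidableEq V] {v b : V} {B : Finset V} {p1 p2 : V → V} :
    glueMap v b B p1 p2 b = v := by rw [glueMap, if_pos rfl]

lemma glueMap_of_mem [DecidableEq V] {v b : V} {B : Finset V} {p1 p2 : V → V} {w : V}
    (hw : w ∈ B.erase b) : glueMap v b B p1 p2 w = p1 w := by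
  rw [mem_erase] at hw
  rw [glueMap, if_neg hw.1, if_pos hw.2]

variable [Fintype V] [LinearOrder V]

/-- Rooted trees on `S ∪ {v}` with root `v`, as parent maps. -/
def treeMaps (v : V) (S : Finset V) : Finset (V → V) :=
  univ.filter fun p => (∀ w, w ∉ S → p w = w) ∧ ∀ w ∈ S, Reach p v w

lemma mem_treeMaps {v : V} {S : Finset V} {p : V → V} :
    p ∈ treeMaps v S ↔ (∀ w, w ∉ S → p w = w) ∧ ∀ w ∈ S, Reach p v w := by
  rw [treeMaps, mem_filter, and_iff_right (mem_univ _)]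

lemma parent_mem {v : V} {S : Finset V} {p : V → V} (hp : p ∈ treeMaps v S) (hv : v ∉ S) {w : V}
    (hw : w ∈ S) : p w ∈ S ∨ p w = v := by
  rw [mem_treeMaps] at hp
  by_cases h : p w ∈ S
  · exact Or.inl h
  · have hne : w ≠ v := fun h => hv (h ▸ hw)
    exact Or.inr (((hp.2 w hw).tail hne).eq_of_fixed (hp.1 _ h)).symm

/-- The inversion statistic of a tree. -/
def treeStat (e : V → V → ℕ) (S : Finset V) (p : V → V) : ℕ :=
  ∑ i ∈ S, ∑ j ∈ S, if j < i ∧ Reach p i j then e (p i) j else 0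

/-- The weight of a tree. -/
def treeWt {A : Type*} [CommRing A] (e : V → V → ℕ) (Q : A) (S : Finset V) (p : V → V) : A :=
  Q ^ treeStat e S p * ∏ w ∈ S, nq Q (e w (p w))

/-- The weighted sum over trees. -/
def treeSum {A : Type*} [CommRing A] (e : V → V → ℕ) (Q : A) (v : V) (S : Finset V) : A :=
  ∑ p ∈ treeMaps v S, treeWt e Q S p

/-- A block `B` with root `b` that can be glued to a tree with root `v`. -/
structure GlueData (v b : V) (S B : Finset V) (p1 p2 : V → V) : Prop where
  hv : v ∉ S
  hB : B ⊆ S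
  hb : b ∈ B
  h1 : p1 ∈ treeMaps b (B.erase b)
  h2 : p2 ∈ treeMaps v (S \ B)

namespace GlueData

variable {v b : V} {S B : Finset V} {p1 p2 : V → V} (h : GlueData v b S B p1 p2)
include h

lemma glue_of_notMem {w : V} (hw : w ∉ B) : glueMap v b B p1 p2 w = p2 w := by
  rw [glueMap, if_neg (show w ≠ b from fun h' => hw (by rw [h']; exact h.hb)), if_neg hw]

lemma notMem_root : v ∉ B := fun h' => h.hv (h.hB h')

lemma glue_v : glueMap v b B p1 p2 v = v := by
  rw [h.glue_of_notMem h.notMem_root]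
  exact (mem_treeMaps.1 h.h2).1 v fun h' => h.hv (mem_sdiff.1 h').1

lemma closed_compl : ∀ w ∈ {w | w ∉ B}, glueMap v b B p1 p2 w ∈ {w | w ∉ B} := by
  intro w hw
  change _ ∉ B
  change w ∉ B at hw
  rw [h.glue_of_notMem hw]
  by_cases hS : w ∈ S
  · rcases parent_mem h.h2 (fun h' => h.hv (mem_sdiff.1 h').1) (mem_sdiff.2 ⟨hS, hw⟩) with h3 | h3
    · exact (mem_sdiff.1 h3).2
    · rw [h3]; exact h.notMem_root
  · rw [(mem_treeMaps.1 h.h2).1 w fun h' => hS (mem_sdiff.1 h').1]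
    exact hw

lemma parent_mem_block {w : V} (hw : w ∈ B) : glueMap v b B p1 p2 w ∈ B ∨
    glueMap v b B p1 p2 w = v := by
  by_cases hwb : w = b
  · right; rw [hwb]; exact glueMap_root
  · left
    have hw' := mem_erase.2 ⟨hwb, hw⟩
    rw [glueMap_of_mem hw']
    rcases parent_mem h.h1 (notMem_erase b B) hw' with h3 | h3
    · exact mem_of_mem_erase h3
    · rw [h3]; exact h.hb

lemma closed_block : ∀ w ∈ {w | w ∈ B ∨ w = v}, glueMap v b B p1 p2 w ∈ {w | w ∈ B ∨ w = v} := by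
  rintro w (hw | rfl)
  · exact h.parent_mem_block hw
  · exact Or.inr h.glue_v

lemma reach_block {w : V} (hw : w ∈ B) : Reach (glueMap v b B p1 p2) b w := by
  have h1 := mem_treeMaps.1 h.h1
  by_cases hwb : w = b
  · rw [hwb]; exact Reach.refl _ _
  · refine (h1.2 w (mem_erase.2 ⟨hwb, hw⟩)).congr fun w' _ h4 h5 => ?_
    by_cases hw' : w' ∈ B.erase b
    · exact glueMap_of_mem hw'
    · exact absurd (h4.eq_of_fixed (h1.1 w' hw')).symm h5

lemma reach_iff_block {i j : V} (hi : i ∈ B.erase b) :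
    Reach (glueMap v b B p1 p2) i j ↔ Reach p1 i j := by
  have h1 := mem_treeMaps.1 h.h1
  have hi' := mem_erase.1 hi
  constructor
  · refine fun h3 => h3.congr fun w _ h4 h5 => ?_
    have hwB : w ∈ B := by
      by_contra hw
      exact Reach.mem_of_closed h.closed_compl h4 hw hi'.2
    have hwb : w ≠ b := by
      rintro rfl
      have := h4.tail h5
      rw [glueMap_root] at this
      have := this.eq_of_fixed h.glue_v
      exact h.notMem_root (this ▸ hi'.2)
    exact (glueMap_of_mem (mem_erase.2 ⟨hwb, hwB⟩)).symm
  · refine fun h3 => h3.congr fun w _ h4 h5 => ?_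
    by_cases hw : w ∈ B.erase b
    · exact glueMap_of_mem hw
    · exact absurd (h4.eq_of_fixed (h1.1 w hw)).symm h5

lemma reach_iff_compl {i j : V} (hi : i ∈ S \ B) :
    Reach (glueMap v b B p1 p2) i j ↔ Reach p2 i j := by
  have h2 := mem_treeMaps.1 h.h2
  have hi' := mem_sdiff.1 hi
  constructor
  · refine fun h3 => h3.congr fun w _ h4 h5 => ?_
    have hwB : w ∉ B := by
      intro hw
      rcases Reach.mem_of_closed h.closed_block h4 (Or.inl hw) with h6 | h6
      · exact hi'.2 h6
      · exact h.hv (h6 ▸ hi'.1)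
    exact (h.glue_of_notMem hwB).symm
  · refine fun h3 => h3.congr fun w _ h4 h5 => ?_
    by_cases hw : w ∈ S \ B
    · exact h.glue_of_notMem (mem_sdiff.1 hw).2
    · exact absurd (h4.eq_of_fixed (h2.1 w hw)).symm h5

lemma reach_root_iff {j : V} : Reach (glueMap v b B p1 p2) b j ↔ j ∈ B := by
  refine ⟨fun h3 => ?_, h.reach_block⟩
  by_contra hj
  exact Reach.mem_of_closed h.closed_compl h3 hj h.hb

lemma glue_mem : glueMap v b B p1 p2 ∈ treeMaps v S := by
  rw [mem_treeMaps]
  have h2 := mem_treeMaps.1 h.h2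
  refine ⟨fun w hw => ?_, fun w hw => ?_⟩
  · rw [h.glue_of_notMem fun h' => hw (h.hB h')]
    exact h2.1 w fun h' => hw (mem_sdiff.1 h').1
  · by_cases hwB : w ∈ B
    · refine Reach.trans (Reach.step ?_) (h.reach_block hwB)
      rw [glueMap_root]
      exact Reach.refl _ _
    · refine (h2.2 w (mem_sdiff.2 ⟨hw, hwB⟩)).congr fun w' _ h4 h5 => ?_
      by_cases hw' : w' ∈ S \ B
      · exact h.glue_of_notMem (mem_sdiff.1 hw').2
      · exact absurd (h4.eq_of_fixed (h2.1 w' hw')).symm h5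

lemma treeStat_glue (e : V → V → ℕ) : treeStat e S (glueMap v b B p1 p2) =
    treeStat e (B.erase b) p1 + treeStat e (S \ B) p2 + ∑ j ∈ B.filter (fun j => j < b), e v j := by
  have hS : ∀ F : V → ℕ, ∑ i ∈ S, F i = ∑ i ∈ B.erase b, F i + F b + ∑ i ∈ S \ B, F i := by
    intro F
    rw [← sum_sdiff h.hB, sum_erase_add _ _ h.hb, add_comm]
  have hB1 : ∀ i ∈ B.erase b, (∑ j ∈ S, if j < i ∧ Reach (glueMap v b B p1 p2) i j then
      e (glueMap v b B p1 p2 i) j else 0) =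
      ∑ j ∈ B.erase b, if j < i ∧ Reach p1 i j then e (p1 i) j else 0 := by
    intro i hi
    have h1 := mem_treeMaps.1 h.h1
    have hi' := mem_erase.1 hi
    rw [hS, glueMap_of_mem hi]
    simp only [h.reach_iff_block hi]
    rw [if_neg, sum_eq_zero (s := S \ B), add_zero, add_zero]
    · intro j hj
      refine if_neg fun h3 => ?_
      have hjB := (mem_sdiff.1 hj).2
      have := h3.2.eq_of_fixed (h1.1 j fun h' => hjB (mem_of_mem_erase h'))
      exact hjB (this ▸ hi'.2)
    · intro h3
      exact hi'.1 (h3.2.eq_of_fixed (h1.1 b (notMem_erase b B)))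
  have hB2 : ∀ i ∈ S \ B, (∑ j ∈ S, if j < i ∧ Reach (glueMap v b B p1 p2) i j then
      e (glueMap v b B p1 p2 i) j else 0) =
      ∑ j ∈ S \ B, if j < i ∧ Reach p2 i j then e (p2 i) j else 0 := by
    intro i hi
    have h2 := mem_treeMaps.1 h.h2
    have hi' := mem_sdiff.1 hi
    rw [← sum_sdiff h.hB, h.glue_of_notMem hi'.2]
    simp only [h.reach_iff_compl hi]
    rw [sum_eq_zero (s := B), add_zero]
    intro j hj
    refine if_neg fun h3 => ?_
    have := h3.2.eq_of_fixed (h2.1 j fun h' => (mem_sdiff.1 h').2 hj)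
    exact hi'.2 (this ▸ hj)
  have hB3 : (∑ j ∈ S, if j < b ∧ Reach (glueMap v b B p1 p2) b j then
      e (glueMap v b B p1 p2 b) j else 0) = ∑ j ∈ B.filter (fun j => j < b), e v j := by
    rw [← sum_filter, glueMap_root]
    refine sum_congr ?_ fun _ _ => rfl
    ext j
    rw [mem_filter, mem_filter, h.reach_root_iff]
    exact ⟨fun h3 => ⟨h3.2.2, h3.2.1⟩, fun h3 => ⟨h.hB h3.1, h3.2, h3.1⟩⟩
  rw [treeStat, hS, sum_congr rfl hB1, sum_congr rfl hB2, hB3, treeStat, treeStat]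
  ring

lemma treeWt_glue {A : Type*} [CommRing A] (e : V → V → ℕ) (Q : A) :
    treeWt e Q S (glueMap v b B p1 p2) =
      nq Q (e b v) * Q ^ (∑ j ∈ B.filter (fun j => j < b), e v j) *
        (treeWt e Q (B.erase b) p1 * treeWt e Q (S \ B) p2) := by
  have e1 : ∏ w ∈ S \ B, nq Q (e w (glueMap v b B p1 p2 w)) = ∏ w ∈ S \ B, nq Q (e w (p2 w)) :=
    prod_congr rfl fun w hw => by rw [h.glue_of_notMem (mem_sdiff.1 hw).2]
  have e2 : ∏ w ∈ B.erase b, nq Q (e w (glueMap v b B p1 p2 w)) =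
      ∏ w ∈ B.erase b, nq Q (e w (p1 w)) :=
    prod_congr rfl fun w hw => by rw [glueMap_of_mem hw]
  rw [treeWt, h.treeStat_glue, ← prod_sdiff h.hB, ← mul_prod_erase B _ h.hb, glueMap_root, e1, e2,
    treeWt, treeWt, pow_add, pow_add]
  ring

end GlueData

lemma exists_glueData {v m : V} {S : Finset V} (hv : v ∉ S) (hm : m ∈ S) {p : V → V}
    (hp : p ∈ treeMaps v S) :
    ∃ b B p1 p2, GlueData v b S B p1 p2 ∧ m ∈ B ∧ glueMap v b B p1 p2 = p := by
  have hpv := (mem_treeMaps.1 hp).1 v hv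
  obtain ⟨b, hb, hbm, hbv⟩ : ∃ b ∈ S, Reach p b m ∧ p b = v := by
    obtain ⟨k, hk⟩ := (mem_treeMaps.1 hp).2 m hm
    induction k generalizing m with
    | zero => exact absurd hm (by rw [← hk] at hv; exact hv)
    | succ k ih =>
      rcases parent_mem hp hv hm with h | h
      · obtain ⟨b, hb, h1, h2⟩ := ih h hk
        exact ⟨b, hb, h1.step, h2⟩
      · exact ⟨m, hm, Reach.refl _ _, h⟩
  have hbv' : b ≠ v := fun h => hv (h ▸ hb)
  let B := S.filter fun w => Reach p b w
  have hB : ∀ w, w ∈ B ↔ w ∈ S ∧ Reach p b w := fun w => mem_filter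
  have hbB : b ∈ B := (hB b).2 ⟨hb, Reach.refl _ _⟩
  refine ⟨b, B, fun w => if w ∈ B.erase b then p w else w, fun w => if w ∈ S \ B then p w else w,
    ⟨hv, filter_subset _ _, hbB, ?_, ?_⟩, (hB m).2 ⟨hm, hbm⟩, ?_⟩
  · rw [mem_treeMaps]
    refine ⟨fun w hw => if_neg hw, fun w hw => ?_⟩
    rw [mem_erase, hB] at hw
    refine hw.2.2.congr fun w' _ h4 h5 => if_pos (mem_erase.2 ⟨h5, (hB w').2 ⟨?_, h4⟩⟩)
    by_contra hS
    exact h5 (h4.eq_of_fixed ((mem_treeMaps.1 hp).1 w' hS)).symm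
  · rw [mem_treeMaps]
    refine ⟨fun w hw => if_neg hw, fun w hw => ?_⟩
    rw [mem_sdiff, hB] at hw
    refine ((mem_treeMaps.1 hp).2 w hw.1).congr fun w' h3 h4 h5 => if_pos (mem_sdiff.2 ⟨?_, ?_⟩)
    · by_contra hS
      exact h5 (h4.eq_of_fixed ((mem_treeMaps.1 hp).1 w' hS)).symm
    · intro hw'
      exact hw.2 ⟨hw.1, ((hB w').1 hw').2.trans h3⟩
  · funext w
    rw [glueMap]
    by_cases hwb : w = b
    · rw [if_pos hwb, hwb, hbv]
    · rw [if_neg hwb]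
      by_cases hwB : w ∈ B
      · rw [if_pos hwB, if_pos (mem_erase.2 ⟨hwb, hwB⟩)]
      · rw [if_neg hwB]
        by_cases hS : w ∈ S
        · rw [if_pos (mem_sdiff.2 ⟨hS, hwB⟩)]
        · rw [if_neg fun h => hS (mem_sdiff.1 h).1, (mem_treeMaps.1 hp).1 w hS]

lemma GlueData.unique {v m b b' : V} {S B B' : Finset V} {p1 p2 p1' p2' : V → V}
    (h : GlueData v b S B p1 p2) (h' : GlueData v b' S B' p1' p2') (hm : m ∈ B) (hm' : m ∈ B')
    (he : glueMap v b B p1 p2 = glueMap v b' B' p1' p2') :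
    b = b' ∧ B = B' ∧ p1 = p1' ∧ p2 = p2' := by
  have aux : ∀ {b b' : V} {B B' : Finset V} {p1 p2 p1' p2' : V → V},
      GlueData v b S B p1 p2 → GlueData v b' S B' p1' p2' →
      glueMap v b B p1 p2 = glueMap v b' B' p1' p2' →
      Reach (glueMap v b B p1 p2) b b' → b = b' := by
    intro b b' B B' p1 p2 p1' p2' h h' he hr
    by_contra hne
    have := hr.tail (Ne.symm hne)
    rw [he, glueMap_root, ← he] at this
    have := this.eq_of_fixed h.glue_v
    exact h.notMem_root (this ▸ h.hb)
  have hb : b = b' := by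
    have h1 := h.reach_block hm
    have h2 := h'.reach_block hm'
    rw [← he] at h2
    rcases h1.total h2 with h3 | h3
    · exact aux h h' he h3
    · exact (aux h' h he.symm (he ▸ h3)).symm
  subst hb
  have hB : B = B' := by
    ext w
    rw [← h.reach_root_iff, ← h'.reach_root_iff, he]
  subst hB
  refine ⟨rfl, rfl, funext fun w => ?_, funext fun w => ?_⟩
  · by_cases hw : w ∈ B.erase b
    · rw [← glueMap_of_mem (v := v) (p1 := p1) (p2 := p2) hw,
        ← glueMap_of_mem (v := v) (p1 := p1') (p2 := p2') hw, he]
    · rw [(mem_treeMaps.1 h.h1).1 w hw, (mem_treeMaps.1 h'.h1).1 w hw]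
  · by_cases hw : w ∈ S \ B
    · rw [← h.glue_of_notMem (mem_sdiff.1 hw).2, ← h'.glue_of_notMem (mem_sdiff.1 hw).2, he]
    · rw [(mem_treeMaps.1 h.h2).1 w hw, (mem_treeMaps.1 h'.h2).1 w hw]

theorem treeSum_rec {A : Type*} [CommRing A] (e : V → V → ℕ) (Q : A) {v m : V} {S : Finset V}
    (hv : v ∉ S) (hm : m ∈ S) :
    treeSum e Q v S = ∑ B ∈ S.powerset.filter (fun B => m ∈ B), ∑ b ∈ B,
      nq Q (e b v) * Q ^ (∑ j ∈ B.filter (fun j => j < b), e v j) *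
        (treeSum e Q b (B.erase b) * treeSum e Q v (S \ B)) := by
  simp only [treeSum, sum_mul_sum]
  simp only [mul_sum]
  simp only [sum_sigma']
  symm
  have hG : ∀ x : (Σ _ : Finset V, Σ _ : V, Σ _ : V → V, V → V),
      x ∈ ((S.powerset.filter fun B => m ∈ B).sigma fun B => B.sigma fun b =>
        (treeMaps b (B.erase b)).sigma fun _ => treeMaps v (S \ B)) ↔
      m ∈ x.1 ∧ GlueData v x.2.1 S x.1 x.2.2.1 x.2.2.2 := by
    rintro ⟨B, b, p1, p2⟩
    simp only [mem_sigma, mem_filter, mem_powerset]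
    exact ⟨fun h => ⟨h.1.2, hv, h.1.1, h.2.1, h.2.2.1, h.2.2.2⟩,
      fun h => ⟨⟨h.2.hB, h.1⟩, h.2.hb, h.2.h1, h.2.h2⟩⟩
  refine sum_bij (fun x _ => glueMap v x.2.1 x.1 x.2.2.1 x.2.2.2) ?_ ?_ ?_ ?_
  · intro x hx
    exact ((hG x).1 hx).2.glue_mem
  · rintro ⟨B, b, p1, p2⟩ hx ⟨B', b', p1', p2'⟩ hy he
    rw [hG] at hx hy
    obtain ⟨rfl, rfl, rfl, rfl⟩ := hx.2.unique hy.2 hx.1 hy.1 he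
    rfl
  · intro p hp
    obtain ⟨b, B, p1, p2, h, hmB, he⟩ := exists_glueData hv hm hp
    exact ⟨⟨B, b, p1, p2⟩, (hG _).2 ⟨hmB, h⟩, he⟩
  · intro x hx
    exact (((hG x).1 hx).2.treeWt_glue e Q).symm

end Trees

/-! ### Cumulants of graph weights -/

section TreeCumulant

variable {V A : Type*} [Fintype V] [LinearOrder V] [CommRing A]

omit [Fintype V] in
lemma nq_telescope (Q : A) (d : V → ℕ) (B : Finset V) :
    (Q - 1) * ∑ b ∈ B, nq Q (d b) * Q ^ (∑ j ∈ B.filter (fun j => j < b), d j) =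
      Q ^ (∑ j ∈ B, d j) - 1 := by
  induction B using Finset.induction_on_max with
  | empty => simp
  | insert a s ha ih =>
    have hs : a ∉ s := fun h => lt_irrefl a (ha a h)
    have e1 : (insert a s).filter (fun j => j < a) = s := by
      ext j
      rw [mem_filter, mem_insert]
      exact ⟨fun h => h.1.resolve_left h.2.ne, fun h => ⟨Or.inr h, ha j h⟩⟩
    have e2 : ∑ b ∈ s, nq Q (d b) * Q ^ (∑ j ∈ (insert a s).filter (fun j => j < b), d j) =
        ∑ b ∈ s, nq Q (d b) * Q ^ (∑ j ∈ s.filter (fun j => j < b), d j) := by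
      refine sum_congr rfl fun b hb => ?_
      rw [filter_insert, if_neg (ha b hb).not_gt]
    rw [sum_insert hs, sum_insert hs, e1, e2, mul_add, ih, nq, ← mul_assoc, mul_geom_sum, pow_add]
    ring

lemma treeSum_empty (e : V → V → ℕ) (Q : A) (v : V) : treeSum e Q v ∅ = 1 := by
  have : treeMaps v (∅ : Finset V) = {id} := by
    ext p
    rw [mem_treeMaps, mem_singleton]
    exact ⟨fun h => funext fun w => h.1 w (notMem_empty w), fun h => by subst h; simp⟩
  rw [treeSum, this, sum_singleton, treeWt, treeStat]
  simp

theorem jointCumulant_eq_treeSum (e : V → V → ℕ) (he : ∀ i j, e i j = e j i) (Q : A)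
    (u : Finset V → A) (h0 : u ∅ = 1)
    (hu : ∀ v B, v ∉ B → u (insert v B) = Q ^ (e v v + ∑ b ∈ B, e v b) * u B)
    (S : Finset V) (v : V) (hv : v ∉ S) :
    jointCumulant u (insert v S) =
      Q ^ (∑ w ∈ insert v S, e w w) * ((Q - 1) ^ S.card * treeSum e Q v S) := by
  induction hk : S.card using Nat.strong_induction_on generalizing S v with
  | _ k ih =>
  subst hk
  rcases S.eq_empty_or_nonempty with rfl | ⟨m, hm⟩
  · have h1 : u {v} = Q ^ (e v v) := by
      have := hu v ∅ (notMem_empty v)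
      rwa [h0, sum_empty, add_zero, mul_one, insert_empty_eq] at this
    rw [insert_empty_eq, jointCumulant_singleton u h0, treeSum_empty, h1]
    simp
  rw [cumulant_insert u h0 (Q ^ e v v) (fun B => Q ^ (∑ b ∈ B, e v b))
    (fun B C hBC => by rw [sum_union hBC, pow_add]) (fun B hB => by rw [hu v B hB, pow_add])
    S hv hm, treeSum_rec e Q hv hm, mul_sum, mul_sum]
  refine sum_congr rfl fun B hB => ?_
  rw [mem_filter, mem_powerset] at hB
  have hvS : v ∉ S \ B := fun h => hv (mem_sdiff.1 h).1
  have hcard : (S \ B).card + B.card = S.card := card_sdiff_add_card_eq_card hB.1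
  have hpos : 0 < B.card := card_pos.2 ⟨m, hB.2⟩
  have hdiag : ∑ w ∈ insert v S, e w w = ∑ w ∈ B, e w w + ∑ w ∈ insert v (S \ B), e w w := by
    rw [sum_insert hv, sum_insert hvS, ← sum_sdiff hB.1]
    ring
  rw [ih _ (by omega) (S \ B) v hvS rfl, ← nq_telescope, mul_sum, sum_mul, sum_mul, mul_sum,
    mul_sum]
  refine sum_congr rfl fun b hb => ?_
  have hb1 : jointCumulant u B =
      Q ^ (∑ w ∈ B, e w w) * ((Q - 1) ^ (B.card - 1) * treeSum e Q b (B.erase b)) := by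
    have h1 := ih _ (by rw [card_erase_of_mem hb]; omega) (B.erase b) b (notMem_erase b B) rfl
    rwa [insert_erase hb, card_erase_of_mem hb] at h1
  have hpow : (Q - 1) ^ S.card = (Q - 1) * (Q - 1) ^ (B.card - 1) * (Q - 1) ^ (S \ B).card := by
    rw [← pow_succ', ← pow_add]
    congr 1
    omega
  rw [hb1, hdiag, pow_add, hpow, he b v]
  ring

/-- The `G`-inversion polynomial as a cumulant. -/
theorem Iinv_eq_jointCumulant {r : ℕ} (e : Fin (r+1) → Fin (r+1) → ℕ) (he : ∀ i j, e i j = e j i)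
    (Q : A) (u : Finset (Fin (r+1)) → A) (h0 : u ∅ = 1)
    (hu : ∀ v B, v ∉ B → u (insert v B) = Q ^ (e v v + ∑ b ∈ B, e v b) * u B) :
    jointCumulant u univ = (Q - 1) ^ r * Iinv e Q := by
  have h1 := jointCumulant_eq_treeSum e he Q u h0 hu (univ.erase 0) 0 (notMem_erase _ _)
  rw [insert_erase (mem_univ _), card_erase_of_mem (mem_univ _), card_univ, Fintype.card_fin,
    Nat.add_sub_cancel] at h1
  have hmem : ∀ p ∈ treeMaps (0 : Fin (r+1)) (univ.erase 0), p 0 = 0 ∧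
      (∀ w, w ≠ 0 → p w ≠ w) ∧ ∀ w, ∃ k, p^[k] w = 0 := by
    intro p hp
    rw [mem_treeMaps] at hp
    have h0 := hp.1 0 (notMem_erase _ _)
    refine ⟨h0, fun w hw h => ?_, fun w => ?_⟩
    · exact hw ((hp.2 w (mem_erase.2 ⟨hw, mem_univ _⟩)).eq_of_fixed h).symm
    · by_cases hw : w = 0
      · exact ⟨0, hw⟩
      · exact hp.2 w (mem_erase.2 ⟨hw, mem_univ _⟩)
  have h2 : treeSum e Q 0 (univ.erase (0 : Fin (r+1))) =
      ∑ p ∈ parentMaps e, Q ^ kappaStat e p * ∏ w ∈ univ.erase (0 : Fin (r+1)), nq Q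
        (e w (p w)) := by
    rw [treeSum]
    symm
    have hsub : parentMaps e ⊆ treeMaps 0 (univ.erase 0) := by
      intro p hp
      rw [parentMaps, mem_filter] at hp
      rw [mem_treeMaps]
      refine ⟨fun w hw => ?_, fun w _ => hp.2.2.2 w⟩
      have : w = 0 := by
        by_contra h
        exact hw (mem_erase.2 ⟨h, mem_univ _⟩)
      rw [this, hp.2.1]
    rw [← sum_subset hsub]
    · refine sum_congr rfl fun p hp => ?_
      have hp' := hsub hp
      have h3 := hmem p hp'
      rw [treeWt]
      congr 2
      rw [kappaStat, treeStat, ← sum_product', ← sum_filter]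
      refine sum_subset_zero_on_sdiff ?_ ?_ fun _ _ => rfl
      · rintro ⟨i, j⟩ hij
        rw [mem_filter] at hij ⊢
        obtain ⟨-, h4, h5, h6, h7, h8, -, -⟩ := hij
        exact ⟨mem_product.2 ⟨mem_erase.2 ⟨h4, mem_univ _⟩, mem_erase.2 ⟨h5, mem_univ _⟩⟩, h8, h7⟩
      · rintro ⟨i, j⟩ hij
        rw [mem_sdiff, mem_filter, mem_filter, mem_product] at hij
        obtain ⟨⟨⟨h4, h5⟩, h6, h7⟩, h8⟩ := hij
        by_contra hne
        refine h8 ⟨mem_univ _, ne_of_mem_erase h4, ne_of_mem_erase h5, h6.ne', h7, h6, ?_, ?_⟩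
        · intro h9
          have h10 : p j = j := by
            by_contra h
            obtain ⟨k, hk⟩ := h7
            have hper : p^[k + 1] j = j := by rw [Function.iterate_succ_apply', hk]; exact h9
            obtain ⟨l, hl⟩ := h3.2.2 j
            have hit : ∀ a, p^[(k + 1) * a] j = j := fun a => by
              rw [Function.iterate_mul]
              exact Function.iterate_fixed hper a
            have h11 := hit l
            rw [show (k + 1) * l = k * l + l by ring, Function.iterate_add_apply, hl,
              Function.iterate_fixed h3.1] at h11
            exact ne_of_mem_erase h5 h11.symm
          exact h3.2.1 j (ne_of_mem_erase h5) h10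
        · rw [he]
          exact Nat.pos_of_ne_zero hne
    · intro p hp hp'
      have h3 := hmem p hp
      obtain ⟨w, hw, hw0⟩ : ∃ w, w ≠ 0 ∧ e w (p w) = 0 := by
        by_contra! hcon
        refine hp' (mem_filter.2 ⟨mem_univ _, h3.1, fun w hw => ⟨h3.2.1 w hw, ?_⟩, h3.2.2⟩)
        exact Nat.pos_of_ne_zero (hcon w hw)
      have h4 : nq Q (e w (p w)) = 0 := by rw [hw0, nq, range_zero, sum_empty]
      rw [treeWt, prod_eq_zero (mem_erase.2 ⟨hw, mem_univ w⟩) h4, mul_zero]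
  rw [h1, h2, Iinv]
  ring

end TreeCumulant

/-! ### Colors of columns -/

section Rank

variable {α β : Type*} [LinearOrder β]

/-- The position of `p` in `P` sorted by the key `κ`. -/
def rankIn (κ : α → β) (P : Finset α) (p : α) : ℕ := (P.filter fun p' => κ p' ≤ κ p).card

lemma rankIn_lt {κ : α → β} {P : Finset α} {p p' : α} (hp : p ∈ P) (h : κ p' < κ p) :
    rankIn κ P p' < rankIn κ P p := by
  refine card_lt_card ((ssubset_iff_of_subset ?_).2 ⟨p, ?_, ?_⟩)
  · intro x hx
    rw [mem_filter] at hx ⊢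
    exact ⟨hx.1, hx.2.trans h.le⟩
  · exact mem_filter.2 ⟨hp, le_rfl⟩
  · exact fun hx => h.not_ge (mem_filter.1 hx).2

lemma rankIn_injOn {κ : α → β} (hκ : Function.Injective κ) (P : Finset α) :
    Set.InjOn (rankIn κ P) P := by
  intro p hp p' hp' h
  rcases lt_trichotomy (κ p) (κ p') with h1 | h1 | h1
  · exact absurd h (rankIn_lt hp' h1).ne
  · exact hκ h1
  · exact absurd h (rankIn_lt hp h1).ne'

lemma rankIn_mem {κ : α → β} {P : Finset α} {p : α} (hp : p ∈ P) :
    rankIn κ P p ∈ Icc 1 P.card :=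
  mem_Icc.2 ⟨card_pos.2 ⟨p, mem_filter.2 ⟨hp, le_rfl⟩⟩, card_le_card (filter_subset _ _)⟩

lemma exists_rankIn {κ : α → β} (hκ : Function.Injective κ) {P : Finset α} {x : ℕ}
    (hx : x ∈ Icc 1 P.card) : ∃ p ∈ P, rankIn κ P p = x :=
  surjOn_of_injOn_of_card_le (rankIn κ P) (fun _ hp => rankIn_mem hp) (rankIn_injOn hκ P)
    (by rw [Nat.card_Icc, Nat.add_sub_cancel]) hx

lemma rankIn_le_iff {κ : α → β} {P D : Finset α} (hD : D ⊆ P)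
    (hdown : ∀ p ∈ P, ∀ p' ∈ D, κ p ≤ κ p' → p ∈ D) {p : α} (hp : p ∈ P) :
    rankIn κ P p ≤ D.card ↔ p ∈ D := by
  constructor
  · intro h
    by_contra hpD
    refine h.not_gt (card_lt_card ((ssubset_iff_of_subset ?_).2 ⟨p, ?_, hpD⟩))
    · intro x hx
      refine mem_filter.2 ⟨hD hx, ?_⟩
      by_contra hlt
      exact hpD (hdown p hp x hx (not_le.1 hlt).le)
    · exact mem_filter.2 ⟨hp, le_rfl⟩
  · intro h
    refine card_le_card fun x hx => ?_
    rw [mem_filter] at hx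
    exact hdown x hx.1 p h hx.2

end Rank

section Colors

variable {r : ℕ} (lam : Fin (r+1) → ℕ → ℕ)

/-- The sorting key of the columns. -/
def colKey (p : Fin (r+1) × ℕ) : ℕᵒᵈ ×ₗ (Fin (r+1) ×ₗ ℕ) :=
  toLex (OrderDual.toDual (colLen (lam p.1) p.2), toLex p)

lemma colKey_injective : Function.Injective (colKey lam) := by
  intro p p' h
  have h1 := congrArg (fun x => ofLex (ofLex x).2) h
  exact h1

lemma colBefore_iff {p' p : Fin (r+1) × ℕ} : colBefore lam p' p ↔ colKey lam p' ≤ colKey lam p := by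
  rw [colKey, colKey, Prod.Lex.toLex_le_toLex, Prod.Lex.toLex_le_toLex, colBefore]
  simp only [OrderDual.toDual_lt_toDual, OrderDual.toDual_inj]

lemma posIn_eq (B : Finset (Fin (r+1))) (p : Fin (r+1) × ℕ) :
    posIn lam B p.1 p.2 = rankIn (colKey lam) (columnPairs lam B) p := by
  rw [posIn, rankIn]
  simp only [colBefore_iff]

lemma mem_columnPairs {p : Fin (r+1) × ℕ} :
    p ∈ columnPairs lam univ ↔ 1 ≤ p.2 ∧ p.2 ≤ lam p.1 1 := by
  rw [columnPairs, mem_filter, mem_product, mem_Icc]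
  refine ⟨fun h => ⟨h.1.2.1, h.2⟩, fun h => ⟨⟨mem_univ _, h.1, h.2.trans ?_⟩, h.2⟩⟩
  exact single_le_sum (f := fun b => lam b 1) (fun _ _ => Nat.zero_le _) (mem_univ p.1)

variable {lam}

lemma card_columnPairs_filter {j : ℕ} (hlam : ∀ b, IsPartitionFun (lam b)) (hj : 1 ≤ j) :
    ((columnPairs lam univ).filter fun p => p.2 ≤ lam p.1 j).card = lamB lam univ j := by
  have : (columnPairs lam univ).filter (fun p => p.2 ≤ lam p.1 j) =
      ((univ : Finset (Fin (r+1))).sigma fun b => Icc 1 (lam b j)).map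
        (Equiv.sigmaEquivProd _ _).toEmbedding := by
    ext p
    rw [mem_filter, mem_columnPairs, mem_map_equiv, mem_sigma, mem_Icc]
    exact ⟨fun h => ⟨mem_univ _, h.1.1, h.2⟩,
      fun h => ⟨⟨h.2.1, h.2.2.trans ((hlam p.1).1 hj)⟩, h.2.2⟩⟩
  rw [this, card_map, card_sigma, lamB]
  exact sum_congr rfl fun b _ => by rw [Nat.card_Icc, Nat.add_sub_cancel]

lemma colColor_rankIn {p : Fin (r+1) × ℕ} (hp : p ∈ columnPairs lam univ) :
    colColor lam (rankIn (colKey lam) (columnPairs lam univ) p) = p.1 := by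
  have h : ∃ p' ∈ columnPairs lam univ, posIn lam univ p'.1 p'.2 =
      rankIn (colKey lam) (columnPairs lam univ) p := ⟨p, hp, posIn_eq lam _ p⟩
  have h1 := h.choose_spec
  rw [posIn_eq] at h1
  rw [colColor, colAt, dif_pos h, rankIn_injOn (colKey_injective lam) _ h1.1 hp h1.2]

/-- The number of boxes of a given color in a row of `λ^{[r]}`. -/
lemma card_color_row (hlam : ∀ b, IsPartitionFun (lam b)) {j : ℕ} (hj : 1 ≤ j) (b : Fin (r+1)) :
    ((Icc 1 (lamB lam univ j)).filter fun x => colColor lam x = b).card = lam b j := by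
  set P := columnPairs lam univ with hP
  set D := P.filter fun p => p.2 ≤ lam p.1 j with hD
  have hDP : D ⊆ P := filter_subset _ _
  have hcD : D.card = lamB lam univ j := card_columnPairs_filter hlam hj
  have hsh : ∀ b, IsShape (lam b) := fun b => by
    have h : lamB lam {b} = lam b := funext fun j => sum_singleton _ _
    exact h ▸ isShape_lamB hlam {b}
  have hlen : ∀ p ∈ P, (p ∈ D ↔ j ≤ colLen (lam p.1) p.2) := by
    intro p hp
    rw [hD, mem_filter, and_iff_right hp, le_colLen (hsh p.1) ((mem_columnPairs lam).1 hp).1 hj]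
  have hdown : ∀ p ∈ P, ∀ p' ∈ D, colKey lam p ≤ colKey lam p' → p ∈ D := by
    intro p hp p' hp' h
    rw [hlen p hp]
    refine ((hlen p' (hDP hp')).1 hp').trans ?_
    rw [← colBefore_iff] at h
    rcases h with h | h
    · exact h.le
    · exact h.1.ge
  have hle := fun p (hp : p ∈ P) => rankIn_le_iff hDP hdown hp
  rw [hcD] at hle
  have hcard : lam b j = (Icc 1 (lam b j)).card := by rw [Nat.card_Icc, Nat.add_sub_cancel]
  rw [hcard]
  symm
  have hmem : ∀ i ∈ Icc 1 (lam b j), (b, i) ∈ D := by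
    intro i hi
    rw [mem_Icc] at hi
    exact mem_filter.2 ⟨(mem_columnPairs lam).2 ⟨hi.1, hi.2.trans ((hlam b).1 hj)⟩, hi.2⟩
  refine card_bij (fun i _ => rankIn (colKey lam) P (b, i)) ?_ ?_ ?_
  · intro i hi
    have h := hmem i hi
    rw [mem_filter, mem_Icc]
    exact ⟨⟨(mem_Icc.1 (rankIn_mem (hDP h))).1, (hle _ (hDP h)).2 h⟩, colColor_rankIn (hDP h)⟩
  · intro i hi i' hi' h
    have := rankIn_injOn (colKey_injective lam) P (hDP (hmem i hi)) (hDP (hmem i' hi')) h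
    exact congrArg Prod.snd this
  · intro x hx
    rw [mem_filter, mem_Icc] at hx
    obtain ⟨⟨h1, h2⟩, h3⟩ := hx
    obtain ⟨p, hp, rfl⟩ := exists_rankIn (colKey_injective lam) (P := P)
      (mem_Icc.2 ⟨h1, h2.trans (hcD ▸ card_le_card hDP)⟩)
    rw [colColor_rankIn hp] at h3
    have h4 := (hle p hp).1 h2
    subst h3
    exact ⟨p.2, mem_Icc.2 ⟨((mem_columnPairs lam).1 hp).1, (mem_filter.1 h4).2⟩, rfl⟩

end Colors

/-! ### Products and transport of generating polynomials -/

section Products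

variable {α F : Type*} [DecidableEq α] [CommRing F]

/-- Restriction of a filling, extended by zero. -/
def restr (C : Finset α) (σ : α → ℕ) : α → ℕ := fun c => if c ∈ C then σ c else 0

lemma restr_of_mem {C : Finset α} {σ : α → ℕ} {c : α} (hc : c ∈ C) : restr C σ c = σ c := if_pos hc

lemma restr_of_notMem {C : Finset α} {σ : α → ℕ} {c : α} (hc : c ∉ C) : restr C σ c = 0 := if_neg hc

lemma restr_mem_fills {C D : Finset α} (h : C ⊆ D) {N : ℕ} {σ : α → ℕ} (hσ : σ ∈ fills D N) :
    restr C σ ∈ fills C N := by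
  rw [mem_fills] at hσ ⊢
  exact ⟨fun c hc => by rw [restr_of_mem hc]; exact hσ.1 c (h hc), fun c hc => if_neg hc⟩

lemma restr_restr {C D : Finset α} (h : C ⊆ D) (σ : α → ℕ) : restr C (restr D σ) = restr C σ := by
  funext c
  by_cases hc : c ∈ C
  · rw [restr_of_mem hc, restr_of_mem hc, restr_of_mem (h hc)]
  · rw [restr_of_notMem hc, restr_of_notMem hc]

lemma fillPoly_mul {C D : Finset α} (h : Disjoint C D) (N : ℕ) (w w' : (α → ℕ) → F) :
    fillPoly C N w * fillPoly D N w' =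
      fillPoly (C ∪ D) N fun σ => w (restr C σ) * w' (restr D σ) := by
  have hD : ∀ c ∈ D, c ∉ C := fun c hc hc' => disjoint_left.1 h hc' hc
  rw [fillPoly, fillPoly, fillPoly, sum_mul_sum, ← sum_product']
  have key : ∀ p ∈ fills C N ×ˢ fills D N,
      restr C (fun c => if c ∈ C then p.1 c else p.2 c) = p.1 ∧
      restr D (fun c => if c ∈ C then p.1 c else p.2 c) = p.2 := by
    intro p hp
    rw [mem_product, mem_fills, mem_fills] at hp
    refine ⟨funext fun c => ?_, funext fun c => ?_⟩
    · by_cases hc : c ∈ C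
      · rw [restr_of_mem hc, if_pos hc]
      · rw [restr_of_notMem hc, hp.1.2 c hc]
    · by_cases hc : c ∈ D
      · rw [restr_of_mem hc, if_neg (hD c hc)]
      · rw [restr_of_notMem hc, hp.2.2 c hc]
  refine sum_bij' (fun p _ c => if c ∈ C then p.1 c else p.2 c) (fun σ _ => (restr C σ, restr D σ))
    ?_ ?_ ?_ ?_ ?_
  · intro p hp
    rw [mem_product, mem_fills, mem_fills] at hp
    rw [mem_fills]
    refine ⟨fun c hc => ?_, fun c hc => ?_⟩
    · split_ifs with h1
      · exact hp.1.1 c h1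
      · exact hp.2.1 c ((mem_union.1 hc).resolve_left h1)
    · rw [mem_union, not_or] at hc
      rw [if_neg hc.1, hp.2.2 c hc.2]
  · intro σ hσ
    exact mem_product.2 ⟨restr_mem_fills subset_union_left hσ, restr_mem_fills subset_union_right
      hσ⟩
  · intro p hp
    exact Prod.ext (key p hp).1 (key p hp).2
  · intro σ hσ
    funext c
    change (if c ∈ C then restr C σ c else restr D σ c) = σ c
    by_cases hc : c ∈ C
    · rw [if_pos hc, restr_of_mem hc]
    · rw [if_neg hc]
      by_cases hc' : c ∈ D
      · rw [restr_of_mem hc']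
      · rw [restr_of_notMem hc', (mem_fills.1 hσ).2 c fun h => (mem_union.1 h).elim hc hc']
  · intro p hp
    rw [(key p hp).1, (key p hp).2, prod_union h, map_mul]
    have e1 : ∏ c ∈ C, (MvPolynomial.X (if c ∈ C then p.1 c else p.2 c) : MvPolynomial ℕ F) =
        ∏ c ∈ C, MvPolynomial.X (p.1 c) := prod_congr rfl fun c hc => by rw [if_pos hc]
    have e2 : ∏ c ∈ D, (MvPolynomial.X (if c ∈ C then p.1 c else p.2 c) : MvPolynomial ℕ F) =
        ∏ c ∈ D, MvPolynomial.X (p.2 c) := prod_congr rfl fun c hc => by rw [if_neg (hD c hc)]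
    rw [e1, e2]
    ring

lemma fillPoly_prod {ι : Type*} [DecidableEq ι] (s : Finset ι) (C : ι → Finset α)
    (h : ∀ i ∈ s, ∀ j ∈ s, i ≠ j → Disjoint (C i) (C j)) (N : ℕ) (w : ι → (α → ℕ) → F) :
    ∏ i ∈ s, fillPoly (C i) N (w i) =
      fillPoly (s.biUnion C) N fun σ => ∏ i ∈ s, w i (restr (C i) σ) := by
  induction s using Finset.induction_on with
  | empty =>
    have : fills (∅ : Finset α) N = {fun _ => 0} := by
      ext σ
      rw [mem_fills, mem_singleton]
      exact ⟨fun h => funext fun c => h.2 c (notMem_empty c), fun h => by subst h; simp⟩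
    rw [prod_empty, biUnion_empty, fillPoly, this, sum_singleton]
    simp
  | insert a s ha ih =>
    have hdisj : Disjoint (C a) (s.biUnion C) := by
      rw [disjoint_biUnion_right]
      intro i hi
      exact h a (mem_insert_self a s) i (mem_insert_of_mem hi) fun h => ha (h ▸ hi)
    rw [prod_insert ha, ih fun i hi j hj => h i (mem_insert_of_mem hi) j (mem_insert_of_mem hj),
      fillPoly_mul hdisj, biUnion_insert]
    congr 1
    funext σ
    rw [prod_insert ha]
    congr 1
    exact prod_congr rfl fun i hi => by rw [restr_restr (subset_biUnion_of_mem C hi)]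

lemma fillPoly_transport [Nonempty α] {α' : Type*} [DecidableEq α'] {C : Finset α}
    {C' : Finset α'} (ψ : α → α')
    (hψ : Set.BijOn ψ C C') (N : ℕ) (w : (α → ℕ) → F) (w' : (α' → ℕ) → F)
    (hw : ∀ σ ∈ fills C' N, w' σ = w (restr C (σ ∘ ψ))) :
    fillPoly C' N w' = fillPoly C N w := by
  rw [fillPoly, fillPoly]
  refine sum_bij (fun σ _ => restr C (σ ∘ ψ)) ?_ ?_ ?_ ?_
  · intro σ hσ
    rw [mem_fills] at hσ ⊢
    exact ⟨fun c hc => by rw [restr_of_mem hc]; exact hσ.1 _ (hψ.mapsTo hc), fun c hc => if_neg hc⟩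
  · intro σ hσ τ hτ h
    funext c
    by_cases hc : c ∈ C'
    · obtain ⟨d, hd, rfl⟩ := hψ.surjOn hc
      have := congrFun h d
      beta_reduce at this
      rwa [restr_of_mem hd, restr_of_mem hd] at this
    · rw [(mem_fills.1 hσ).2 c hc, (mem_fills.1 hτ).2 c hc]
  · intro τ hτ
    have hsurj : ∀ c ∈ C', ∃ d, d ∈ C ∧ ψ d = c := fun c hc => hψ.surjOn hc
    choose! g hg using hsurj
    refine ⟨restr C' (τ ∘ g), ?_, ?_⟩
    · rw [mem_fills] at hτ ⊢
      exact ⟨fun c hc => by rw [restr_of_mem hc]; exact hτ.1 _ (hg c hc).1, fun c hc => if_neg hc⟩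
    · funext c
      by_cases hc : c ∈ C
      · have h1 := hψ.mapsTo hc
        rw [restr_of_mem hc, Function.comp_apply, restr_of_mem h1, Function.comp_apply,
          hψ.injOn (hg _ h1).1 hc (hg _ h1).2]
      · rw [restr_of_notMem hc, (mem_fills.1 hτ).2 c hc]
  · intro σ hσ
    rw [hw σ hσ]
    congr 1
    symm
    refine prod_bij (fun c _ => ψ c) (fun c hc => hψ.mapsTo hc)
      (fun c hc d hd h => hψ.injOn hc hd h)
      (fun c hc => ?_) fun c hc => by rw [restr_of_mem hc, Function.comp_apply]
    obtain ⟨d, hd, h⟩ := hψ.surjOn hc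
    exact ⟨d, hd, h⟩

end Products

lemma card_filter_insert_pair {P V : Type*} [DecidableEq V] (S : Finset P) (a b : P → V) {v : V}
    {B : Finset V} (hv : v ∉ B) :
    (S.filter fun p => a p ∈ insert v B ∧ b p ∈ insert v B).card =
      (S.filter fun p => (a p = v ∧ b p = v) ∨ (a p = v ∧ b p = v)).card +
      ∑ w ∈ B, (S.filter fun p => (a p = v ∧ b p = w) ∨ (a p = w ∧ b p = v)).card +
      (S.filter fun p => a p ∈ B ∧ b p ∈ B).card := by
  simp only [card_filter]
  rw [sum_comm, ← sum_add_distrib, ← sum_add_distrib]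
  refine sum_congr rfl fun p _ => ?_
  simp only [mem_insert, or_self]
  by_cases ha : a p = v <;> by_cases hb : b p = v
  · have h1 : ∀ w ∈ B, (if (a p = v ∧ b p = w) ∨ (a p = w ∧ b p = v) then 1 else 0) = 0 := by
      intro w hw
      refine if_neg ?_
      rw [ha, hb]
      rintro (⟨-, rfl⟩ | ⟨rfl, -⟩) <;> exact hv hw
    rw [sum_congr rfl h1]
    simp [ha, hb, hv]
  · simp [ha, hb, hv]
  · simp [ha, hb, hv]
  · simp [ha, hb]

/-! ### Macdonald cumulants as generating polynomials -/

/-- The image of `q` in `ℚ(q,t)`. -/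
def qK : KField := algebraMap (MvPolynomial (Fin 2) ℤ) KField (MvPolynomial.X 0)

/-- The image of `t` in `ℚ(q,t)`. -/
def tK : KField := algebraMap (MvPolynomial (Fin 2) ℤ) KField (MvPolynomial.X 1)

lemma qK_ne_zero : qK ≠ 0 := by
  rw [qK, Ne, map_eq_zero_iff _ (IsFractionRing.injective (MvPolynomial (Fin 2) ℤ) KField)]
  exact MvPolynomial.X_ne_zero 0

lemma qK_ne_one : qK - 1 ≠ 0 := by
  rw [sub_ne_zero, qK, Ne, ← map_one (algebraMap (MvPolynomial (Fin 2) ℤ) KField),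
    (IsFractionRing.injective (MvPolynomial (Fin 2) ℤ) KField).eq_iff]
  intro h
  have := congrArg MvPolynomial.constantCoeff h
  simp at this

lemma toK_macH (f : ℕ → ℕ) (N : ℕ) :
    toK (macH f N) = fillPoly (cells f) N fun σ => qK ^ invStat f σ * tK ^ majStat f σ := by
  rw [macH, fillPoly, map_sum, fillings_eq_fills]
  refine sum_congr rfl fun σ _ => ?_
  have hq : toK qv = MvPolynomial.C qK := MvPolynomial.aeval_X _ _
  have ht : toK tv = MvPolynomial.C tK := MvPolynomial.aeval_X _ _
  have hx : ∀ k, toK (xv k) = MvPolynomial.X k := fun k => MvPolynomial.aeval_X _ _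
  rw [map_mul, map_mul, map_pow, map_pow, map_prod, hq, ht, map_mul, map_pow, map_pow]
  simp only [hx]

section ColoredCells

variable {r : ℕ} (lam : Fin (r+1) → ℕ → ℕ)

/-- The cells of `λ^{[r]}` with color in `B`. -/
def colCells (B : Finset (Fin (r+1))) : Finset (ℕ × ℕ) :=
  (cells (lamB lam univ)).filter fun c => colColor lam c.1 ∈ B

/-- The number of inversion pairs with both colors in `B`. -/
def invIn (σ : ℕ × ℕ → ℕ) (B : Finset (Fin (r+1))) : ℕ :=
  ((invPairs (lamB lam univ) σ).filter fun p =>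
    colColor lam p.1.1 ∈ B ∧ colColor lam p.2.1 ∈ B).card

/-- The contribution to the major index of the columns with color in `B`. -/
def majIn (σ : ℕ × ℕ → ℕ) (B : Finset (Fin (r+1))) : ℕ :=
  ∑ c ∈ (desSet (lamB lam univ) σ).filter fun c => colColor lam c.1 ∈ B,
    (colLen (lamB lam univ) c.1 - c.2 + 1)

/-- The position of column `x` among the columns with color in `B`. -/
def colRank (B : Finset (Fin (r+1))) (x : ℕ) : ℕ :=
  ((Icc 1 x).filter fun x' => colColor lam x' ∈ B).card

variable {lam} (hlam : ∀ b, IsPartitionFun (lam b)) {B : Finset (Fin (r+1))}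

lemma mem_colCells_of_row_le (hlam : ∀ b, IsPartitionFun (lam b)) {c : ℕ × ℕ}
    (hc : c ∈ colCells lam B) {j : ℕ} (hj : 1 ≤ j) (hjc : j ≤ c.2) : (c.1, j) ∈ colCells lam B := by
  have hΛ := isShape_lamB hlam univ
  rw [colCells, mem_filter, mem_cells hΛ] at hc ⊢
  exact ⟨⟨hc.1.1, hj, hc.1.2.2.trans (hΛ.1 _ _ hj hjc)⟩, hc.2⟩

include hlam

lemma card_color_block {j : ℕ} (hj : 1 ≤ j) :
    ((Icc 1 (lamB lam univ j)).filter fun x => colColor lam x ∈ B).card = lamB lam B j := by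
  rw [card_eq_sum_card_fiberwise (s := (Icc 1 (lamB lam univ j)).filter fun x => colColor lam x ∈ B)
    (f := colColor lam) (t := B) fun x hx => (mem_filter.1 hx).2, lamB]
  refine sum_congr rfl fun b hb => ?_
  rw [← card_color_row hlam hj b, filter_filter]
  congr 1
  ext x
  rw [mem_filter, mem_filter]
  exact ⟨fun h => ⟨h.1, h.2.2⟩, fun h => ⟨h.1, by rw [h.2]; exact hb, h.2⟩⟩

omit hlam in
lemma colRank_lt {x y : ℕ} (hxy : x < y) (hy : colColor lam y ∈ B) :
    colRank lam B x < colRank lam B y := by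
  refine card_lt_card ((ssubset_iff_of_subset ?_).2 ⟨y, ?_, ?_⟩)
  · exact filter_subset_filter _ (Icc_subset_Icc le_rfl hxy.le)
  · exact mem_filter.2 ⟨mem_Icc.2 ⟨by omega, le_rfl⟩, hy⟩
  · exact fun h => hxy.not_ge (mem_Icc.1 (mem_filter.1 h).1).2

omit hlam in
lemma colRank_lt_iff {x y : ℕ} (hx : colColor lam x ∈ B) (hy : colColor lam y ∈ B) :
    colRank lam B x < colRank lam B y ↔ x < y := by
  refine ⟨fun h => ?_, fun h => colRank_lt h hy⟩
  by_contra hc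
  rcases (not_lt.1 hc).lt_or_eq with h1 | h1
  · exact lt_asymm h (colRank_lt h1 hx)
  · rw [h1] at h
    exact lt_irrefl _ h

lemma colRank_le_iff {x j : ℕ} (hx : 1 ≤ x) (hj : 1 ≤ j) (hxB : colColor lam x ∈ B) :
    colRank lam B x ≤ lamB lam B j ↔ x ≤ lamB lam univ j := by
  rw [← card_color_block hlam hj]
  constructor
  · intro h
    by_contra hc
    refine h.not_gt (card_lt_card ((ssubset_iff_of_subset ?_).2 ⟨x, ?_, ?_⟩))
    · exact filter_subset_filter _ (Icc_subset_Icc le_rfl (not_le.1 hc).le)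
    · exact mem_filter.2 ⟨mem_Icc.2 ⟨hx, le_rfl⟩, hxB⟩
    · exact fun h => hc (mem_Icc.1 (mem_filter.1 h).1).2
  · exact fun h => card_le_card (filter_subset_filter _ (Icc_subset_Icc le_rfl h))

omit hlam in
lemma one_le_colRank {x : ℕ} (hx : 1 ≤ x) (hxB : colColor lam x ∈ B) : 1 ≤ colRank lam B x :=
  card_pos.2 ⟨x, mem_filter.2 ⟨mem_Icc.2 ⟨hx, le_rfl⟩, hxB⟩⟩

lemma colLen_colRank {x : ℕ} (hx : 1 ≤ x) (hxB : colColor lam x ∈ B) :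
    colLen (lamB lam B) (colRank lam B x) = colLen (lamB lam univ) x := by
  have key : ∀ j, 1 ≤ j → (j ≤ colLen (lamB lam B) (colRank lam B x) ↔
      j ≤ colLen (lamB lam univ) x) := fun j hj => by
    rw [le_colLen (isShape_lamB hlam _) (one_le_colRank hx hxB) hj,
      le_colLen (isShape_lamB hlam _) hx hj, colRank_le_iff hlam hx hj hxB]
  apply le_antisymm
  · by_contra h
    exact h ((key _ (by omega)).1 le_rfl)
  · by_contra h
    exact h ((key _ (by omega)).2 le_rfl)

lemma bijOn_colRank : Set.BijOn (fun c : ℕ × ℕ => (colRank lam B c.1, c.2)) (colCells lam B)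
    (cells (lamB lam B)) := by
  have hΛ := isShape_lamB hlam univ
  have hmem : ∀ c, c ∈ colCells lam B ↔
      (1 ≤ c.1 ∧ 1 ≤ c.2 ∧ c.1 ≤ lamB lam univ c.2) ∧ colColor lam c.1 ∈ B := fun c => by
    rw [colCells, mem_filter, mem_cells hΛ]
  refine ⟨?_, ?_, ?_⟩
  · intro c hc
    obtain ⟨⟨h1, h2, h3⟩, h4⟩ := (hmem c).1 hc
    exact (mem_cells (isShape_lamB hlam B)).2
      ⟨one_le_colRank h1 h4, h2, (colRank_le_iff hlam h1 h2 h4).2 h3⟩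
  · intro c hc d hd h
    have h1 := congrArg Prod.fst h
    have h2 := congrArg Prod.snd h
    have hc4 := ((hmem c).1 hc).2
    have hd4 := ((hmem d).1 hd).2
    refine Prod.ext ?_ h2
    rcases lt_trichotomy c.1 d.1 with h3 | h3 | h3
    · exact absurd h1 (colRank_lt h3 hd4).ne
    · exact h3
    · exact absurd h1 (colRank_lt h3 hc4).ne'
  · rintro ⟨i, j⟩ hij
    obtain ⟨h1, h2, h3⟩ := (mem_cells (isShape_lamB hlam B)).1 hij
    have hsurj := surjOn_of_injOn_of_card_le
      (s := (Icc 1 (lamB lam univ j)).filter fun x => colColor lam x ∈ B)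
      (t := Icc 1 (lamB lam B j)) (colRank lam B) ?_ ?_ ?_
    · obtain ⟨x, hx, hxi⟩ := hsurj (mem_Icc.2 ⟨h1, h3⟩)
      rw [mem_coe, mem_filter, mem_Icc] at hx
      exact ⟨(x, j), (hmem _).2 ⟨⟨hx.1.1, h2, hx.1.2⟩, hx.2⟩, Prod.ext hxi rfl⟩
    · intro x hx
      rw [mem_coe, mem_filter, mem_Icc] at hx
      exact mem_Icc.2 ⟨one_le_colRank hx.1.1 hx.2, (colRank_le_iff hlam hx.1.1 h2 hx.2).2 hx.1.2⟩
    · intro x hx y hy h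
      rw [mem_coe, mem_filter] at hx hy
      rcases lt_trichotomy x y with h3 | h3 | h3
      · exact absurd h (colRank_lt h3 hy.2).ne
      · exact h3
      · exact absurd h (colRank_lt h3 hx.2).ne'
    · rw [Nat.card_Icc, Nat.add_sub_cancel, card_color_block hlam h2]

omit hlam in
lemma mem_invPairs {f : ℕ → ℕ} {σ : ℕ × ℕ → ℕ} {p : (ℕ × ℕ) × (ℕ × ℕ)} : p ∈ invPairs f σ ↔
    (p.1 ∈ cells f ∧ p.2 ∈ cells f) ∧ p.1.2 = p.2.2 ∧ p.1.1 < p.2.1 ∧ invTriple σ p.1 p.2 := by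
  rw [invPairs, mem_filter, mem_product]

lemma invStat_colRank {σ τ : ℕ × ℕ → ℕ}
    (h : ∀ c ∈ colCells lam B, τ c = σ (colRank lam B c.1, c.2))
    (h' : ∀ c ∈ colCells lam B, τ (c.1, c.2 - 1) = σ (colRank lam B c.1, c.2 - 1)) :
    invStat (lamB lam B) σ = invIn lam τ B := by
  have hψ := bijOn_colRank hlam (B := B)
  rw [invStat, invIn]
  symm
  have hp : ∀ p, p ∈ (invPairs (lamB lam univ) τ).filter (fun p =>
      colColor lam p.1.1 ∈ B ∧ colColor lam p.2.1 ∈ B) ↔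
      (p.1 ∈ colCells lam B ∧ p.2 ∈ colCells lam B) ∧ p.1.2 = p.2.2 ∧ p.1.1 < p.2.1 ∧
        invTriple τ p.1 p.2 := by
    intro p
    rw [mem_filter, mem_invPairs, colCells, mem_filter, mem_filter]
    tauto
  have hinv : ∀ p : (ℕ × ℕ) × (ℕ × ℕ), p.1 ∈ colCells lam B → p.2 ∈ colCells lam B →
      (invTriple σ (colRank lam B p.1.1, p.1.2) (colRank lam B p.2.1, p.2.2) ↔
        invTriple τ p.1 p.2) := by
    intro p h1 h2
    rw [invTriple, invTriple, h _ h1, h _ h2, h' _ h1]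
  refine card_bij (fun p _ => ((colRank lam B p.1.1, p.1.2), (colRank lam B p.2.1, p.2.2))) ?_ ?_ ?_
  · intro p hp1
    obtain ⟨⟨h1, h2⟩, h3, h4, h5⟩ := (hp p).1 hp1
    exact mem_invPairs.2 ⟨⟨hψ.mapsTo h1, hψ.mapsTo h2⟩, h3,
      colRank_lt h4 (mem_filter.1 h2).2, (hinv p h1 h2).2 h5⟩
  · intro p hp1 p' hp2 he
    obtain ⟨⟨h1, h2⟩, -⟩ := (hp p).1 hp1
    obtain ⟨⟨h3, h4⟩, -⟩ := (hp p').1 hp2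
    exact Prod.ext (hψ.injOn h1 h3 (congrArg Prod.fst he)) (hψ.injOn h2 h4 (congrArg Prod.snd he))
  · rintro ⟨c, d⟩ hcd
    obtain ⟨⟨h1, h2⟩, h3, h4, h5⟩ := mem_invPairs.1 hcd
    obtain ⟨c, hc, rfl⟩ := hψ.surjOn h1
    obtain ⟨d, hd, rfl⟩ := hψ.surjOn h2
    refine ⟨(c, d), (hp _).2 ⟨⟨hc, hd⟩, h3, ?_, (hinv (c, d) hc hd).1 h5⟩, rfl⟩
    exact (colRank_lt_iff (mem_filter.1 hc).2 (mem_filter.1 hd).2).1 h4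

lemma majStat_colRank {σ τ : ℕ × ℕ → ℕ}
    (h : ∀ c ∈ colCells lam B, τ c = σ (colRank lam B c.1, c.2))
    (h' : ∀ c ∈ colCells lam B, τ (c.1, c.2 - 1) = σ (colRank lam B c.1, c.2 - 1)) :
    majStat (lamB lam B) σ = majIn lam τ B := by
  have hψ := bijOn_colRank hlam (B := B)
  rw [majStat, majIn]
  symm
  have hp : ∀ c, c ∈ (desSet (lamB lam univ) τ).filter (fun c => colColor lam c.1 ∈ B) ↔
      c ∈ colCells lam B ∧ 2 ≤ c.2 ∧ τ (c.1, c.2 - 1) < τ c := by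
    intro p
    rw [mem_filter, desSet, mem_filter, colCells, mem_filter]
    tauto
  refine sum_bij (fun c _ => (colRank lam B c.1, c.2)) ?_ ?_ ?_ ?_
  · intro c hc
    obtain ⟨h1, h2, h3⟩ := (hp c).1 hc
    rw [h _ h1, h' _ h1] at h3
    exact mem_filter.2 ⟨hψ.mapsTo h1, h2, h3⟩
  · intro c hc d hd he
    exact hψ.injOn ((hp c).1 hc).1 ((hp d).1 hd).1 he
  · intro c hc
    obtain ⟨h1, h2, h3⟩ := mem_filter.1 hc
    obtain ⟨d, hd, rfl⟩ := hψ.surjOn h1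
    refine ⟨d, (hp d).2 ⟨hd, h2, ?_⟩, rfl⟩
    rw [h _ hd, h' _ hd]
    exact h3
  · intro c hc
    have h1 := mem_filter.1 ((hp c).1 hc).1
    rw [colLen_colRank hlam ((mem_cells (isShape_lamB hlam univ)).1 h1.1).1 h1.2]

lemma toK_macH_lamB (B : Finset (Fin (r+1))) (N : ℕ) : toK (macH (lamB lam B) N) =
    fillPoly (colCells lam B) N fun σ => qK ^ invIn lam σ B * tK ^ majIn lam σ B := by
  rw [toK_macH]
  refine fillPoly_transport _ (bijOn_colRank hlam) N _ _ fun σ hσ => ?_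
  have h : ∀ c ∈ colCells lam B, restr (colCells lam B)
      (σ ∘ fun c : ℕ × ℕ => (colRank lam B c.1, c.2)) c = σ (colRank lam B c.1, c.2) :=
    fun c hc => restr_of_mem hc
  have h' : ∀ c ∈ colCells lam B, restr (colCells lam B)
      (σ ∘ fun c : ℕ × ℕ => (colRank lam B c.1, c.2)) (c.1, c.2 - 1) =
        σ (colRank lam B c.1, c.2 - 1) := by
    intro c hc
    by_cases h2 : 1 ≤ c.2 - 1
    · exact h _ (mem_colCells_of_row_le hlam hc h2 (Nat.sub_le _ _))
    · have h0 : ∀ x B', (x, c.2 - 1) ∉ cells (lamB lam B') := fun x B' hx =>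
        h2 ((mem_cells (isShape_lamB hlam B')).1 hx).2.1
      rw [restr_of_notMem (C := colCells lam B) fun hx => h0 _ _ (mem_filter.1 hx).1,
        (mem_fills.1 hσ).2 _ (h0 _ _)]
  rw [invStat_colRank hlam h h', majStat_colRank hlam h h']

end ColoredCells

/-! ### The cumulant as a generating polynomial -/

lemma fillPoly_congr {α F : Type*} [DecidableEq α] [CommRing F] {C : Finset α} {N : ℕ}
    {w w' : (α → ℕ) → F} (h : ∀ σ ∈ fills C N, w σ = w' σ) : fillPoly C N w = fillPoly C N w' :=
  sum_congr rfl fun σ hσ => by rw [h σ hσ]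

section CumulantExpansion

variable {r : ℕ} {lam : Fin (r+1) → ℕ → ℕ}

lemma invIn_congr {σ τ : ℕ × ℕ → ℕ} {B : Finset (Fin (r+1))} (h : ∀ c ∈ colCells lam B, τ c = σ c)
    (h' : ∀ c ∈ colCells lam B, τ (c.1, c.2 - 1) = σ (c.1, c.2 - 1)) :
    invIn lam τ B = invIn lam σ B := by
  rw [invIn, invIn]
  congr 1
  ext p
  rw [mem_filter, mem_filter, mem_invPairs, mem_invPairs]
  refine and_congr_left fun hB => and_congr_right fun hc => ?_
  have h1 : p.1 ∈ colCells lam B := mem_filter.2 ⟨hc.1, hB.1⟩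
  have h2 : p.2 ∈ colCells lam B := mem_filter.2 ⟨hc.2, hB.2⟩
  rw [invTriple, invTriple, h _ h1, h _ h2, h' _ h1]

lemma majIn_congr {σ τ : ℕ × ℕ → ℕ} {B : Finset (Fin (r+1))} (h : ∀ c ∈ colCells lam B, τ c = σ c)
    (h' : ∀ c ∈ colCells lam B, τ (c.1, c.2 - 1) = σ (c.1, c.2 - 1)) :
    majIn lam τ B = majIn lam σ B := by
  rw [majIn, majIn]
  refine sum_congr ?_ fun _ _ => rfl
  ext c
  rw [mem_filter, mem_filter, desSet, desSet, mem_filter, mem_filter]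
  refine and_congr_left fun hB => and_congr_right fun hc => ?_
  have h1 : c ∈ colCells lam B := mem_filter.2 ⟨hc, hB⟩
  rw [h _ h1, h' _ h1]

lemma sum_majIn {π : Finset (Finset (Fin (r+1)))} (hπ : IsSetPartition π univ) (σ : ℕ × ℕ → ℕ) :
    ∑ B ∈ π, majIn lam σ B = majStat (lamB lam univ) σ := by
  simp only [majIn, majStat, sum_filter]
  rw [sum_comm]
  refine sum_congr rfl fun c _ => ?_
  obtain ⟨B, hB, hc⟩ := hπ.2.2.2 (colColor lam c.1) (mem_univ _)
  rw [sum_eq_single B, if_pos hc]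
  · exact fun B' hB' hne => if_neg fun hc' => hne (hπ.eq_of_mem hB' hB hc' hc)
  · exact fun h => absurd hB h

variable (hlam : ∀ b, IsPartitionFun (lam b))
include hlam

lemma prod_toK_macH {π : Finset (Finset (Fin (r+1)))} (hπ : IsSetPartition π univ) (N : ℕ) :
    ∏ B ∈ π, toK (macH (lamB lam B) N) = fillPoly (cells (lamB lam univ)) N fun σ =>
      tK ^ majStat (lamB lam univ) σ * ∏ B ∈ π, qK ^ invIn lam σ B := by
  have hΛ := isShape_lamB hlam univ
  rw [prod_congr rfl fun B _ => toK_macH_lamB hlam B N, fillPoly_prod π (colCells lam)]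
  · have hU : π.biUnion (colCells lam) = cells (lamB lam univ) := by
      ext c
      rw [mem_biUnion]
      constructor
      · rintro ⟨B, -, hc⟩
        exact (mem_filter.1 hc).1
      · intro hc
        obtain ⟨B, hB, hcB⟩ := hπ.2.2.2 (colColor lam c.1) (mem_univ _)
        exact ⟨B, hB, mem_filter.2 ⟨hc, hcB⟩⟩
    rw [hU]
    refine fillPoly_congr fun σ hσ => ?_
    have h : ∀ B, ∀ c ∈ colCells lam B, restr (colCells lam B) σ c = σ c :=
      fun B c hc => restr_of_mem hc
    have h' : ∀ B, ∀ c ∈ colCells lam B,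
        restr (colCells lam B) σ (c.1, c.2 - 1) = σ (c.1, c.2 - 1) := by
      intro B c hc
      by_cases h2 : 1 ≤ c.2 - 1
      · exact h B _ (mem_colCells_of_row_le hlam hc h2 (Nat.sub_le _ _))
      · have h0 : (c.1, c.2 - 1) ∉ cells (lamB lam univ) := fun hx => h2 ((mem_cells hΛ).1 hx).2.1
        rw [restr_of_notMem (C := colCells lam B) fun hx => h0 (mem_filter.1 hx).1,
          (mem_fills.1 hσ).2 _ h0]
    have e : ∀ B ∈ π, qK ^ invIn lam (restr (colCells lam B) σ) B *
        tK ^ majIn lam (restr (colCells lam B) σ) B = qK ^ invIn lam σ B * tK ^ majIn lam σ B :=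
      fun B _ => by rw [invIn_congr (h B) (h' B), majIn_congr (h B) (h' B)]
    rw [prod_congr rfl e, prod_mul_distrib, prod_pow_eq_pow_sum π (majIn lam σ), sum_majIn hπ,
      mul_comm]
  · intro B hB B' hB' hne
    rw [disjoint_left]
    exact fun c hc hc' => hne (hπ.eq_of_mem hB hB' (mem_filter.1 hc).2 (mem_filter.1 hc').2)

omit hlam in
lemma toK_macCumulant_eq (N : ℕ) : toK (macCumulant lam N) =
    ∑ π ∈ setPartitions (univ : Finset (Fin (r+1))),
      MvPolynomial.C ((-1 : KField) ^ (π.card - 1) * ((π.card - 1).factorial : KField)) *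
        ∏ B ∈ π, toK (macH (lamB lam B) N) := by
  rw [macCumulant, map_sum]
  refine sum_congr rfl fun π _ => ?_
  simp only [map_mul, map_pow, map_neg, map_one, map_natCast, map_prod]

lemma toK_macCumulant (N : ℕ) : toK (macCumulant lam N) =
    fillPoly (cells (lamB lam univ)) N fun σ =>
      tK ^ majStat (lamB lam univ) σ * jointCumulant (fun B => qK ^ invIn lam σ B) univ := by
  have e : ∀ π ∈ setPartitions (univ : Finset (Fin (r+1))), ∏ B ∈ π, toK (macH (lamB lam B) N) =
      _ :=
    fun π hπ => prod_toK_macH hlam (mem_setPartitions.1 hπ) N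
  rw [toK_macCumulant_eq, sum_congr rfl fun π hπ => by rw [e π hπ]]
  simp only [fillPoly, mul_sum, jointCumulant, map_sum, sum_mul]
  rw [sum_comm]
  refine sum_congr rfl fun σ _ => sum_congr rfl fun π _ => ?_
  simp only [map_mul]
  ring

lemma toK_macCumulant_isSym (N : ℕ) : IsSym N (toK (macCumulant lam N)) := by
  rw [toK_macCumulant_eq]
  refine IsSym.sum fun π _ => IsSym.C_mul (IsSym.prod fun B _ => ?_) _
  rw [toK_macH]
  exact macPoly_isSym (isShape_lamB hlam B) qK_ne_zero tK N

omit hlam in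
lemma jointCumulant_inv (σ : ℕ × ℕ → ℕ) :
    jointCumulant (fun B => qK ^ invIn lam σ B) univ = (qK - 1) ^ r * Iinv (eG lam σ) qK := by
  refine Iinv_eq_jointCumulant _ (fun i j => ?_) _ _ ?_ fun v B hv => ?_
  · rw [eG, eG]
    simp only [or_comm]
  · rw [invIn]
    simp
  · rw [← pow_add]
    congr 1
    exact card_filter_insert_pair _ _ _ hv

end CumulantExpansion

/-! ### Hook fillings of the coloured diagram -/

section HookFilling

variable {f : ℕ → ℕ}

lemma below_mem (hf : IsShape f) {c : ℕ × ℕ} (hc : c ∈ cells f) (h2 : 2 ≤ c.2) :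
    (c.1, c.2 - 1) ∈ cells f := by
  rw [mem_cells hf] at hc ⊢
  exact ⟨hc.1, by dsimp only; omega,
    hc.2.2.trans (hf.1 _ _ (by dsimp only; omega) (Nat.sub_le _ _))⟩

lemma rdKey_lt_below {c d : ℕ × ℕ} (h : c.2 = d.2) (h2 : 2 ≤ c.2) (x : ℕ) :
    rdKey d < rdKey (x, c.2 - 1) :=
  rdKey_lt.2 (Or.inl (by dsimp only; omega))

/-- The conditions defining inversion pairs only involve comparisons along the reading order. -/
lemma invTriple_iff (hf : IsShape f) {σ : ℕ × ℕ → ℕ} (hpos : ∀ c ∈ cells f, 0 < σ c)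
    (h0 : ∀ c, c ∉ cells f → σ c = 0) {P : ℕ × ℕ → ℕ × ℕ → Prop}
    (hP : ∀ u ∈ cells f, ∀ w ∈ cells f, rdKey u < rdKey w → (σ w < σ u ↔ P u w))
    {c d : ℕ × ℕ} (hc : c ∈ cells f) (hd : d ∈ cells f) (hr : c.2 = d.2) (hlt : c.1 < d.1) :
    invTriple σ c d ↔ if 2 ≤ c.2 then
      (¬ P c (c.1, c.2 - 1) ∧ P d (c.1, c.2 - 1)) ∨ (P d (c.1, c.2 - 1) ∧ P c d) ∨
        (P c d ∧ ¬ P c (c.1, c.2 - 1)) else P c d := by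
  have h1 := hP c hc d hd (rdKey_lt.2 (Or.inr ⟨hr, hlt⟩))
  rw [invTriple, ← h1]
  split_ifs with h2
  · have hb := below_mem hf hc h2
    rw [← hP c hc _ hb (rdKey_lt_below rfl h2 _), ← hP d hd _ hb (rdKey_lt_below hr h2 _), not_lt]
  · have hb : (c.1, c.2 - 1) ∉ cells f := fun h => by
      have := ((mem_cells hf).1 h).2.1
      dsimp only at this
      omega
    have h3 := hpos c hc
    have h4 := hpos d hd
    rw [h0 _ hb]
    constructor
    · rintro (h | h | h) <;> omega
    · exact fun h => Or.inr (Or.inl ⟨h4, h⟩)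

lemma desSet_congr (hf : IsShape f) {σ τ : ℕ × ℕ → ℕ}
    (h : ∀ u ∈ cells f, ∀ w ∈ cells f, rdKey u < rdKey w → (σ w < σ u ↔ τ w < τ u)) :
    desSet f σ = desSet f τ := by
  ext c
  rw [desSet, desSet, mem_filter, mem_filter]
  exact and_congr_right fun hc => and_congr_right fun h2 =>
    h c hc _ (below_mem hf hc h2) (rdKey_lt_below rfl h2 _)

lemma invPairs_congr (hf : IsShape f) {N : ℕ} {σ τ : ℕ × ℕ → ℕ} (hσ : σ ∈ fills (cells f) N)
    (hτ : τ ∈ fills (cells f) N)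
    (h : ∀ u ∈ cells f, ∀ w ∈ cells f, rdKey u < rdKey w → (σ w < σ u ↔ τ w < τ u)) :
    invPairs f σ = invPairs f τ := by
  rw [mem_fills] at hσ hτ
  ext p
  rw [mem_invPairs, mem_invPairs]
  refine and_congr_right fun hc => and_congr_right fun hr => and_congr_right fun hlt => ?_
  rw [invTriple_iff hf (fun c hc => (hσ.1 c hc).1) hσ.2 h hc.1 hc.2 hr hlt,
    invTriple_iff hf (fun c hc => (hτ.1 c hc).1) hτ.2 (P := fun u w => τ w < τ u)
      (fun _ _ _ _ _ => Iff.rfl) hc.1 hc.2 hr hlt]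

lemma mem_invPairs_hookFill (hf : IsShape f) {D : Finset (ℕ × ℕ)} {s : ℕ} (hs : D.card ≤ s)
    (hD : D ⊆ cells f) {p : (ℕ × ℕ) × (ℕ × ℕ)} : p ∈ invPairs f (hookFill rdKey (cells f) s D) ↔
      (p.1 ∈ cells f ∧ p.2 ∈ cells f) ∧ p.1.2 = p.2.2 ∧ p.1.1 < p.2.1 ∧ p.2 ∈ D := by
  rw [mem_invPairs]
  refine and_congr_right fun hc => and_congr_right fun hr => and_congr_right fun hlt => ?_
  have hpos : ∀ c ∈ cells f, 0 < hookFill rdKey (cells f) s D c := fun c hc => by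
    by_cases h : c ∈ D
    · exact hookFill_pos h
    · exact hookFill_of_notMem (rd := rdKey) (s := s) h hc ▸ Nat.succ_pos s
  have h0 : ∀ c, c ∉ cells f → hookFill rdKey (cells f) s D c = 0 := fun c hc => by
    rw [hookFill, if_neg fun h => hc (hD h), if_neg hc]
  rw [invTriple_iff hf hpos h0
    (P := fun _ w => w ∈ D) (fun u hu w hw h => hookFill_lt_iff hs hu hw h) hc.1 hc.2 hr hlt]
  split_ifs
  · tauto
  · rfl

lemma majStat_hookFill (hf : IsShape f) {D : Finset (ℕ × ℕ)} {s : ℕ} (hs : D.card ≤ s)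
    (hD : D ⊆ cells f) : majStat f (hookFill rdKey (cells f) s D) =
      ∑ c ∈ D, (colLen f c.1 - c.2) := by
  rw [majStat, ← sum_filter_of_ne (s := D) (p := fun c => c.2 + 1 ≤ colLen f c.1)
    fun c _ hne => by omega]
  have hdes : ∀ c, c ∈ desSet f (hookFill rdKey (cells f) s D) ↔
      c ∈ cells f ∧ 2 ≤ c.2 ∧ (c.1, c.2 - 1) ∈ D := by
    intro c
    rw [desSet, mem_filter]
    exact and_congr_right fun hc => and_congr_right fun h2 =>
      hookFill_lt_iff hs hc (below_mem hf hc h2) (rdKey_lt_below rfl h2 _)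
  refine sum_bij' (fun c _ => (c.1, c.2 - 1)) (fun c _ => (c.1, c.2 + 1)) ?_ ?_ ?_ ?_ ?_
  · intro c hc
    obtain ⟨h1, h2, h3⟩ := (hdes c).1 hc
    rw [mem_cells hf] at h1
    refine mem_filter.2 ⟨h3, ?_⟩
    dsimp only
    rw [le_colLen hf h1.1 (by omega), Nat.sub_add_cancel (by omega)]
    exact h1.2.2
  · intro c hc
    obtain ⟨h1, h2⟩ := mem_filter.1 hc
    have h3 := (mem_cells hf).1 (hD h1)
    have h4 := h3.2.1
    rw [le_colLen hf h3.1 (by omega)] at h2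
    exact (hdes _).2 ⟨(mem_cells hf).2 ⟨h3.1, Nat.le_add_left _ _, h2⟩, by dsimp only; omega,
      by simpa using h1⟩
  · intro c hc
    have := ((hdes c).1 hc).2.1
    exact Prod.ext rfl (by dsimp only; omega)
  · intro c hc
    exact Prod.ext rfl (by dsimp only; omega)
  · intro c hc
    obtain ⟨h1, h2, -⟩ := (hdes c).1 hc
    rw [mem_cells hf] at h1
    have h3 := (le_colLen hf h1.1 h1.2.1).2 h1.2.2
    dsimp only
    omega

/-- Reflection of every column. -/
def reflectCell (f : ℕ → ℕ) (c : ℕ × ℕ) : ℕ × ℕ := (c.1, colLen f c.1 - c.2 + 1)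

lemma reflectCell_mem (hf : IsShape f) {c : ℕ × ℕ} (hc : c ∈ cells f) :
    reflectCell f c ∈ cells f := by
  rw [mem_cells hf] at hc
  have h := (le_colLen hf hc.1 hc.2.1).2 hc.2.2
  rw [reflectCell, mem_cells hf]
  exact ⟨hc.1, Nat.le_add_left _ _,
    (le_colLen hf hc.1 (Nat.le_add_left _ _)).1 (by omega)⟩

lemma reflectCell_reflectCell (hf : IsShape f) {c : ℕ × ℕ} (hc : c ∈ cells f) :
    reflectCell f (reflectCell f c) = c := by
  rw [mem_cells hf] at hc
  have h := (le_colLen hf hc.1 hc.2.1).2 hc.2.2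
  exact Prod.ext rfl (by simp only [reflectCell]; omega)

lemma reflectCell_injOn (hf : IsShape f) : Set.InjOn (reflectCell f) (cells f) := by
  intro c hc d hd h
  rw [← reflectCell_reflectCell hf hc, h, reflectCell_reflectCell hf hd]

lemma reflectCell_corner (hf : IsShape f) (h : (1, 1) ∈ cells f) :
    reflectCell f (1, 1) = (1, nRows f) := by
  rw [mem_cells hf] at h
  have h1 := (le_colLen hf le_rfl le_rfl).2 h.2.2
  have key : ∀ j, 1 ≤ j → (j ≤ colLen f 1 ↔ j ≤ nRows f) := fun j hj => by
    rw [le_colLen hf le_rfl hj, le_nRows hf hj, Nat.one_le_iff_ne_zero]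
  have h2 := (key 1 le_rfl).1 h1
  have h3 : colLen f 1 = nRows f :=
    le_antisymm ((key _ h1).1 le_rfl) ((key _ h2).2 le_rfl)
  rw [reflectCell, ← h3]
  exact Prod.ext rfl (Nat.sub_add_cancel h1)

end HookFilling

/-! ### The hook coefficients -/

section HookCoefficients

variable {r : ℕ} {lam : Fin (r+1) → ℕ → ℕ}

lemma eG_hookFill (hf : IsShape (lamB lam univ)) {D : Finset (ℕ × ℕ)} {s : ℕ} (hs : D.card ≤ s)
    (hD : D ⊆ cells (lamB lam univ)) :
    eG lam (hookFill rdKey (cells (lamB lam univ)) s D) = eBox lam D := by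
  funext i j
  rw [eG, eBox]
  refine card_nbij' Prod.swap Prod.swap ?_ ?_ (fun _ _ => rfl) (fun _ _ => rfl)
  · intro p hp
    simp only [mem_coe, mem_filter, mem_invPairs_hookFill hf hs hD, mem_product, Prod.swap]
      at hp ⊢
    obtain ⟨⟨⟨h1, h2⟩, h3, h4, h5⟩, h6⟩ := hp
    exact ⟨⟨h5, h1⟩, h3, h4, h6⟩
  · intro p hp
    simp only [mem_coe, mem_filter, mem_invPairs_hookFill hf hs hD, mem_product, Prod.swap]
      at hp ⊢
    obtain ⟨⟨h1, h2⟩, h3, h4, h5⟩ := hp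
    exact ⟨⟨⟨h2, hD h1⟩, h3, h4, h1⟩, h5⟩

lemma image_reflectCell_subset {f : ℕ → ℕ} (hf : IsShape f) {D : Finset (ℕ × ℕ)}
    (hD : D ⊆ cells f) : D.image (reflectCell f) ⊆ cells f :=
  image_subset_iff.2 fun _ hc => reflectCell_mem hf (hD hc)

lemma image_reflectCell_image {f : ℕ → ℕ} (hf : IsShape f) {D : Finset (ℕ × ℕ)}
    (hD : D ⊆ cells f) : (D.image (reflectCell f)).image (reflectCell f) = D := by
  rw [image_image]
  exact (image_congr fun c hc => reflectCell_reflectCell hf (hD hc)).trans image_id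

lemma mem_cells_of_left {f : ℕ → ℕ} (hf : IsShape f) {c : ℕ × ℕ} {x : ℕ} (hc : c ∈ cells f)
    (h1 : 1 ≤ x) (hx : x < c.1) : (x, c.2) ∈ cells f := by
  rw [mem_cells hf] at hc ⊢
  exact ⟨h1, hc.2.1, hx.le.trans hc.2.2⟩

/-- Only the columns of the boxes matter for the multigraph attached to a set of boxes. -/
lemma eBox_image_reflectCell (hf : IsShape (lamB lam univ)) {D : Finset (ℕ × ℕ)}
    (hD : D ⊆ cells (lamB lam univ)) :
    eBox lam (D.image (reflectCell (lamB lam univ))) = eBox lam D := by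
  funext i j
  rw [eBox, eBox]
  symm
  have left : ∀ p : (ℕ × ℕ) × (ℕ × ℕ), p.2 ∈ cells (lamB lam univ) → 1 ≤ p.2.1 := fun p hp =>
    ((mem_cells hf).1 hp).1
  have maps : ∀ {D' D'' : Finset (ℕ × ℕ)}, D' ⊆ cells (lamB lam univ) →
      (∀ c ∈ D', reflectCell (lamB lam univ) c ∈ D'') → ∀ p ∈ (D' ×ˢ cells (lamB lam univ)).filter
        (fun pr => pr.2.2 = pr.1.2 ∧ pr.2.1 < pr.1.1 ∧
          ((colColor lam pr.2.1 = i ∧ colColor lam pr.1.1 = j) ∨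
            (colColor lam pr.2.1 = j ∧ colColor lam pr.1.1 = i))),
      (reflectCell (lamB lam univ) p.1, (p.2.1, (reflectCell (lamB lam univ) p.1).2)) ∈
        (D'' ×ˢ cells (lamB lam univ)).filter
        (fun pr => pr.2.2 = pr.1.2 ∧ pr.2.1 < pr.1.1 ∧
          ((colColor lam pr.2.1 = i ∧ colColor lam pr.1.1 = j) ∨
            (colColor lam pr.2.1 = j ∧ colColor lam pr.1.1 = i))) := by
    intro D' D'' hD' hmap p hp
    rw [mem_filter, mem_product] at hp ⊢
    obtain ⟨⟨h1, h2⟩, -, h4, h5⟩ := hp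
    exact ⟨⟨hmap _ h1, mem_cells_of_left hf (reflectCell_mem hf (hD' h1)) (left _ h2) h4⟩,
      rfl, h4, h5⟩
  have inv : ∀ {D' : Finset (ℕ × ℕ)}, D' ⊆ cells (lamB lam univ) → ∀ p ∈ (D' ×ˢ
      cells (lamB lam univ)).filter (fun pr => pr.2.2 = pr.1.2 ∧ pr.2.1 < pr.1.1 ∧
          ((colColor lam pr.2.1 = i ∧ colColor lam pr.1.1 = j) ∨
            (colColor lam pr.2.1 = j ∧ colColor lam pr.1.1 = i))),
      (reflectCell (lamB lam univ) (reflectCell (lamB lam univ) p.1),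
        (p.2.1, (reflectCell (lamB lam univ) (reflectCell (lamB lam univ) p.1)).2)) = p := by
    intro D' hD' p hp
    rw [mem_filter, mem_product] at hp
    rw [reflectCell_reflectCell hf (hD' hp.1.1), ← hp.2.1]
  refine card_nbij' (fun p => (reflectCell (lamB lam univ) p.1,
      (p.2.1, (reflectCell (lamB lam univ) p.1).2)))
    (fun p => (reflectCell (lamB lam univ) p.1, (p.2.1, (reflectCell (lamB lam univ) p.1).2)))
    (maps hD fun c hc => mem_image_of_mem _ hc)
    (maps (image_reflectCell_subset hf hD) fun c hc => ?_) (inv hD)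
    (inv (image_reflectCell_subset hf hD))
  rw [← image_reflectCell_image hf hD]
  exact mem_image_of_mem _ hc

lemma sum_image_reflectCell {f : ℕ → ℕ} (hf : IsShape f) {D : Finset (ℕ × ℕ)}
    (hD : D ⊆ cells f) :
    ∑ c ∈ D.image (reflectCell f), (colLen f c.1 - c.2) = ∑ c ∈ D, (c.2 - 1) := by
  rw [sum_image ((reflectCell_injOn hf).mono (coe_subset.2 hD))]
  refine sum_congr rfl fun c hc => ?_
  obtain ⟨h1, h2, h3⟩ := (mem_cells hf).1 (hD hc)
  have h4 := (le_colLen hf h1 h2).2 h3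
  simp only [reflectCell]
  omega

lemma image_reflectCell_mem {f : ℕ → ℕ} (hf : IsShape f) {s : ℕ} {a : ℕ × ℕ} (ha : a ∈ cells f)
    {D : Finset (ℕ × ℕ)} (hD : D ∈ ((cells f).erase a).powersetCard s) :
    D.image (reflectCell f) ∈ ((cells f).erase (reflectCell f a)).powersetCard s := by
  rw [mem_powersetCard] at hD ⊢
  have hD' := hD.1.trans (erase_subset _ _)
  refine ⟨fun c hc => ?_, ?_⟩
  · obtain ⟨d, hd, rfl⟩ := mem_image.1 hc
    have hd' := mem_erase.1 (hD.1 hd)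
    exact mem_erase.2 ⟨fun h => hd'.1 (reflectCell_injOn hf hd'.2 ha h),
      reflectCell_mem hf hd'.2⟩
  · rw [card_image_of_injOn ((reflectCell_injOn hf).mono (coe_subset.2 hD')), hD.2]

/-- Reflecting the columns moves the omitted corner from the top to the bottom row. -/
lemma sum_powersetCard_reflectCell {f : ℕ → ℕ} (hf : IsShape f) (h1 : (1, 1) ∈ cells f) (s : ℕ)
    {M : Type*} [AddCommMonoid M] (F : Finset (ℕ × ℕ) → M) :
    ∑ D ∈ ((cells f).erase (1, nRows f)).powersetCard s, F D =
      ∑ D ∈ ((cells f).erase (1, 1)).powersetCard s, F (D.image (reflectCell f)) := by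
  have hc := reflectCell_corner hf h1
  have hc' : reflectCell f (1, nRows f) = (1, 1) := by rw [← hc, reflectCell_reflectCell hf h1]
  have hmem : (1, nRows f) ∈ cells f := hc ▸ reflectCell_mem hf h1
  symm
  refine sum_nbij' (image (reflectCell f)) (image (reflectCell f)) (fun D hD => ?_)
    (fun D hD => ?_) (fun D hD => ?_) (fun D hD => ?_) fun _ _ => rfl
  · exact hc ▸ image_reflectCell_mem hf h1 hD
  · exact hc' ▸ image_reflectCell_mem hf hmem hD
  · exact image_reflectCell_image hf ((mem_powersetCard.1 hD).1.trans (erase_subset _ _))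
  · exact image_reflectCell_image hf ((mem_powersetCard.1 hD).1.trans (erase_subset _ _))

lemma map_Iinv {R S : Type*} [CommSemiring R] [CommSemiring S] (φ : R →+* S)
    (e : Fin (r+1) → Fin (r+1) → ℕ) (q : R) : φ (Iinv e q) = Iinv e (φ q) := by
  simp only [Iinv, nq, map_mul, map_sum, map_pow, map_prod]

/-- The hook functional of the Macdonald cumulant. -/
lemma hookL_toK_macCumulant (hlam : ∀ b, IsPartitionFun (lam b)) {N s : ℕ}
    (hs : s + 1 ≤ (cells (lamB lam univ)).card) (hN : s + 1 ≤ N) :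
    hookL s (toK (macCumulant lam N)) =
      (qK - 1) ^ r * algebraMap (MvPolynomial (Fin 2) ℤ) KField (hookCoeff lam s) := by
  have hf := isShape_lamB hlam univ
  obtain ⟨hc0, hmin⟩ := corner_mem hf (card_pos.1 (by omega))
  have h11 : (1, 1) ∈ cells (lamB lam univ) := by
    obtain ⟨h1, h2, h3⟩ := (mem_cells hf).1 hc0
    exact (mem_cells hf).2 ⟨le_rfl, le_rfl, h3.trans (hf.1 _ _ le_rfl h2)⟩
  rw [toK_macCumulant hlam, hookL_fillPoly rdKey_injective hs hN hc0 hmin,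
    sum_powersetCard_reflectCell hf h11, hookCoeff, map_sum, mul_sum]
  · refine sum_congr rfl fun D hD => ?_
    obtain ⟨hD, hcard⟩ := mem_powersetCard.1 hD
    have hD' := hD.trans (erase_subset _ _)
    have hi := image_reflectCell_subset hf hD'
    have hle : (D.image (reflectCell (lamB lam univ))).card ≤ s := card_image_le.trans hcard.le
    rw [majStat_hookFill hf hle hi, sum_image_reflectCell hf hD', jointCumulant_inv,
      eG_hookFill hf hle hi, eBox_image_reflectCell hf hD', map_mul, map_pow, map_Iinv]
    rw [← qK, ← tK]
    ring
  · intro σ hσ τ hτ h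
    simp only [majStat, invIn, desSet_congr hf h, invPairs_congr hf hσ hτ h]

end HookCoefficients

/-- **Theorem 5.1** (multivariate `q,t`-Kostka numbers for hooks, in `N` variables):
the Schur-expansion coefficients of the Macdonald cumulant exist and are unique, and for
every hook `(n-s, 1^s)` the coefficient is the explicit polynomial `hookCoeff` with
nonnegative integer coefficients. -/
theorem stmt16 (r N n : ℕ) (lam : Fin (r+1) → ℕ → ℕ) (hlam : ∀ b, IsPartitionFun (lam b))
    (hn : n = (cells (lamB lam univ)).card) (hn1 : 1 ≤ n) (hN : n ≤ N) :
    (∃! K : (ℕ → ℕ) → KField, SchurExpansion lam N n K) ∧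
    ∀ K : (ℕ → ℕ) → KField, SchurExpansion lam N n K →
      ∀ s : ℕ, s ≤ n - 1 →
        K (hookFun n s) = algebraMap (MvPolynomial (Fin 2) ℤ) KField (hookCoeff lam s) := by
  have hf := isShape_lamB hlam univ
  have hc : algebraMap (MvPolynomial (Fin 2) ℤ) KField ((MvPolynomial.X 0 - 1) ^ r) =
      (qK - 1) ^ r := by
    rw [map_pow, map_sub, map_one, qK]
  refine ⟨?_, fun K hK s hs => ?_⟩
  · have hh : IsHomog n N (toK (macCumulant lam N)) := by
      rw [toK_macCumulant hlam, hn]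
      exact fillPoly_isHomog _ _ _
    exact existsUnique_schur_expansion (toK_macCumulant_isSym hlam N) hh
      (hc ▸ pow_ne_zero r qK_ne_one)
  · have h1 := hookL_toK_macCumulant (N := N) (s := s) hlam (by omega) (by omega)
    rw [hK.2, hc, hookL_C_mul, map_sum] at h1
    rw [← mul_left_cancel₀ (pow_ne_zero r qK_ne_one) h1,
      sum_eq_single_of_mem _ (hookFun_mem hn1 hN hs), hookL_C_mul,
      hookL_schurK hn1 hN hs (hookFun_mem hn1 hN hs), if_pos rfl, mul_one]
    intro m hm hne
    rw [hookL_C_mul, hookL_schurK hn1 hN hs hm, if_neg hne, mul_zero]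

end
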